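/- arXiv:2008.03583 — 4 statements merged into one kernel-verified Lean document; each statement's English description precedes it below -/
import Mathlib

section
/- If A is a finite-dimensional unital C*-algebra, then for every unital C*-algebra B and every π ∈ Rep(A,B), the unitary orbit U_B(π) is a closed subset of Rep(A,B); that is, every unital *-homomorphism ρ: A → B that is a pointwise-norm limit of unitary conjugates u* π(·) u of π is itself of the form w* π(·) w for some unitary w ∈ B. -/
/-- The unitary orbit of a unital *-homomorphism `π : A → B`, as a set of functions `A → B`
(with the topology of pointwise norm convergence, i.e. the product topology). -/
def unitaryOrbit {A B : Type*} [CStarAlgebra A] [CStarAlgebra B] (π : A →⋆ₐ[ℂ] B) :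
    Set (A → B) :=
  {f | ∃ u ∈ unitary B, f = fun a => star u * π a * u}

open MeasureTheory Topology

/-- The unitary group of a finite-dimensional C*-algebra is compact. -/
lemma compactSpace_unitary_of_finiteDimensional (A : Type*) [CStarAlgebra A]
    [FiniteDimensional ℂ A] : CompactSpace (unitary A) := by
  have : ProperSpace A := FiniteDimensional.proper ℂ A
  refine isCompact_iff_compactSpace.mp
    (Metric.isCompact_of_isClosed_isBounded (isClosed_unitary (R := A)) ?_)
  refine (Metric.isBounded_closedBall (x := (0 : A)) (r := 1)).subset fun v hv => ?_
  rw [mem_closedBall_zero_iff]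
  rcases subsingleton_or_nontrivial A with hA | hA
  · simp [Subsingleton.elim v 0]
  · exact (CStarRing.norm_of_mem_unitary hv).le

/-- Averaging `v ↦ π v * y * ρ (star v)` over the unitary group of a finite-dimensional
C*-algebra gives an intertwiner close to `y` when all these elements are close to `y`. -/
lemma exists_intertwiner_norm_sub_le {A B : Type*} [CStarAlgebra A] [FiniteDimensional ℂ A]
    [CStarAlgebra B] (π ρ : A →⋆ₐ[ℂ] B) (y : B) (c : ℝ)
    (h : ∀ v ∈ unitary A, ‖π v * y * ρ (star v) - y‖ ≤ c) :
    ∃ x : B, ‖x - y‖ ≤ c ∧ ∀ a, π a * x = x * ρ a := by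
  have : CompactSpace (unitary A) := compactSpace_unitary_of_finiteDimensional A
  let : MeasurableSpace (unitary A) := borel _
  have : BorelSpace (unitary A) := ⟨rfl⟩
  let μ : Measure (unitary A) := Measure.haarMeasure ⊤
  have : IsProbabilityMeasure μ := ⟨by
    simpa using Measure.haarMeasure_self (K₀ := (⊤ : TopologicalSpace.PositiveCompacts (unitary A)))⟩
  let F : unitary A → B := fun v => π v * y * ρ (star (v : A))
  have hπ : Continuous π := π.toAlgHom.toLinearMap.continuous_of_finiteDimensional
  have hρ : Continuous ρ := ρ.toAlgHom.toLinearMap.continuous_of_finiteDimensional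
  have hF : Continuous F := by
    have h1 : Continuous fun v : unitary A => π v := hπ.comp continuous_subtype_val
    have h2 : Continuous fun v : unitary A => ρ (star (v : A)) :=
      hρ.comp (continuous_star.comp continuous_subtype_val)
    exact (h1.mul continuous_const).mul h2
  have hFi : Integrable F μ :=
    hF.integrable_of_hasCompactSupport (HasCompactSupport.of_compactSpace F)
  refine ⟨∫ v, F v ∂μ, ?_, fun a => ?_⟩
  · have h1 : ∫ v, (F v - y) ∂μ = (∫ v, F v ∂μ) - y := by
      rw [integral_sub hFi (integrable_const y)]
      simp
    rw [← h1]
    simpa using norm_integral_le_of_norm_le_const (μ := μ) (f := fun v => F v - y)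
      (Filter.Eventually.of_forall fun v => h v v.2)
  · have hu : ∀ g : unitary A, π g * ∫ v, F v ∂μ = (∫ v, F v ∂μ) * ρ g := by
      intro g
      have h1 : π g * ∫ v, F v ∂μ = ∫ v, π g * F v ∂μ :=
        ((ContinuousLinearMap.mul ℂ B (π g)).integral_comp_comm hFi).symm
      have h2 : (∫ v, F v ∂μ) * ρ g = ∫ v, F v * ρ g ∂μ :=
        (((ContinuousLinearMap.mul ℂ B).flip (ρ g)).integral_comp_comm hFi).symm
      rw [h1, h2, ← integral_mul_left_eq_self (μ := μ) (fun v => F v * ρ g) g]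
      congr 1
      ext v
      have h3 : ρ (star (g : A)) * ρ g = 1 := by
        rw [← map_mul, Unitary.coe_star_mul_self, map_one]
      simp only [F, Submonoid.coe_mul, star_mul, map_mul, mul_assoc, h3, mul_one]
    have ha : a ∈ Submodule.span ℂ (unitary A : Set A) := by
      rw [CStarAlgebra.span_unitary]; trivial
    induction ha using Submodule.span_induction with
    | mem v hv => exact hu ⟨v, hv⟩
    | zero => simp
    | add a b _ _ ha hb => rw [map_add, map_add, add_mul, mul_add, ha, hb]
    | smul z a _ ha => rw [map_smul, map_smul, smul_mul_assoc, mul_smul_comm, ha]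

/-- The unitary part of an invertible intertwiner of two *-homomorphisms intertwines them. -/
lemma exists_unitary_intertwiner_of_isUnit {A B : Type*} [CStarAlgebra A] [CStarAlgebra B]
    (π ρ : A →⋆ₐ[ℂ] B) {x : B} (hx : IsUnit x) (h : ∀ a, π a * x = x * ρ a) :
    ∃ w ∈ unitary B, ∀ a, ρ a = star w * π a * w := by
  let := CStarAlgebra.spectralOrder B
  have := CStarAlgebra.spectralOrderedRing B
  have h' : ∀ a, star x * π a = ρ a * star x := fun a => by
    simpa [← map_star] using congrArg star (h (star a))
  have hcomm : ∀ a, Commute (star x * x) (ρ a) := fun a => by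
    change star x * x * ρ a = ρ a * (star x * x)
    rw [mul_assoc, ← h, ← mul_assoc, h', mul_assoc]
  have hnn : 0 ≤ star x * x := star_mul_self_nonneg x
  have hs : IsUnit (CFC.sqrt (star x * x)) :=
    (CFC.isUnit_sqrt_iff _ hnn).mpr (hx.star.mul hx)
  have hss : CFC.sqrt (star x * x) * CFC.sqrt (star x * x) = star x * x :=
    CFC.sqrt_mul_sqrt_self _ hnn
  have hsa : star (CFC.sqrt (star x * x)) = CFC.sqrt (star x * x) :=
    (CFC.sqrt_nonneg (star x * x)).isSelfAdjoint
  have hsc : ∀ a, Commute (CFC.sqrt (star x * x)) (ρ a) := fun a => by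
    rw [CFC.sqrt_eq_cfc]
    exact (hcomm a).cfc_nnreal _
  obtain ⟨s, hs⟩ := hs
  rw [← hs] at hss hsa hsc
  have hsi : star (↑s⁻¹ : B) = ↑s⁻¹ := by
    have : star s = s := Units.ext hsa
    rw [← Units.coe_star, star_inv, this]
  have hw : star (x * ↑s⁻¹) * (x * ↑s⁻¹) = 1 := by
    rw [star_mul, hsi, mul_assoc, ← mul_assoc (star x), ← hss]
    simp [mul_assoc]
  have hwu : IsUnit (x * ↑s⁻¹) := hx.mul s⁻¹.isUnit
  refine ⟨x * ↑s⁻¹, ⟨hw, ?_⟩, fun a => ?_⟩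
  · obtain ⟨t, ht⟩ := hwu
    rw [← ht] at hw ⊢
    rw [← Units.inv_eq_of_mul_eq_one_left hw, Units.mul_inv]
  · have h1 : ↑s⁻¹ * ρ a = ρ a * ↑s⁻¹ := (hsc a).units_inv_left
    rw [mul_assoc, ← mul_assoc (π a), h, mul_assoc x, ← h1, ← mul_assoc x, ← mul_assoc, hw, one_mul]

/-- On a finite-dimensional C*-algebra, a linear map in the pointwise closure of a set of linear
maps is approximated by that set uniformly on the unitary group. -/
lemma exists_norm_sub_lt_of_mem_closure {A B : Type*} [CStarAlgebra A] [FiniteDimensional ℂ A]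
    [CStarAlgebra B] {S : Set (A → B)} (hS : ∀ f ∈ S, IsLinearMap ℂ f) (ρ : A →ₗ[ℂ] B)
    (hρ : ⇑ρ ∈ closure S) {ε : ℝ} (hε : 0 < ε) :
    ∃ f ∈ S, ∀ v ∈ unitary A, ‖f v - ρ v‖ < ε := by
  have : CompactSpace (unitary A) := compactSpace_unitary_of_finiteDimensional A
  let b := Module.finBasis ℂ A
  have hcont : Continuous fun v : unitary A => ∑ i, ‖b.repr (v : A) i‖ := by
    refine continuous_finsetSum _ fun i _ => continuous_norm.comp ?_
    exact ((b.coord i).continuous_of_finiteDimensional).comp continuous_subtype_val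
  obtain ⟨C, hC⟩ := (isCompact_range hcont).bddAbove
  have hC' : ∀ v : unitary A, ∑ i, ‖b.repr (v : A) i‖ ≤ C := fun v => hC ⟨v, rfl⟩
  have hC0 : 0 ≤ C := le_trans (Finset.sum_nonneg fun i _ => norm_nonneg _) (hC' 1)
  have hδ : 0 < ε / (C + 1) := by positivity
  have hnhds : {f : A → B | ∀ i, ‖f (b i) - ρ (b i)‖ < ε / (C + 1)} ∈ 𝓝 (⇑ρ) := by
    refine IsOpen.mem_nhds ?_ (fun i => by simpa using hδ)
    simp only [Set.ofPred_forall]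
    exact isOpen_iInter_of_finite fun i =>
      isOpen_lt (((continuous_apply (b i)).sub continuous_const).norm) continuous_const
  obtain ⟨f, hf, hfS⟩ := mem_closure_iff_nhds.mp hρ _ hnhds
  refine ⟨f, hfS, fun v hv => ?_⟩
  let L : A →ₗ[ℂ] B := (hS f hfS).mk' f - ρ
  have hL : f v - ρ v = ∑ i, b.repr v i • L (b i) := by
    calc f v - ρ v = L (∑ i, b.repr v i • b i) := by rw [b.sum_repr]; rfl
      _ = ∑ i, b.repr v i • L (b i) := by simp only [map_sum, map_smul]
  calc ‖f v - ρ v‖ ≤ ∑ i, ‖b.repr v i‖ * (ε / (C + 1)) := by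
        rw [hL]
        refine norm_sum_le_of_le _ fun i _ => ?_
        rw [norm_smul]
        exact mul_le_mul_of_nonneg_left (hf i).le (norm_nonneg _)
    _ ≤ C * (ε / (C + 1)) := by
        rw [← Finset.sum_mul]
        exact mul_le_mul_of_nonneg_right (hC' ⟨v, hv⟩) hδ.le
    _ < ε := by
        rw [mul_div_assoc', div_lt_iff₀ (by positivity)]
        nlinarith

theorem stmt2 (A B : Type*) [CStarAlgebra A] [FiniteDimensional ℂ A] [CStarAlgebra B]
    (π ρ : A →⋆ₐ[ℂ] B) (hρ : ⇑ρ ∈ closure (unitaryOrbit π)) :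
    ∃ w ∈ unitary B, ∀ a : A, ρ a = star w * π a * w := by
  have hlin : ∀ f ∈ unitaryOrbit π, IsLinearMap ℂ f := by
    rintro f ⟨u, -, rfl⟩
    exact ⟨fun a b => by simp [mul_add, add_mul], fun z a => by simp⟩
  obtain ⟨f, ⟨u, hu, rfl⟩, hf⟩ := exists_norm_sub_lt_of_mem_closure hlin
    ρ.toAlgHom.toLinearMap hρ (ε := 1 / 2) (by norm_num)
  obtain ⟨x, hxu, hx⟩ := exists_intertwiner_norm_sub_le π ρ u (1 / 2) fun v hv => by
    have h1 : ρ v * ρ (star v) = 1 := by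
      rw [← map_mul, Unitary.mul_star_self_of_mem hv, map_one]
    have h2 : π v * u * ρ (star v) - u = u * (star u * π v * u - ρ v) * ρ (star v) := by
      simp only [mul_sub, sub_mul, ← mul_assoc, Unitary.mul_star_self_of_mem hu, one_mul]
      rw [mul_assoc u (ρ v), h1, mul_one]
    rw [h2, CStarRing.norm_mul_mem_unitary _ (Unitary.map_mem ρ (Unitary.star_mem hv)),
      CStarRing.norm_mem_unitary_mul _ hu]
    exact (hf v hv).le
  refine exists_unitary_intertwiner_of_isUnit π ρ ?_ hx
  have h1 : ‖1 - star u * x‖ < 1 := by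
    rw [← Unitary.star_mul_self_of_mem hu, ← mul_sub,
      CStarRing.norm_mem_unitary_mul _ (Unitary.star_mem hu), norm_sub_rev]
    linarith
  have h2 : IsUnit (star u * x) := by
    simpa using (Units.oneSub _ h1).isUnit
  have h3 : IsUnit u := ⟨Unitary.toUnits ⟨u, hu⟩, rfl⟩
  have h4 : x = u * (star u * x) := by
    rw [← mul_assoc, Unitary.mul_star_self_of_mem hu, one_mul]
  rw [h4]
  exact h3.mul h2
end

section
/- Suppose {A_λ : λ ∈ Λ} is an increasingly directed family of unital C*-subalgebras of a unital C*-algebra A (all containing the unit of A) such that the closure of ∪_{λ∈Λ} A_λ equals A, and each A_λ has property HUC. Then A has property HUC. Moreover, if each A_λ merely has property UC, then A has property UC. -/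
variable {A : Type*} [CStarAlgebra A]

/-- The unitary group of a subset `S` of a unital C*-algebra (unitaries of `A` lying in `S`). -/
def unitarySetIn (S : Set A) : Set A :=
  {u | u ∈ S ∧ star u * u = 1 ∧ u * star u = 1}

/-- Property UC for a C*-subalgebra (given as a subset): its unitary group is connected. -/
def PropUC (S : Set A) : Prop :=
  IsConnected (unitarySetIn S)

/-- Property HUC: for every projection `p` in `S`, the unitary group of the corner `pSp`
(with unit `p`) is connected. -/
def PropHUC (S : Set A) : Prop :=
  ∀ p ∈ S, IsSelfAdjoint p → p * p = p →
    IsConnected {u | u ∈ S ∧ p * u * p = u ∧ star u * u = p ∧ u * star u = p}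
/-- The unitary group of the corner of `S` cut out by `p`. -/
def cornerUnitarySet (p : A) (S : Set A) : Set A :=
  {u | u ∈ S ∧ p * u * p = u ∧ star u * u = p ∧ u * star u = p}

lemma norm_le_one_of_star_mul_self_eq_one {u : A} (hu : star u * u = 1) : ‖u‖ ≤ 1 := by
  nontriviality A
  have := CStarRing.norm_star_mul_self (x := u)
  rw [hu, CStarRing.norm_one] at this
  nlinarith [norm_nonneg u]

lemma norm_le_one_of_projection {p : A} (hs : IsSelfAdjoint p) (hp : p * p = p) : ‖p‖ ≤ 1 := by
  have := CStarRing.norm_star_mul_self (x := p)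
  rw [hs.star_eq, hp] at this
  by_contra! h
  nlinarith

lemma abs_inv_sqrt_sub_one_le {x : ℝ} (hx : 1 / 2 ≤ x) : |(√x)⁻¹ - 1| ≤ |x - 1| := by
  have h0 : 0 < √x := Real.sqrt_pos.2 (by linarith)
  have hsq : √x * √x = x := Real.mul_self_sqrt (by linarith)
  have h1 : (1 : ℝ) / 2 ≤ √x := by nlinarith
  have hd : x - 1 = ((√x)⁻¹ - 1) * -(√x * (1 + √x)) := by
    field_simp
    linarith
  rw [hd, abs_mul, abs_neg, abs_of_pos (by positivity : 0 < √x * (1 + √x))]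
  exact le_mul_of_one_le_right (abs_nonneg _) (by nlinarith)

lemma mem_of_cfc_real {T : StarSubalgebra ℂ A} (hT : IsClosed (T : Set A)) {b : A} (hb : b ∈ T)
    (hsa : IsSelfAdjoint b) (f : ℝ → ℝ) : cfc f b ∈ T := by
  rw [cfc_real_eq_complex f hsa]
  exact StarAlgebra.elemental.le_of_mem hT hb (cfc_mem_elemental _ _)

/-- The inverse square root of an element close to `1`. -/
lemma exists_inv_sqrt {b : A} (hsa : IsSelfAdjoint b) (hb : ‖b - 1‖ ≤ 1 / 2) :
    ∃ h : A, IsSelfAdjoint h ∧ h * b * h = 1 ∧ ‖h - 1‖ ≤ ‖b - 1‖ ∧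
      (∀ c, Commute c b → Commute c h) ∧
      ∀ T : StarSubalgebra ℂ A, IsClosed (T : Set A) → b ∈ T → h ∈ T := by
  have hspec : ∀ x ∈ spectrum ℝ b, |x - 1| ≤ ‖b - 1‖ := by
    intro x hx
    have : cfc (fun x : ℝ ↦ x - 1) b = b - 1 := by
      rw [cfc_sub .., cfc_id' ℝ b, cfc_const_one ℝ b]
    rw [← this]
    exact norm_apply_le_norm_cfc (fun x : ℝ ↦ x - 1) b hx
  have hhalf : ∀ x ∈ spectrum ℝ b, 1 / 2 ≤ x := fun x hx ↦ by
    linarith [(abs_le.1 ((hspec x hx).trans hb)).1]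
  have hpos : ∀ x ∈ spectrum ℝ b, 0 < √x := fun x hx ↦
    Real.sqrt_pos.2 (by linarith [hhalf x hx])
  have hcont : ContinuousOn (fun x : ℝ ↦ (√x)⁻¹) (spectrum ℝ b) :=
    Real.continuous_sqrt.continuousOn.inv₀ fun x hx ↦ (hpos x hx).ne'
  refine ⟨cfc (fun x : ℝ ↦ (√x)⁻¹) b, cfc_predicate _ _, ?_, ?_,
    fun c hc ↦ (hc.symm.cfc_real _).symm, fun T hT hbT ↦ mem_of_cfc_real hT hbT hsa _⟩
  · nth_rewrite 2 [← cfc_id' ℝ b]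
    rw [← cfc_mul .., ← cfc_mul .., ← cfc_const_one ℝ b]
    refine cfc_congr fun x hx ↦ ?_
    have h1 := hpos x hx
    have h2 : √x * √x = x := Real.mul_self_sqrt (by linarith [hhalf x hx])
    field_simp
    nlinarith
  · have : cfc (fun x : ℝ ↦ (√x)⁻¹ - 1) b = cfc (fun x : ℝ ↦ (√x)⁻¹) b - 1 := by
      rw [cfc_sub (fun x : ℝ ↦ (√x)⁻¹) (fun _ ↦ 1) b hcont continuousOn_const, cfc_const_one ℝ b]
    rw [← this]
    exact norm_cfc_le (norm_nonneg _) fun x hx ↦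
      (abs_inv_sqrt_sub_one_le (hhalf x hx)).trans (hspec x hx)

/-- Polar decomposition of an element `a` close to a unitary `u`. -/
lemma exists_polar {a u : A} (hu : star u * u = 1) (hu' : u * star u = 1)
    (ha : ‖a - u‖ ≤ 1 / 8) :
    ∃ h : A, IsSelfAdjoint h ∧ star (a * h) * (a * h) = 1 ∧ (a * h) * star (a * h) = 1 ∧
      ‖a * h - u‖ ≤ 7 * ‖a - u‖ ∧ (∀ c, Commute c (star a * a) → Commute c h) ∧
      ∀ T : StarSubalgebra ℂ A, IsClosed (T : Set A) → a ∈ T → h ∈ T := by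
  have hu1 := norm_le_one_of_star_mul_self_eq_one hu
  have ha1 : ‖a‖ ≤ 1 + ‖a - u‖ := by
    calc ‖a‖ = ‖u + (a - u)‖ := by rw [add_sub_cancel]
      _ ≤ _ := (norm_add_le _ _).trans (by linarith)
  have hb : ‖star a * a - 1‖ ≤ 3 * ‖a - u‖ := by
    have e : star a * a - 1 = star a * (a - u) + star (a - u) * u := by
      rw [← hu, star_sub]; noncomm_ring
    have h1 := norm_mul_le (star a) (a - u)
    have h2 := norm_mul_le (star (a - u)) u
    rw [norm_star] at h1 h2
    rw [e]
    refine (norm_add_le _ _).trans ?_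
    nlinarith [norm_nonneg (a - u)]
  obtain ⟨h, hsa, hbh, hn, hc, hT⟩ := exists_inv_sqrt (.star_mul_self a)
    (hb.trans (by linarith))
  have hw : star (a * h) * (a * h) = 1 := by
    rw [star_mul, hsa.star_eq, ← hbh]; noncomm_ring
  have hau : IsUnit a := by
    have h1 : IsUnit (star u * a) := by
      have h2 : ‖1 - star u * a‖ < 1 := by
        have : 1 - star u * a = star u * (u - a) := by rw [mul_sub, hu]
        rw [this]
        refine (norm_mul_le _ _).trans_lt ?_
        rw [norm_star, norm_sub_rev]
        nlinarith [norm_nonneg (a - u)]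
      simpa using isUnit_one_sub_of_norm_lt_one h2
    have h3 : IsUnit u := ⟨⟨u, star u, hu', hu⟩, rfl⟩
    simpa [← mul_assoc, hu'] using h3.mul h1
  have hhu : IsUnit h := by
    have h2 : ‖1 - h‖ < 1 := by rw [norm_sub_rev]; linarith
    simpa using isUnit_one_sub_of_norm_lt_one h2
  refine ⟨h, hsa, hw, ?_, ?_, hc, fun T hTc ha ↦ hT T hTc (mul_mem (star_mem ha) ha)⟩
  · obtain ⟨w, hw'⟩ := hau.mul hhu
    rw [← hw'] at hw ⊢
    rw [left_inv_eq_right_inv hw w.mul_inv, Units.mul_inv]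
  · have e : a * h - u = a * (h - 1) + (a - u) := by noncomm_ring
    rw [e]
    refine (norm_add_le _ _).trans ?_
    have := norm_mul_le a (h - 1)
    nlinarith [norm_nonneg (a - u), norm_nonneg (h - 1), norm_nonneg a]

lemma symmetry_of_projection {p : A} (hs : IsSelfAdjoint p) (hp : p * p = p) :
    star (2 * p - 1) = 2 * p - 1 ∧ (2 * p - 1) * (2 * p - 1) = 1 := by
  constructor
  · simp [hs.star_eq, two_mul]
  · have : (2 * p - 1) * (2 * p - 1) = 4 * (p * p) - 4 * p + 1 := by noncomm_ring
    rw [this, hp]; noncomm_ring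

/-- Projections close to a closed star subalgebra are close to projections in it. -/
lemma exists_projection_mem_near {T : StarSubalgebra ℂ A} (hT : IsClosed (T : Set A)) {p a : A}
    (hs : IsSelfAdjoint p) (hp : p * p = p) (ha : a ∈ T) (hap : ‖a - p‖ ≤ 1 / 16) :
    ∃ q ∈ T, IsSelfAdjoint q ∧ q * q = q ∧ ‖q - p‖ ≤ 7 * ‖a - p‖ := by
  obtain ⟨hs1, hs2⟩ := symmetry_of_projection hs hp
  set c : A := a + star a - 1 with hcdef
  have hcT : c ∈ T := sub_mem (add_mem ha (star_mem ha)) (one_mem T)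
  have hcs : star c = c := by simp [c, add_comm]
  have hcn : ‖c - (2 * p - 1)‖ ≤ 2 * ‖a - p‖ := by
    have e : c - (2 * p - 1) = (a - p) + star (a - p) := by
      rw [star_sub, hs.star_eq, hcdef]; noncomm_ring
    rw [e]
    refine (norm_add_le _ _).trans ?_
    rw [norm_star]; linarith
  obtain ⟨h, hsa, hw, -, hn, hcomm, hhT⟩ := exists_polar (u := 2 * p - 1) (a := c)
    (by rw [hs1, hs2]) (by rw [hs1, hs2]) (by linarith)
  have hch : Commute c h := hcomm c (by rw [hcs]; exact (Commute.refl c).mul_right (.refl c))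
  have hws : star (c * h) = c * h := by rw [star_mul, hsa.star_eq, hcs, hch.eq]
  set w := c * h with hwdef
  have hwT : w ∈ T := mul_mem hcT (hhT T hT hcT)
  refine ⟨(2⁻¹ : ℂ) • (w + 1), T.smul_mem (add_mem hwT (one_mem T)) _, ?_, ?_, ?_⟩
  · simp [IsSelfAdjoint, hws]
  · rw [hws] at hw
    have e : (w + 1) * (w + 1) = (2 : ℂ) • (w + 1) := by
      have : (w + 1) * (w + 1) = w * w + w + w + 1 := by noncomm_ring
      rw [this, hw, two_smul]; abel
    rw [smul_mul_smul_comm, e, smul_smul]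
    norm_num
  · have e : (2⁻¹ : ℂ) • (w + 1) - p = (2⁻¹ : ℂ) • (w - (2 * p - 1)) := by
      have : p = (2⁻¹ : ℂ) • (2 * p) := by
        rw [two_mul, ← two_smul ℂ p, smul_smul]; norm_num
      nth_rewrite 1 [this]
      rw [← smul_sub]
      congr 1
      abel
    rw [e, norm_smul]
    norm_num
    linarith

/-- Nearby projections are unitarily equivalent. -/
lemma exists_unitary_intertwining {p q : A} (hps : IsSelfAdjoint p) (hp : p * p = p)
    (hqs : IsSelfAdjoint q) (hq : q * q = q) (h : ‖q - p‖ ≤ 1 / 8) :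
    ∃ w : A, star w * w = 1 ∧ w * star w = 1 ∧ w * q = p * w := by
  obtain ⟨hs1, hs2⟩ := symmetry_of_projection hps hp
  set z : A := p * q + (1 - p) * (1 - q) with hz
  have hzq : z * q = p * z := by
    have e1 : z * q = p * (q * q) + (1 - p) * (q - q * q) := by rw [hz]; noncomm_ring
    have e2 : p * z = p * p * q + (p - p * p) * (1 - q) := by rw [hz]; noncomm_ring
    rw [e1, e2, hp, hq]; simp
  have hqz : q * star z = star z * p := by
    have := congrArg star hzq
    rwa [star_mul, star_mul, hps.star_eq, hqs.star_eq] at this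
  have hz1 : ‖z - 1‖ ≤ 1 / 8 := by
    have e : z - 1 = (2 * p - 1) * (q - p) := by
      have : (2 * p - 1) * (q - p) = 2 * (p * q) - 2 * (p * p) - q + p := by noncomm_ring
      rw [this, hp, hz]; noncomm_ring
    rw [e]
    refine (norm_mul_le _ _).trans ?_
    have := norm_le_one_of_star_mul_self_eq_one (u := 2 * p - 1) (by rw [hs1, hs2])
    nlinarith [norm_nonneg (q - p)]
  obtain ⟨k, -, h1, h2, -, hc, -⟩ := exists_polar (u := 1) (a := z) (by simp) (by simp) hz1
  have hqk : Commute q k := hc q <| by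
    rw [Commute, SemiconjBy, ← mul_assoc, hqz, mul_assoc, mul_assoc, hzq]
  refine ⟨z * k, h1, h2, ?_⟩
  rw [mul_assoc, ← hqk.eq, ← mul_assoc, hzq, mul_assoc]

lemma self_mem_cornerUnitarySet {q : A} {S : Set A} (hqS : q ∈ S) (hqs : IsSelfAdjoint q)
    (hq : q * q = q) : q ∈ cornerUnitarySet q S := by
  refine ⟨hqS, ?_, ?_, ?_⟩ <;> simp [hqs.star_eq, hq]

/-- Corner unitaries close to a closed star subalgebra containing the projection are close to
corner unitaries in it. -/
lemma exists_mem_cornerUnitarySet_near {T : StarSubalgebra ℂ A} (hT : IsClosed (T : Set A))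
    {q u a : A} (hqT : q ∈ T) (hqs : IsSelfAdjoint q) (hq : q * q = q)
    (hu : u ∈ cornerUnitarySet q Set.univ) (ha : a ∈ T) (hau : ‖a - u‖ ≤ 1 / 8) :
    ∃ x ∈ cornerUnitarySet q (T : Set A), ‖x - u‖ ≤ 7 * ‖a - u‖ := by
  obtain ⟨-, huq, hu1, hu2⟩ := hu
  have hq1 := norm_le_one_of_projection hqs hq
  have hqu : q * u = u := by
    rw [← huq, ← mul_assoc, ← mul_assoc, hq]
  have huq' : u * q = u := by
    rw [← huq, mul_assoc, hq]
  have hsqu : star u * q = star u := by simpa [hqs.star_eq] using congrArg star hqu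
  have hsuq : q * star u = star u := by simpa [hqs.star_eq] using congrArg star huq'
  set b : A := q * a * q + (1 - q) with hb
  have hbT : b ∈ T := add_mem (mul_mem (mul_mem hqT ha) hqT) (sub_mem (one_mem T) hqT)
  have hqb : Commute q b := by
    have e1 : q * b = q * q * a * q + (q - q * q) := by rw [hb]; noncomm_ring
    have e2 : b * q = q * a * (q * q) + (q - q * q) := by rw [hb]; noncomm_ring
    rw [Commute, SemiconjBy, e1, e2, hq]
  have hqb' : Commute q (star b) := by simpa [hqs.star_eq] using hqb.star_star
  have hbn : ‖b - (u + (1 - q))‖ ≤ ‖a - u‖ := by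
    have e : b - (u + (1 - q)) = q * (a - u) * q := by
      rw [mul_sub, sub_mul, huq, hb]; abel
    rw [e]
    calc ‖q * (a - u) * q‖ ≤ ‖q‖ * ‖a - u‖ * ‖q‖ :=
          (norm_mul_le _ _).trans (by gcongr; exact norm_mul_le _ _)
      _ ≤ 1 * ‖a - u‖ * 1 := by gcongr
      _ = ‖a - u‖ := by ring
  obtain ⟨h, hsa, hw1, hw2, hn, hc, hhT⟩ := exists_polar (u := u + (1 - q)) (a := b)
    (by
      simp only [star_add, star_sub, star_one, hqs.star_eq]
      simp only [add_mul, mul_add, mul_sub, sub_mul, mul_one, one_mul, hu1, hsqu, hqu, hq]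
      abel)
    (by
      simp only [star_add, star_sub, star_one, hqs.star_eq]
      simp only [add_mul, mul_add, mul_sub, sub_mul, mul_one, one_mul, hu2, hsuq, huq', hq]
      abel) (hbn.trans hau)
  set w := b * h with hwdef
  have hqw : Commute q w := hqb.mul_right (hc q (hqb'.mul_right hqb))
  have hwT : w ∈ T := mul_mem hbT (hhT T hT hbT)
  refine ⟨q * w, ⟨mul_mem hqT hwT, ?_, ?_, ?_⟩, ?_⟩
  · rw [mul_assoc, mul_assoc, ← hqw.eq, ← mul_assoc q q w, hq, ← mul_assoc, hq]
  · rw [hqw.eq, star_mul, hqs.star_eq, mul_assoc, ← mul_assoc (star w), hw1, one_mul, hq]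
  · rw [star_mul, hqs.star_eq, mul_assoc, ← mul_assoc w, hw2, one_mul, hq]
  · have e : q * w - u = q * (w - (u + (1 - q))) := by
      simp only [mul_sub, mul_add, mul_one, hqu, hq]; abel
    rw [e]
    refine (norm_mul_le _ _).trans ?_
    nlinarith [norm_nonneg (w - (u + (1 - q)))]

lemma isConnected_cornerUnitarySet_univ {Λ : Type*} (S : Λ → StarSubalgebra ℂ A)
    (hclosed : ∀ l, IsClosed ((S l : Set A)))
    (hdir : ∀ l m : Λ, ∃ n : Λ, S l ≤ S n ∧ S m ≤ S n)
    (hdense : closure (⋃ l, ((S l : Set A))) = Set.univ) {q : A} {l : Λ} (hql : q ∈ S l)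
    (hqs : IsSelfAdjoint q) (hq : q * q = q)
    (hconn : ∀ m, q ∈ S m → IsConnected (cornerUnitarySet q (S m : Set A))) :
    IsConnected (cornerUnitarySet q (Set.univ : Set A)) := by
  have hU : IsPreconnected (⋃ m : {m // q ∈ S m}, cornerUnitarySet q (S m : Set A)) :=
    isPreconnected_iUnion
      ⟨q, Set.mem_iInter.2 fun m ↦ self_mem_cornerUnitarySet m.2 hqs hq⟩
      fun m ↦ (hconn m m.2).isPreconnected
  refine ⟨⟨q, self_mem_cornerUnitarySet (Set.mem_univ q) hqs hq⟩,
    hU.subset_closure (Set.iUnion_subset fun m x hx ↦ ⟨Set.mem_univ x, hx.2⟩) ?_⟩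
  intro u hu
  rw [Metric.mem_closure_iff]
  intro ε hε
  obtain ⟨a, ha, hau⟩ := Metric.mem_closure_iff.1 (hdense ▸ Set.mem_univ u : u ∈ closure _)
    (min (1 / 8) (ε / 7)) (by positivity)
  obtain ⟨m, ham⟩ := Set.mem_iUnion.1 ha
  obtain ⟨n, hln, hmn⟩ := hdir l m
  rw [dist_comm, dist_eq_norm, lt_min_iff] at hau
  obtain ⟨x, hx, hxu⟩ := exists_mem_cornerUnitarySet_near (hclosed n) (hln hql) hqs hq hu
    (hmn ham) hau.1.le
  refine ⟨x, Set.mem_iUnion.2 ⟨⟨n, hln hql⟩, hx⟩, ?_⟩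
  rw [dist_comm, dist_eq_norm]
  linarith [hau.2]

/-- A unitary intertwining two projections transports the unitaries of one corner onto those of
the other. -/
lemma image_conj_cornerUnitarySet {p q w : A} (h1 : star w * w = 1) (h2 : w * star w = 1)
    (hpq : w * q = p * w) :
    (fun x ↦ w * x * star w) '' cornerUnitarySet q Set.univ = cornerUnitarySet p Set.univ := by
  have key : ∀ {p q w : A}, star w * w = 1 → w * star w = 1 → w * q = p * w →
      ∀ x ∈ cornerUnitarySet q Set.univ, w * x * star w ∈ cornerUnitarySet p Set.univ := by
    intro p q w h1 h2 h x hx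
    have hp : p = w * q * star w := by rw [h, mul_assoc, h2, mul_one]
    have c1 : ∀ y, star w * (w * y) = y := fun y ↦ by rw [← mul_assoc, h1, one_mul]
    obtain ⟨-, hx1, hx2, hx3⟩ := hx
    refine ⟨Set.mem_univ _, ?_, ?_, ?_⟩
    · calc p * (w * x * star w) * p = w * (q * x * q) * star w := by
            simp only [hp, mul_assoc, c1]
        _ = w * x * star w := by rw [hx1]
    · rw [hp, ← hx2]
      simp only [star_mul, star_star, mul_assoc, c1]
    · rw [hp, ← hx3]
      simp only [star_mul, star_star, mul_assoc, c1]
  refine Set.Subset.antisymm (Set.image_subset_iff.2 (key h1 h2 hpq)) fun y hy ↦ ?_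
  have h3 : star w * p = q * star w := by
    calc star w * p = star w * (p * w) * star w := by simp only [mul_assoc, h2, mul_one]
      _ = q * star w := by rw [← hpq, ← mul_assoc, h1, one_mul]
  refine ⟨star w * y * star (star w), key (by rwa [star_star]) (by rwa [star_star]) h3 y hy, ?_⟩
  calc w * (star w * y * star (star w)) * star w
      = (w * star w) * y * (w * star w) := by simp only [star_star, mul_assoc]
    _ = y := by rw [h2, one_mul, mul_one]

lemma cornerUnitarySet_one (S : Set A) : cornerUnitarySet 1 S = unitarySetIn S := by
  simp [cornerUnitarySet, unitarySetIn]

theorem stmt4 (Λ : Type*) [Nonempty Λ] (S : Λ → StarSubalgebra ℂ A)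
    (hclosed : ∀ l, IsClosed ((S l : Set A)))
    (hdir : ∀ l m : Λ, ∃ n : Λ, S l ≤ S n ∧ S m ≤ S n)
    (hdense : closure (⋃ l, ((S l : Set A))) = Set.univ) :
    ((∀ l, PropHUC ((S l : Set A))) → PropHUC (Set.univ : Set A)) ∧
    ((∀ l, PropUC ((S l : Set A))) → PropUC (Set.univ : Set A)) := by
  constructor
  · intro hHUC p _ hps hp
    obtain ⟨a, ha, hap⟩ := Metric.mem_closure_iff.1 (hdense ▸ Set.mem_univ p : p ∈ closure _)
      (1 / 56) (by norm_num)
    obtain ⟨l, hal⟩ := Set.mem_iUnion.1 ha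
    rw [dist_comm, dist_eq_norm] at hap
    obtain ⟨q, hql, hqs, hq, hqp⟩ :=
      exists_projection_mem_near (hclosed l) hps hp hal (by linarith)
    obtain ⟨w, h1, h2, h3⟩ := exists_unitary_intertwining hps hp hqs hq (by linarith)
    have hconn := isConnected_cornerUnitarySet_univ S hclosed hdir hdense hql hqs hq
      fun m hm ↦ hHUC m q hm hqs hq
    change IsConnected (cornerUnitarySet p Set.univ)
    rw [← image_conj_cornerUnitarySet h1 h2 h3]
    exact hconn.image _ (by fun_prop)
  · intro hUC
    obtain ⟨l⟩ := ‹Nonempty Λ›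
    have hconn := isConnected_cornerUnitarySet_univ S hclosed hdir hdense (one_mem (S l))
      (.one A) (mul_one 1) fun m _ ↦ by
        rw [cornerUnitarySet_one]
        exact hUC m
    rwa [cornerUnitarySet_one] at hconn
end

section
/- Every unital AF C*-algebra has property HUC: if A is a unital C*-algebra that is the norm closure of the union of an increasingly directed family of finite-dimensional unital C*-subalgebras (each containing the unit of A), then for every projection p ∈ A, the unitary group of pAp is connected. -/
/-- Polar decomposition of an invertible element. -/
theorem IsUnit.exists_mul_mem_unitary {A : Type*} [CStarAlgebra A] {b : A} (hb : IsUnit b) :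
    ∃ r : A, IsSelfAdjoint r ∧ (∀ c, Commute (star b * b) c → Commute r c) ∧
      b * r ∈ unitary A ∧ ‖b * r - b‖ ≤ ‖star b * b - 1‖ := by
  set a := star b * b with ha
  have hsa : IsSelfAdjoint a := .star_mul_self b
  have hau : IsUnit a := hb.star.mul hb
  have hpos : ∀ t ∈ spectrum ℝ a, 0 < t := fun t ht ↦
    (spectrum_star_mul_self_nonneg t ht).lt_of_ne fun h ↦
      spectrum.zero_notMem ℝ hau (h ▸ ht)
  have hcont : ContinuousOn (fun t : ℝ ↦ (√t)⁻¹) (spectrum ℝ a) :=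
    Real.continuous_sqrt.continuousOn.inv₀ fun t ht ↦ (Real.sqrt_pos.2 (hpos t ht)).ne'
  set r := cfc (fun t : ℝ ↦ (√t)⁻¹) a with hr
  have hrsa : IsSelfAdjoint r := cfc_predicate _ a
  have hcomm : ∀ c, Commute a c → Commute r c := fun c hc ↦ hc.cfc_real _
  have hid : cfc (fun t : ℝ ↦ t) a = a := cfc_id' ℝ a
  have hrar : r * a * r = 1 := by
    have h1 : r * a * r = cfc (fun t : ℝ ↦ (√t)⁻¹ * t * (√t)⁻¹) a := by
      rw [cfc_mul (fun t : ℝ ↦ (√t)⁻¹ * t) _ a (hcont.mul continuousOn_id) hcont,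
        cfc_mul _ (fun t : ℝ ↦ t) a hcont continuousOn_id, hid]
    rw [h1, ← cfc_one ℝ a]
    refine cfc_congr fun t ht ↦ ?_
    have h := hpos t ht
    have h' := Real.sqrt_pos.2 h
    simp only [Pi.one_apply]
    field_simp
    rw [Real.sq_sqrt h.le]
  have hru : IsUnit r := by
    have hra : r * a = a * r := hcomm a (.refl a)
    refine isUnit_iff_exists_and_exists.2 ⟨⟨a * r, by rw [← mul_assoc, hrar]⟩, ⟨r * a, hrar⟩⟩
  have hiso : star (b * r) * (b * r) = 1 := by
    rw [star_mul, hrsa.star_eq, ← hrar, ha]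
    noncomm_ring
  refine ⟨r, hrsa, hcomm, ?_, ?_⟩
  · refine Unitary.mem_iff.2 ⟨hiso, ?_⟩
    obtain ⟨w, hw⟩ := hb.mul hru
    have := left_inv_eq_right_inv hiso (hw ▸ w.mul_inv)
    rw [this, ← hw, w.mul_inv]
  · have hsq : star (b * r - b) * (b * r - b) = cfc (fun t : ℝ ↦ (√t - 1) ^ 2) a := by
      have h1 : cfc (fun t : ℝ ↦ (√t - 1) ^ 2) a = (r - 1) * a * (r - 1) := by
        have hcont' : ContinuousOn (fun t : ℝ ↦ (√t)⁻¹ - 1) (spectrum ℝ a) :=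
          hcont.sub continuousOn_const
        have h2 : r - 1 = cfc (fun t : ℝ ↦ (√t)⁻¹ - 1) a := by
          rw [cfc_sub _ (fun _ : ℝ ↦ 1) a hcont continuousOn_const, cfc_const_one ℝ a]
        have h3 : (r - 1) * a * (r - 1) =
            cfc (fun t : ℝ ↦ ((√t)⁻¹ - 1) * t * ((√t)⁻¹ - 1)) a := by
          rw [cfc_mul (fun t : ℝ ↦ ((√t)⁻¹ - 1) * t) _ a (hcont'.mul continuousOn_id) hcont',
            cfc_mul _ (fun t : ℝ ↦ t) a hcont' continuousOn_id, hid, h2]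
        rw [h3]
        refine cfc_congr fun t ht ↦ ?_
        have h := hpos t ht
        have h' := Real.sqrt_pos.2 h
        field_simp
        rw [Real.sq_sqrt h.le]
        ring
      rw [h1, ha, star_sub, star_mul, hrsa.star_eq]
      noncomm_ring
    rw [← sq_le_sq₀ (norm_nonneg _) (norm_nonneg _), sq ‖b * r - b‖, ← CStarRing.norm_star_mul_self,
      hsq]
    refine norm_cfc_le (by positivity) fun t ht ↦ ?_
    have h1 : |t - 1| ≤ ‖a - 1‖ := by
      have := norm_apply_le_norm_cfc (fun t : ℝ ↦ t - 1) a ht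
      rwa [cfc_sub _ _ a, hid, cfc_const_one ℝ a] at this
    have h := hpos t ht
    have h' := Real.sqrt_nonneg t
    have h2 := Real.sq_sqrt h.le
    rw [Real.norm_of_nonneg (sq_nonneg _)]
    calc (√t - 1) ^ 2 ≤ (t - 1) ^ 2 := by
          have : (t - 1) ^ 2 = (√t - 1) ^ 2 * (√t + 1) ^ 2 := by
            conv_lhs => rw [← h2]
            ring
          rw [this]
          exact le_mul_of_one_le_right (sq_nonneg _) (by nlinarith)
      _ = |t - 1| ^ 2 := (sq_abs _).symm
      _ ≤ _ := by gcongr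

theorem isUnit_of_norm_sub_one_lt_one {A : Type*} [NormedRing A] [CompleteSpace A] {x : A}
    (h : ‖x - 1‖ < 1) : IsUnit x := by
  simpa using isUnit_one_sub_of_norm_lt_one (x := 1 - x) (by rwa [norm_sub_rev])

theorem norm_star_mul_self_sub_one_lt {A : Type*} [CStarAlgebra A] {u b : A} (hu : u ∈ unitary A)
    (h : ‖b - u‖ < 1 / 4) : ‖star b * b - 1‖ < 3 / 4 := by
  have hu1 : ‖u‖ ≤ 1 := by
    nontriviality A
    exact (CStarRing.norm_of_mem_unitary hu).le
  have hb : ‖star b‖ ≤ 5 / 4 := by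
    rw [norm_star]
    linarith [norm_le_norm_sub_add b u]
  have h' : ‖star (b - u)‖ < 1 / 4 := by rwa [norm_star]
  calc ‖star b * b - 1‖ = ‖star b * (b - u) + star (b - u) * u‖ := by
        rw [← Unitary.star_mul_self_of_mem hu, star_sub]; congr 1; noncomm_ring
    _ ≤ ‖star b‖ * ‖b - u‖ + ‖star (b - u)‖ * ‖u‖ :=
        (norm_add_le _ _).trans (add_le_add (norm_mul_le _ _) (norm_mul_le _ _))
    _ ≤ 5 / 4 * ‖b - u‖ + ‖star (b - u)‖ * 1 := by gcongr
    _ < 3 / 4 := by linarith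

theorem StarSubalgebra.isClosed_of_finiteDimensional {A : Type*} [CStarAlgebra A]
    (S : StarSubalgebra ℂ A) [FiniteDimensional ℂ S] : IsClosed (S : Set A) :=
  haveI : FiniteDimensional ℂ S.toSubalgebra.toSubmodule := ‹FiniteDimensional ℂ S›
  S.toSubalgebra.toSubmodule.closed_of_finiteDimensional

/-- An element of a finite-dimensional star subalgebra which is close to a unitary is close to
a unitary of that subalgebra. -/
theorem StarSubalgebra.exists_unitary_near {A : Type*} [CStarAlgebra A]
    (S : StarSubalgebra ℂ A) [FiniteDimensional ℂ S] {u b : A} (hu : u ∈ unitary A)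
    (hb : b ∈ S) (h : ‖b - u‖ < 1 / 4) :
    ∃ v ∈ unitary A, v ∈ S ∧ ‖v - u‖ < 1 ∧ (IsSelfAdjoint b → IsSelfAdjoint v) := by
  have hcl : IsClosed (S : Set A) := S.isClosed_of_finiteDimensional
  lift b to S using hb
  have h1 : ‖star b * b - 1‖ < 3 / 4 := norm_star_mul_self_sub_one_lt (b := (b : A)) hu h
  have h2 : ‖b * star b - 1‖ < 3 / 4 := by
    have := norm_star_mul_self_sub_one_lt (b := star (b : A)) (Unitary.star_mem hu)
      (by rwa [← star_sub, norm_star])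
    rwa [star_star] at this
  have hbu : IsUnit b := by
    obtain ⟨x, hx⟩ := isUnit_of_norm_sub_one_lt_one (h1.trans (by norm_num))
    obtain ⟨y, hy⟩ := isUnit_of_norm_sub_one_lt_one (h2.trans (by norm_num))
    refine isUnit_iff_exists_and_exists.2 ⟨⟨star b * ↑y⁻¹, ?_⟩, ⟨↑x⁻¹ * star b, ?_⟩⟩
    · rw [← mul_assoc, ← hy, y.mul_inv]
    · rw [mul_assoc, ← hx, x.inv_mul]
  obtain ⟨r, hr, hc, hbr, hn⟩ := hbu.exists_mul_mem_unitary
  refine ⟨b * r, ?_, (b * r).2, ?_, fun hb ↦ ?_⟩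
  · exact Unitary.mem_iff.2 ⟨congrArg Subtype.val (Unitary.star_mul_self_of_mem hbr), congrArg Subtype.val (Unitary.mul_star_self_of_mem hbr)⟩
  · have h3 : ‖(b * r : A) - b‖ < 3 / 4 := hn.trans_lt h1
    have := norm_sub_le_norm_sub_add_norm_sub (b * r : A) b u
    linarith
  · have hb' : IsSelfAdjoint b := Subtype.ext hb
    have : Commute r b := hc b (by rw [hb'.star_eq]; exact (Commute.refl b).mul_left (.refl b))
    exact congrArg Subtype.val ((hb'.commute_iff hr).1 this.symm)

theorem spectrum_finite_of_mem {A : Type*} [CStarAlgebra A]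
    (S : StarSubalgebra ℂ A) [FiniteDimensional ℂ S] {v : A} (hv : v ∈ S) :
    (spectrum ℂ v).Finite := by
  obtain ⟨q, hq, hqv⟩ := Algebra.IsAlgebraic.isAlgebraic (R := ℂ) (⟨v, hv⟩ : S)
  have hqv' : Polynomial.aeval v q = 0 := by
    have := congrArg S.subtype hqv
    rwa [← Polynomial.aeval_algHom_apply, map_zero] at this
  refine (q.rootSet_finite ℂ).subset fun μ hμ ↦ ?_
  have h0 := spectrum.subset_polynomial_aeval v q ⟨μ, hμ, rfl⟩
  rw [hqv'] at h0
  have : Nontrivial A := by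
    by_contra h
    rw [not_nontrivial_iff_subsingleton] at h
    simp at hμ
  rw [spectrum.zero_eq, Set.mem_singleton_iff] at h0
  exact Polynomial.mem_rootSet.2 ⟨hq, by simpa using h0⟩

theorem selfAdjoint.coe_expUnitary_smul_one {A : Type*} [CStarAlgebra A] (t : ℝ) :
    (selfAdjoint.expUnitary (t • (1 : selfAdjoint A)) : A) = Complex.exp (Complex.I * t) • 1 := by
  rw [selfAdjoint.expUnitary_coe]
  have : (Complex.I • ((t • (1 : selfAdjoint A) : selfAdjoint A) : A)) =
      algebraMap ℂ A (Complex.I * t) := by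
    rw [Algebra.algebraMap_eq_smul_one, mul_smul]
    simp
  rw [this, ← NormedSpace.algebraMap_exp_comm, Complex.exp_eq_exp_ℂ,
    Algebra.algebraMap_eq_smul_one]

theorem Unitary.joined_one_of_spectrum_finite {A : Type*} [CStarAlgebra A] (v : unitary A)
    (hv : (spectrum ℂ (v : A)).Finite) : Joined 1 v := by
  have hinj : Set.InjOn (fun t : ℝ ↦ -Complex.exp (Complex.I * t)) (Set.Ioo 0 1) := by
    intro s hs t ht hst
    have h : Circle.exp s = Circle.exp t := by
      ext
      simpa [mul_comm Complex.I] using hst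
    have hpi := Real.pi_gt_three
    rw [← Circle.arg_exp (x := s) (by linarith [hs.1]) (by linarith [hs.2]), h,
      Circle.arg_exp (by linarith [ht.1]) (by linarith [ht.2])]
  obtain ⟨t, -, ht⟩ : ∃ t ∈ Set.Ioo (0 : ℝ) 1, -Complex.exp (Complex.I * t) ∉ spectrum ℂ (v : A) := by
    by_contra! h
    refine ((Set.Ioo_infinite (zero_lt_one (α := ℝ))).image hinj) (hv.subset ?_)
    rintro - ⟨t, ht, rfl⟩
    exact h t ht
  set w : unitary A := selfAdjoint.expUnitary (t • 1) with hw
  have h1 : ‖((star w * v : unitary A) : A) - 1‖ < 2 := by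
    rw [Unitary.norm_sub_one_lt_two_iff (star w * v).2]
    set c : ℂˣ := Units.mk0 (Complex.exp (Complex.I * t)) (Complex.exp_ne_zero _)
    have : c • ((star w * v : unitary A) : A) = v := by
      have hwc : (w : A) = c • 1 := selfAdjoint.coe_expUnitary_smul_one t
      calc c • ((star w * v : unitary A) : A) = (w : A) * ((star w * v : unitary A) : A) := by
            rw [hwc, smul_mul_assoc, one_mul]
        _ = v := by simp [← mul_assoc]
    rw [← spectrum.smul_mem_smul_iff (r := c), this]
    simpa [c, Units.smul_def] using ht
  simpa [hw, ← mul_assoc] using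
    (selfAdjoint.joined_one_expUnitary (t • 1)).mul (Unitary.joined 1 (star w * v) h1)

/-- A C⋆-algebra in which finite-dimensional star subalgebras are locally dense has connected
unitary group. -/
theorem Unitary.isConnected_of_locally_finiteDimensional {A : Type*} [CStarAlgebra A]
    (h : ∀ (x : A) (ε : ℝ), 0 < ε → ∃ S : StarSubalgebra ℂ A, FiniteDimensional ℂ S ∧
      ∃ b ∈ S, ‖b - x‖ < ε) : ConnectedSpace (unitary A) := by
  suffices PathConnectedSpace (unitary A) from inferInstance
  refine pathConnectedSpace_iff_eq.2 ⟨1, Set.eq_univ_of_forall fun u ↦ ?_⟩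
  obtain ⟨S, _, b, hb, hbu⟩ := h u (1 / 4) (by norm_num)
  obtain ⟨v, hv, hvS, hvu, -⟩ := S.exists_unitary_near u.2 hb hbu
  exact (Unitary.joined_one_of_spectrum_finite ⟨v, hv⟩ (spectrum_finite_of_mem S hvS)).trans
    (Unitary.joined _ _ (by rw [norm_sub_rev]; exact hvu.trans one_lt_two))

/-- Close selfadjoint unitaries are unitarily equivalent. -/
theorem IsSelfAdjoint.exists_unitary_conj {A : Type*} [CStarAlgebra A] {s v : A}
    (hs : IsSelfAdjoint s) (hv : IsSelfAdjoint v) (hs1 : s * s = 1) (hv1 : v * v = 1)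
    (h : ‖v - s‖ < 1) : ∃ z ∈ unitary A, z * v = s * z := by
  have hsn : ‖s‖ ≤ 1 := by
    nontriviality A
    exact (CStarRing.norm_of_mem_unitary (Unitary.mem_iff.2 ⟨by rwa [hs.star_eq], by rwa [hs.star_eq]⟩)).le
  set b : A := 1 + s * v with hb
  have hbu : IsUnit b := by
    have h2 : b = algebraMap ℂ A 2 * (1 + (1 / 2 : ℂ) • (s * (v - s))) := by
      rw [Algebra.algebraMap_eq_smul_one, smul_mul_assoc, one_mul, smul_add, smul_smul, mul_sub, hs1]
      norm_num
      rw [ofNat_smul_eq_nsmul, two_nsmul, hb]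
      abel
    rw [h2]
    refine ((isUnit_iff_ne_zero.2 two_ne_zero).map _).mul (isUnit_of_norm_sub_one_lt_one ?_)
    rw [add_sub_cancel_left, norm_smul]
    calc ‖(1 / 2 : ℂ)‖ * ‖s * (v - s)‖ ≤ ‖(1 / 2 : ℂ)‖ * (1 * ‖v - s‖) := by
          gcongr
          exact (norm_mul_le _ _).trans (by gcongr)
      _ < 1 := by norm_num; linarith
  have hbv : b * v = s * b := by
    rw [hb, add_mul, mul_add, mul_assoc, hv1, ← mul_assoc, hs1]
    noncomm_ring
  have hc : Commute (star b * b) v := by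
    have : star b * b = 2 + s * v + v * s := by
      rw [hb, star_add, star_mul, hs.star_eq, hv.star_eq, star_one]
      have : v * s * (s * v) = 1 := by rw [mul_assoc, ← mul_assoc s, hs1, one_mul, hv1]
      rw [add_mul, mul_add, mul_add, this]
      rw [← one_add_one_eq_two]
      noncomm_ring
    rw [this]
    have h1 : v * s * v = v * (s * v) := mul_assoc _ _ _
    have h2 : s * v * v = s := by rw [mul_assoc, hv1, mul_one]
    have h3 : v * (v * s) = s := by rw [← mul_assoc, hv1, one_mul]
    rw [Commute, SemiconjBy, add_mul, add_mul, mul_add, mul_add, h1, h2, h3]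
    noncomm_ring
  obtain ⟨r, -, hr, hz, -⟩ := hbu.exists_mul_mem_unitary
  exact ⟨b * r, hz, by rw [mul_assoc, (hr v hc).eq, ← mul_assoc, hbv, mul_assoc]⟩

theorem IsSelfAdjoint.norm_le_one_of_mul_self_eq {A : Type*} [CStarAlgebra A] {q : A} (hq : IsSelfAdjoint q)
    (hq2 : q * q = q) : ‖q‖ ≤ 1 := by
  have : ‖q‖ * ‖q‖ = ‖q‖ := by rw [← CStarRing.norm_star_mul_self, hq.star_eq, hq2]
  nlinarith [norm_nonneg q]

/-- If local approximations can be chosen to contain a projection `q`, then the unitary group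
of the corner at `q` is connected. -/
theorem isConnected_corner_of_locally_finiteDimensional {A : Type*} [CStarAlgebra A] {q : A}
    (hq : IsSelfAdjoint q) (hq2 : q * q = q)
    (h : ∀ (x : A) (ε : ℝ), 0 < ε → ∃ S : StarSubalgebra ℂ A, FiniteDimensional ℂ S ∧ q ∈ S ∧
      ∃ b ∈ S, ‖b - x‖ < ε) :
    IsConnected {u : A | q * u * q = u ∧ star u * u = q ∧ u * star u = q} := by
  set C : StarSubalgebra ℂ A := StarSubalgebra.centralizer ℂ {q} with hC
  have hmem : ∀ x, x ∈ C ↔ q * x = x * q := fun x ↦ by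
    simp [hC, StarSubalgebra.mem_centralizer_iff, hq.star_eq]
  have hcl : IsClosed (C : Set A) := by
    have : (C : Set A) = {x | q * x = x * q} := Set.ext hmem
    rw [this]
    exact isClosed_eq (by fun_prop) (by fun_prop)
  set q' := 1 - q with hq'
  have hqq' : q * q' = 0 := by rw [hq', mul_sub, mul_one, hq2, sub_self]
  have hq'q : q' * q = 0 := by rw [hq', sub_mul, one_mul, hq2, sub_self]
  have hq'2 : q' * q' = q' := by rw [hq', mul_sub, mul_one, ← hq', hq'q, sub_zero]
  have hq's : IsSelfAdjoint q' := (IsSelfAdjoint.one A).sub hq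
  have hqn := hq.norm_le_one_of_mul_self_eq hq2
  have hq'n := hq's.norm_le_one_of_mul_self_eq hq'2
  have hconn : ConnectedSpace (unitary C) := by
    refine Unitary.isConnected_of_locally_finiteDimensional fun x ε hε ↦ ?_
    obtain ⟨S, hS, hqS, y, hyS, hy⟩ := h x (ε / 2) (half_pos hε)
    let f : S.comap C.subtype →ₗ[ℂ] S :=
      { toFun := fun t ↦ ⟨((t : C) : A), t.2⟩
        map_add' := fun _ _ ↦ rfl
        map_smul' := fun _ _ ↦ rfl }
    refine ⟨S.comap C.subtype, FiniteDimensional.of_injective f fun s t hst ↦ ?_, ?_⟩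
    · have hst' : ((s : C) : A) = ((t : C) : A) := congrArg (fun r : S ↦ (r : A)) hst
      exact Subtype.ext (Subtype.ext hst')
    have hbC : q * y * q + q' * y * q' ∈ C := by
      rw [hmem]
      calc q * (q * y * q + q' * y * q') = (q * q) * y * q + (q * q') * y * q' := by noncomm_ring
        _ = q * y * (q * q) + q' * y * (q' * q) := by rw [hqq', hq'q, hq2]; simp
        _ = _ := by noncomm_ring
    have hxC := (hmem x).1 x.2
    have hx : q * x * q + q' * x * q' = (x : A) := by
      have hxq' : q' * x = x * q' := by rw [hq', sub_mul, mul_sub, hxC, one_mul, mul_one]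
      rw [hxC, hxq', mul_assoc, mul_assoc, hq2, hq'2, ← mul_add, hq', add_sub_cancel, mul_one]
    have hbS : q * y * q + q' * y * q' ∈ S := by
      have hq'S : q' ∈ S := sub_mem (one_mem S) hqS
      exact add_mem (mul_mem (mul_mem hqS hyS) hqS) (mul_mem (mul_mem hq'S hyS) hq'S)
    refine ⟨⟨_, hbC⟩, hbS, ?_⟩
    change ‖q * y * q + q' * y * q' - (x : A)‖ < ε
    have hcut : ∀ e : A, ‖e‖ ≤ 1 → ‖e * (y - x) * e‖ ≤ ‖y - x‖ := fun e he ↦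
      calc ‖e * (y - x) * e‖ ≤ ‖e‖ * ‖y - x‖ * ‖e‖ := norm_mul₃_le
        _ ≤ 1 * ‖y - x‖ * 1 := by gcongr
        _ = ‖y - x‖ := by ring
    calc ‖q * y * q + q' * y * q' - (x : A)‖ = ‖q * (y - x) * q + q' * (y - x) * q'‖ := by
          conv_lhs => rw [← hx]
          congr 1
          noncomm_ring
      _ ≤ ‖y - x‖ + ‖y - x‖ := norm_add_le_of_le (hcut q hqn) (hcut q' hq'n)
      _ < ε := by linarith
  have himage : {u : A | q * u * q = u ∧ star u * u = q ∧ u * star u = q} =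
      Set.range fun v : unitary C ↦ q * ((v : C) : A) := by
    ext u
    constructor
    · rintro ⟨h1, h2, h3⟩
      have hqu : q * u = u := by rw [← h1, ← mul_assoc, ← mul_assoc, hq2]
      have huq : u * q = u := by rw [← h1, mul_assoc, hq2]
      have hu : u + q' ∈ C := by
        rw [hmem, mul_add, add_mul, hqu, huq, hqq', hq'q]
      have hqsu : q * star u = star u := by simpa [hq.star_eq] using congrArg star huq
      have hsuq : star u * q = star u := by simpa [hq.star_eq] using congrArg star hqu
      have hq'u : q' * u = 0 := by rw [hq', sub_mul, hqu, one_mul, sub_self]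
      have huq' : u * q' = 0 := by rw [hq', mul_sub, huq, mul_one, sub_self]
      have hq'su : q' * star u = 0 := by rw [hq', sub_mul, hqsu, one_mul, sub_self]
      have hsuq' : star u * q' = 0 := by rw [hq', mul_sub, hsuq, mul_one, sub_self]
      refine ⟨⟨⟨u + q', hu⟩, Unitary.mem_iff.2 ⟨Subtype.ext ?_, Subtype.ext ?_⟩⟩, ?_⟩
      · change star (u + q') * (u + q') = 1
        rw [star_add, hq's.star_eq, add_mul, mul_add, mul_add, h2, hq'u, hsuq', hq'2, hq']
        abel
      · change (u + q') * star (u + q') = 1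
        rw [star_add, hq's.star_eq, add_mul, mul_add, mul_add, h3, huq', hq'su, hq'2, hq']
        abel
      · change q * (u + q') = u
        rw [mul_add, hqu, hqq', add_zero]
    · rintro ⟨v, rfl⟩
      have hc : q * ((v : C) : A) = ((v : C) : A) * q := (hmem _).1 (v : C).2
      have h1 : star ((v : C) : A) * ((v : C) : A) = 1 :=
        congrArg Subtype.val (Unitary.star_mul_self_of_mem v.2)
      have h2 : ((v : C) : A) * star ((v : C) : A) = 1 :=
        congrArg Subtype.val (Unitary.mul_star_self_of_mem v.2)
      change q * ((v : C) : A) ∈ _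
      generalize ((v : C) : A) = w at *
      refine ⟨?_, ?_, ?_⟩
      · rw [← mul_assoc, hq2, mul_assoc, ← hc, ← mul_assoc, hq2]
      · rw [star_mul, hq.star_eq, mul_assoc, ← mul_assoc q q, hq2, hc, ← mul_assoc, h1, one_mul]
      · rw [star_mul, hq.star_eq, mul_assoc, ← mul_assoc w, h2, one_mul, hq2]
  rw [himage]
  exact isConnected_range (by fun_prop)

theorem conj_mem_corner_unitary {A : Type*} [CStarAlgebra A] {p q z u : A} (hz : z ∈ unitary A)
    (hzq : z * q = p * z) (hu : q * u * q = u ∧ star u * u = q ∧ u * star u = q) :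
    p * (z * u * star z) * p = z * u * star z ∧ star (z * u * star z) * (z * u * star z) = p ∧
      z * u * star z * star (z * u * star z) = p := by
  obtain ⟨hz1, hz2⟩ := Unitary.mem_iff.1 hz
  obtain ⟨h1, h2, h3⟩ := hu
  have hp : z * q * star z = p := by rw [hzq, mul_assoc, hz2, mul_one]
  refine ⟨?_, ?_, ?_⟩
  · calc p * (z * u * star z) * p
          = z * q * (star z * z) * u * (star z * z) * q * star z := by
            conv_lhs => rw [← hp]
            noncomm_ring
      _ = z * (q * u * q) * star z := by rw [hz1]; noncomm_ring
      _ = _ := by rw [h1]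
  · calc star (z * u * star z) * (z * u * star z)
          = z * (star u * (star z * z) * u) * star z := by
            rw [star_mul, star_mul, star_star]; noncomm_ring
      _ = p := by rw [hz1, mul_one, h2, hp]
  · calc z * u * star z * star (z * u * star z)
          = z * (u * (star z * z) * star u) * star z := by
            rw [star_mul, star_mul, star_star]; noncomm_ring
      _ = p := by rw [hz1, mul_one, h3, hp]

theorem stmt5 (A : Type*) [CStarAlgebra A] (Λ : Type*) [Nonempty Λ]
    (S : Λ → StarSubalgebra ℂ A) (hfd : ∀ l, FiniteDimensional ℂ (S l))
    (hdir : ∀ l m : Λ, ∃ n : Λ, S l ≤ S n ∧ S m ≤ S n)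
    (hdense : closure (⋃ l, ((S l : Set A))) = Set.univ) :
    ∀ p : A, IsSelfAdjoint p → p * p = p →
      IsConnected {u : A | p * u * p = u ∧ star u * u = p ∧ u * star u = p} := by
  intro p hp hp2
  have happ : ∀ (x : A) (ε : ℝ), 0 < ε → ∃ l, ∃ b ∈ S l, ‖b - x‖ < ε := fun x ε hε ↦ by
    have hx : x ∈ closure (⋃ l, (S l : Set A)) := hdense ▸ Set.mem_univ x
    obtain ⟨b, hb, hxb⟩ := Metric.mem_closure_iff.1 hx ε hε
    obtain ⟨l, hl⟩ := Set.mem_iUnion.1 hb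
    exact ⟨l, b, hl, by rwa [← dist_eq_norm, dist_comm]⟩
  have hs : IsSelfAdjoint (2 * p - 1) := by
    rw [two_mul]; exact (hp.add hp).sub (.one A)
  have hs2 : (2 * p - 1) * (2 * p - 1) = 1 := by
    calc (2 * p - 1) * (2 * p - 1) = 4 * (p * p) - 4 * p + 1 := by noncomm_ring
      _ = 1 := by rw [hp2]; simp
  set s : A := 2 * p - 1 with hsdef
  obtain ⟨l, b, hb, hbs⟩ := happ s (1 / 4) (by norm_num)
  have hre : ‖(1 / 2 : ℝ) • (b + star b) - s‖ < 1 / 4 := by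
    have h1 : (1 / 2 : ℝ) • (b + star b) - s = (1 / 2 : ℝ) • ((b - s) + star (b - s)) := by
      rw [star_sub, hs.star_eq]
      module
    have h2 := norm_add_le (b - s) (star (b - s))
    rw [norm_star] at h2
    rw [h1, norm_smul, Real.norm_of_nonneg (by norm_num)]
    linarith
  have hrsa : IsSelfAdjoint ((1 / 2 : ℝ) • (b + star b)) :=
    (IsSelfAdjoint.all _).smul (.add_star_self b)
  have hrS : (1 / 2 : ℝ) • (b + star b) ∈ S l := by
    have : (1 / 2 : ℝ) • (b + star b) = (1 / 2 : ℂ) • (b + star b) := by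
      rw [← Complex.coe_smul]; norm_num
    rw [this]
    exact (S l).smul_mem (add_mem hb (star_mem hb)) _
  have := hfd l
  obtain ⟨v, hv, hvS, hvs, hvsa⟩ := (S l).exists_unitary_near
    (Unitary.mem_iff.2 ⟨by rwa [hs.star_eq], by rwa [hs.star_eq]⟩) hrS hre
  specialize hvsa hrsa
  have hv2 : v * v = 1 := by
    simpa [hvsa.star_eq] using (Unitary.mem_iff.1 hv).1
  obtain ⟨z, hz, hzv⟩ := hs.exists_unitary_conj hvsa hs2 hv2 hvs
  obtain ⟨hz1, hz2⟩ := Unitary.mem_iff.1 hz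
  set q : A := (1 / 2 : ℂ) • (1 + v) with hq
  have hvq : v = 2 * q - 1 := by
    rw [hq, two_mul]; module
  have hqS : q ∈ S l := (S l).smul_mem (add_mem (one_mem _) hvS) _
  have hqsa : IsSelfAdjoint q := by
    rw [isSelfAdjoint_iff, hq, star_smul, star_add, star_one, hvsa.star_eq]
    congr 1
    simp
  have hq2 : q * q = q := by
    rw [hq, smul_mul_smul_comm, add_mul, mul_add, mul_add, hv2]
    simp only [one_mul, mul_one]
    module
  have hzq : z * q = p * z := by
    have hp' : p = (1 / 2 : ℂ) • (1 + s) := by rw [hsdef, two_mul]; module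
    rw [hq, hp', mul_smul_comm, smul_mul_assoc, mul_add, add_mul, hzv, mul_one, one_mul]
  have hconn : IsConnected {u : A | q * u * q = u ∧ star u * u = q ∧ u * star u = q} := by
    refine isConnected_corner_of_locally_finiteDimensional hqsa hq2 fun x ε hε ↦ ?_
    obtain ⟨m, b, hb, hbx⟩ := happ x ε hε
    obtain ⟨n, hln, hmn⟩ := hdir l m
    exact ⟨S n, hfd n, hln hqS, b, hmn hb, hbx⟩
  have himage : {u : A | p * u * p = u ∧ star u * u = p ∧ u * star u = p} =
      (fun u ↦ z * u * star z) '' {u : A | q * u * q = u ∧ star u * u = q ∧ u * star u = q} := by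
    ext w
    constructor
    · intro hw
      have hzp : star z * p = q * star z := by
        calc star z * p = star z * (p * z) * star z := by
              rw [mul_assoc, mul_assoc p, hz2, mul_one]
          _ = q * star z := by rw [← hzq, ← mul_assoc, hz1, one_mul]
      refine ⟨_, conj_mem_corner_unitary (Unitary.star_mem hz) hzp hw, ?_⟩
      calc z * (star z * w * star (star z)) * star z = z * star z * w * (z * star z) := by
            rw [star_star]; noncomm_ring
        _ = w := by rw [hz2, one_mul, mul_one]
    · rintro ⟨u, hu, rfl⟩
      exact conj_mem_corner_unitary hz hzq hu
  rw [himage]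
  exact hconn.image _ (by fun_prop)
end

section
/- Let H be a separable infinite-dimensional complex Hilbert space, let X ∈ B(H), and let Y belong to the norm closure of the unitary orbit {u* X u : u unitary in B(H)} of X. Then there exists C in this closure such that there is a strong internal path from X to C and a strong internal path from Y to C; consequently, the norm closure of the unitary orbit of X is path-connected. -/
open Filter

variable {H : Type*} [NormedAddCommGroup H] [InnerProductSpace ℂ H] [CompleteSpace H]

/-- The unitary orbit of an operator `X`, in the operator-norm topology. -/
def opUnitaryOrbit (X : H →L[ℂ] H) : Set (H →L[ℂ] H) :=
  {Y | ∃ u ∈ unitary (H →L[ℂ] H), Y = star u * X * u}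

/-- A strong internal path from `X` to `C`: a norm-continuous family of unitaries
`γ : [0,1) → U(B(H))` with `γ(t)* X γ(t) → C` as `t → 1⁻`. -/
def StrongInternalPathOp (X C : H →L[ℂ] H) : Prop :=
  ∃ γ : ℝ → H →L[ℂ] H,
    ContinuousOn γ (Set.Ico 0 1) ∧
    (∀ t ∈ Set.Ico (0 : ℝ) 1, γ t ∈ unitary (H →L[ℂ] H)) ∧
    Tendsto (fun t => star (γ t) * X * γ t) (nhdsWithin 1 (Set.Ico 0 1)) (nhds C)

local notation "⟪" x "," y "⟫" => inner ℂ x y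

theorem inner_star_apply (A : H →L[ℂ] H) (x y : H) : ⟪star A x, y⟫ = ⟪x, A y⟫ := by
  rw [ContinuousLinearMap.star_eq_adjoint, ContinuousLinearMap.adjoint_inner_left]

theorem inner_apply_star (A : H →L[ℂ] H) (x y : H) : ⟪x, star A y⟫ = ⟪A x, y⟫ := by
  rw [ContinuousLinearMap.star_eq_adjoint, ContinuousLinearMap.adjoint_inner_right]

/-- A closed subspace that reduces an operator gives a commuting projection. -/
theorem commute_starProjection_of_reducing {K : Submodule ℂ H} [K.HasOrthogonalProjection]
    {A : H →L[ℂ] H} (h : ∀ x ∈ K, A x ∈ K) (h' : ∀ x ∈ K, star A x ∈ K) :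
    Commute K.starProjection A := by
  ext x
  change K.starProjection (A x) = A (K.starProjection x)
  refine (Submodule.eq_starProjection_of_mem_of_inner_eq_zero
    (h _ (K.starProjection_apply_mem x)) fun w hw => ?_)
  rw [← map_sub, ← inner_apply_star]
  exact K.starProjection_inner_eq_zero x _ (h' w hw)

theorem star_starProjection (K : Submodule ℂ H) [K.HasOrthogonalProjection] :
    star K.starProjection = K.starProjection :=
  (isSelfAdjoint_starProjection K).star_eq

omit [CompleteSpace H] in
theorem starProjection_mul_self (K : Submodule ℂ H) [K.HasOrthogonalProjection] :
    K.starProjection * K.starProjection = K.starProjection :=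
  K.isIdempotentElem_starProjection

theorem unitary_norm_apply {u : H →L[ℂ] H} (hu : star u * u = 1) (x : H) : ‖u x‖ = ‖x‖ := by
  have : ⟪u x, u x⟫ = ⟪x, x⟫ := by
    rw [← inner_star_apply, ← mul_apply_eq_comp, hu, one_apply_eq_self]
  rw [inner_self_eq_norm_sq_to_K, inner_self_eq_norm_sq_to_K] at this
  have h2 : ‖u x‖ ^ 2 = ‖x‖ ^ 2 := by exact_mod_cast this
  exact (sq_eq_sq₀ (norm_nonneg _) (norm_nonneg _)).1 h2

/-- A unitary with nonnegative real part is at distance less than two from the identity. -/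
theorem norm_sub_one_lt_two_of_re_nonneg {u : H →L[ℂ] H} (hu : star u * u = 1)
    (h : ∀ x, 0 ≤ (⟪u x, x⟫).re) : ‖u - 1‖ < 2 := by
  have : ‖u - 1‖ ≤ √2 := by
    refine ContinuousLinearMap.opNorm_le_bound _ (Real.sqrt_nonneg _) fun x => ?_
    refine abs_le_of_sq_le_sq' ?_ (by positivity) |>.2
    rw [mul_pow, Real.sq_sqrt (by norm_num)]
    have := norm_sub_sq (𝕜 := ℂ) (u x) x
    simp only [RCLike.re_to_complex] at this
    rw [sub_apply, one_apply_eq_self, this,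
      unitary_norm_apply hu]
    linarith [h x]
  refine this.trans_lt ?_
  rw [Real.sqrt_lt' (by norm_num)]; norm_num

/-- Every unitary commutes with a symmetry which rotates its imaginary part to a nonnegative
operator. -/
theorem exists_symmetry_of_unitary {V : H →L[ℂ] H} (hV : star V * V = 1) (hV' : V * star V = 1) :
    ∃ s : H →L[ℂ] H, star s = s ∧ s * s = 1 ∧ s * V = V * s ∧
      ∀ x, 0 ≤ (⟪(-Complex.I • (s * V)) x, x⟫).re := by
  set b : H →L[ℂ] H := (Complex.I / 2 : ℂ) • (star V - V) with hb
  have hbsa : IsSelfAdjoint b := by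
    rw [IsSelfAdjoint, hb, star_smul, star_sub, star_star]
    rw [← neg_sub (star V) V, smul_neg, ← neg_smul]
    congr 1
    simp [neg_div]
  have hcV : Commute V b := by
    simp only [hb, Commute, SemiconjBy, mul_smul_comm, smul_mul_assoc, mul_sub, sub_mul, hV, hV']
  have hcV' : Commute (star V) b := by
    simp only [hb, Commute, SemiconjBy, mul_smul_comm, smul_mul_assoc, mul_sub, sub_mul, hV, hV']
  have hc : Commute V b⁻ := (hcV.symm.cfcₙ_real _).symm
  have hc' : Commute (star V) b⁻ := (hcV'.symm.cfcₙ_real _).symm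
  set K : Submodule ℂ H := (b⁻).ker with hK
  have : CompleteSpace K := (ContinuousLinearMap.isClosed_ker (b⁻)).completeSpace_coe
  set e := K.starProjection with he
  have heV : Commute e V := by
    refine commute_starProjection_of_reducing (fun x hx => ?_) (fun x hx => ?_)
    · have := congrArg (fun T : H →L[ℂ] H => T x) hc.eq
      simp only [mul_apply_eq_comp] at this
      have hx' : b⁻ x = 0 := hx
      change b⁻ (V x) = 0
      rw [← this, hx', map_zero]
    · have := congrArg (fun T : H →L[ℂ] H => T x) hc'.eq
      simp only [mul_apply_eq_comp] at this
      have hx' : b⁻ x = 0 := hx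
      change b⁻ (star V x) = 0
      rw [← this, hx', map_zero]
  have hpos : e * b⁺ = b⁺ := by
    ext x
    refine (Submodule.starProjection_eq_self_iff).2 ?_
    change b⁻ (b⁺ x) = 0
    rw [← mul_apply_eq_comp, CFC.negPart_mul_posPart]; simp
  have hneg : e * b⁻ = 0 := by
    have h1 : b⁻ * e = 0 := by
      ext x
      exact (K.starProjection_apply_mem x : _)
    have h2 := congrArg star h1
    rwa [star_mul, star_zero, he, star_starProjection,
      (CFC.negPart_nonneg b).isSelfAdjoint.star_eq] at h2
  set s : H →L[ℂ] H := e + e - 1 with hs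
  have hss : star s = s := by
    simp [hs, he, star_starProjection]
  have hs2 : s * s = 1 := by
    have : e * e = e := starProjection_mul_self K
    simp only [hs, sub_mul, mul_sub, add_mul, mul_add, this, one_mul, mul_one]
    abel
  have hsV : s * V = V * s := by
    simp only [hs, sub_mul, mul_sub, add_mul, mul_add, heV.eq, one_mul, mul_one]
  refine ⟨s, hss, hs2, hsV, fun x => ?_⟩
  have hsb : s * b = b⁺ + b⁻ := by
    conv_lhs => rw [← CFC.posPart_sub_negPart b hbsa]
    simp only [hs, sub_mul, mul_sub, add_mul, hpos, hneg, one_mul]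
    abel
  have hnn : 0 ≤ s * b := hsb ▸ add_nonneg (CFC.posPart_nonneg b) (CFC.negPart_nonneg b)
  have hnn' := ((ContinuousLinearMap.nonneg_iff_isPositive _).1 hnn).re_inner_nonneg_left x
  have hsum : (-Complex.I • (s * V)) + star (-Complex.I • (s * V)) = s * b + s * b := by
    have : star V * s = s * star V := by
      have := congrArg star hsV
      rwa [star_mul, star_mul, hss] at this
    rw [star_smul, star_mul, hss, this, hb, mul_smul_comm, ← add_smul, mul_sub, smul_sub,
      add_halves, ]
    simp [sub_eq_neg_add]
  have h3 := congrArg (fun T : H →L[ℂ] H => (⟪T x, x⟫).re) hsum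
  simp only [add_apply, inner_add_left, Complex.add_re, inner_star_apply] at h3
  rw [← inner_conj_symm x, Complex.conj_re] at h3
  simp only [RCLike.re_to_complex] at hnn'
  linarith

/-- The unitary group of `B(H)` is path connected. -/
theorem joined_one_unitary (v : unitary (H →L[ℂ] H)) : Joined 1 v := by
  have hV : star (v : H →L[ℂ] H) * v = 1 := Unitary.star_mul_self_of_mem v.2
  have hV' : (v : H →L[ℂ] H) * star (v : H →L[ℂ] H) = 1 := Unitary.mul_star_self_of_mem v.2
  obtain ⟨s, hss, hs2, hsV, hre⟩ := exists_symmetry_of_unitary hV hV'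
  have hI : (starRingEnd ℂ) (-Complex.I) * -Complex.I = 1 := by simp
  have hw : -Complex.I • s ∈ unitary (H →L[ℂ] H) := by
    constructor
    · rw [star_smul, hss, smul_mul_smul_comm, hs2]; simp
    · rw [star_smul, hss, smul_mul_smul_comm, hs2]; simp
  set w : unitary (H →L[ℂ] H) := ⟨-Complex.I • s, hw⟩
  have h1 : Joined 1 w := by
    refine Unitary.joined _ _ (norm_sub_one_lt_two_of_re_nonneg hw.1 fun x => ?_)
    have : (⟪s x, x⟫).im = 0 := by
      have h := inner_conj_symm (𝕜 := ℂ) (s x) x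
      conv_lhs at h => rw [← hss, inner_apply_star]
      rw [Complex.ext_iff] at h
      simp only [Complex.conj_im] at h
      linarith [h.2]
    simp [w, inner_smul_left, this]
  have h2 : Joined 1 (w * v) := by
    refine Unitary.joined _ _ (norm_sub_one_lt_two_of_re_nonneg (w * v).2.1 fun x => ?_)
    simpa [w] using hre x
  have h3 := h1.inv.mul h2
  simpa using h3

theorem norm_star_mul_mul_of_mem_unitary {u : H →L[ℂ] H} (hu : u ∈ unitary (H →L[ℂ] H))
    (A : H →L[ℂ] H) : ‖star u * A * u‖ = ‖A‖ := by
  rw [CStarRing.norm_mul_mem_unitary _ hu, CStarRing.norm_mem_unitary_mul _ (Unitary.star_mem hu)]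

/-- The product of the first `n` paths `σ j`, the `j`-th one being run on `[j, j + 1]`. -/
def pathProduct (σ : ℕ → ℝ → H →L[ℂ] H) : ℕ → ℝ → H →L[ℂ] H
  | 0, _ => 1
  | n + 1, τ => σ n (max 0 (min 1 (τ - n))) * pathProduct σ n τ

section PathProduct

variable {σ : ℕ → ℝ → H →L[ℂ] H}

theorem continuous_pathProduct (hc : ∀ j, Continuous (σ j)) (n : ℕ) :
    Continuous (pathProduct σ n) := by
  induction n with
  | zero => exact continuous_const
  | succ n ih =>
    exact ((hc n).comp (by fun_prop)).mul ih

theorem pathProduct_mem_unitary (hu : ∀ j s, σ j s ∈ unitary (H →L[ℂ] H)) (n : ℕ) (τ : ℝ) :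
    pathProduct σ n τ ∈ unitary (H →L[ℂ] H) := by
  induction n with
  | zero => exact one_mem _
  | succ n ih => exact mul_mem (hu _ _) ih

omit [CompleteSpace H] in
theorem pathProduct_eq_of_le (h0 : ∀ j, σ j 0 = 1) {n m : ℕ} (hnm : n ≤ m) {τ : ℝ}
    (hτ : τ ≤ n) : pathProduct σ m τ = pathProduct σ n τ := by
  induction m, hnm using Nat.le_induction with
  | base => rfl
  | succ m hm ih =>
    have hm' : (n : ℝ) ≤ m := by exact_mod_cast hm
    rw [pathProduct, ih, max_eq_left, h0, one_mul]
    exact (min_le_right _ _).trans (by linarith)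

omit [CompleteSpace H] in
theorem pathProduct_eq_of_ge {g : ℕ → H →L[ℂ] H} (g0 : g 0 = 1)
    (gs : ∀ j, g (j + 1) = σ j 1 * g j) {n : ℕ} {τ : ℝ} (hτ : n ≤ τ) :
    pathProduct σ n τ = g n := by
  induction n with
  | zero => exact g0.symm
  | succ n ih =>
    push_cast at hτ
    rw [pathProduct, ih (by linarith), min_eq_left (by linarith), max_eq_right zero_le_one, gs]

end PathProduct

/-- Infinitely many successive paths of unitaries that distort `X` by a summable amount give a
strong internal path. -/
theorem exists_strongInternalPath_of_summable (X : H →L[ℂ] H) (σ : ℕ → ℝ → H →L[ℂ] H)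
    (hc : ∀ j, Continuous (σ j)) (hu : ∀ j s, σ j s ∈ unitary (H →L[ℂ] H))
    (h0 : ∀ j, σ j 0 = 1) (δ : ℕ → ℝ) (hδ : Summable δ)
    (hX : ∀ j s, ‖star (σ j s) * X * σ j s - X‖ ≤ δ j)
    (g : ℕ → H →L[ℂ] H) (g0 : g 0 = 1) (gs : ∀ j, g (j + 1) = σ j 1 * g j) :
    ∃ C, StrongInternalPathOp X C ∧
      Tendsto (fun j => star (g j) * X * g j) atTop (nhds C) := by
  have hgu : ∀ j, g j ∈ unitary (H →L[ℂ] H) := by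
    intro j
    induction j with
    | zero => rw [g0]; exact one_mem _
    | succ j ih => rw [gs]; exact mul_mem (hu _ _) ih
  have key : ∀ j s, ‖star (σ j s * g j) * X * (σ j s * g j) - star (g j) * X * g j‖ ≤ δ j := by
    intro j s
    have : star (σ j s * g j) * X * (σ j s * g j) - star (g j) * X * g j
        = star (g j) * (star (σ j s) * X * σ j s - X) * g j := by
      rw [star_mul]; noncomm_ring
    rw [this, norm_star_mul_mul_of_mem_unitary (hgu j)]
    exact hX j s
  have hcau : CauchySeq fun j => star (g j) * X * g j := by
    refine cauchySeq_of_dist_le_of_summable δ (fun n => ?_) hδ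
    rw [dist_comm, dist_eq_norm, gs]
    exact key n 1
  obtain ⟨C, hC⟩ := cauchySeq_tendsto_of_complete hcau
  refine ⟨C, ?_, hC⟩
  set γ : ℝ → H →L[ℂ] H := fun τ => pathProduct σ (⌊τ⌋₊ + 1) τ with hγ
  have hγc : ContinuousOn γ (Set.Ici 0) := by
    intro τ hτ
    obtain ⟨n, hn⟩ := exists_nat_gt τ
    refine ContinuousWithinAt.congr_of_eventuallyEq
      (continuous_pathProduct hc n).continuousWithinAt ?_ ?_
    · filter_upwards [self_mem_nhdsWithin, mem_nhdsWithin_of_mem_nhds (Iio_mem_nhds hn)] with x hx hx'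
      refine (pathProduct_eq_of_le h0 (Nat.succ_le_of_lt ((Nat.floor_lt hx).2 hx')) ?_).symm
      exact_mod_cast (Nat.lt_floor_add_one x).le
    · refine (pathProduct_eq_of_le h0 (Nat.succ_le_of_lt ((Nat.floor_lt hτ).2 hn)) ?_).symm
      exact_mod_cast (Nat.lt_floor_add_one τ).le
  have hγlim : Tendsto (fun τ => star (γ τ) * X * γ τ) atTop (nhds C) := by
    rw [tendsto_iff_norm_sub_tendsto_zero] at hC ⊢
    have hb : Tendsto (fun n => δ n + ‖star (g n) * X * g n - C‖) atTop (nhds 0) := by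
      simpa using hδ.tendsto_atTop_zero.add hC
    refine squeeze_zero' (Eventually.of_forall fun _ => norm_nonneg _) ?_
      (hb.comp tendsto_nat_floor_atTop)
    filter_upwards [eventually_ge_atTop 0] with τ hτ
    have : γ τ = σ ⌊τ⌋₊ (max 0 (min 1 (τ - ⌊τ⌋₊))) * g ⌊τ⌋₊ := by
      rw [hγ]
      simp only [pathProduct]
      rw [pathProduct_eq_of_ge g0 gs (Nat.floor_le hτ)]
    rw [this]
    calc _ = ‖_ + _‖ := by rw [sub_add_sub_cancel _ (star (g ⌊τ⌋₊) * X * g ⌊τ⌋₊) C]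
      _ ≤ _ := norm_add_le _ _
      _ ≤ _ := add_le_add_left (key _ _) _
  have hlim : Tendsto (fun t : ℝ => t * (1 - t)⁻¹) (nhdsWithin 1 (Set.Ico 0 1)) atTop := by
    refine Tendsto.pos_mul_atTop (C := 1) one_pos ?_ ?_
    · exact tendsto_nhdsWithin_of_tendsto_nhds tendsto_id
    · refine tendsto_inv_nhdsGT_zero.comp (tendsto_nhdsWithin_iff.2 ⟨?_, ?_⟩)
      · refine tendsto_nhdsWithin_of_tendsto_nhds ?_
        have : Continuous fun t : ℝ => 1 - t := by fun_prop
        simpa using this.tendsto 1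
      · filter_upwards [self_mem_nhdsWithin] with t ht
        exact sub_pos.2 ht.2
  refine ⟨fun t => γ (t * (1 - t)⁻¹), ?_, fun t _ => pathProduct_mem_unitary hu _ _,
    hγlim.comp hlim⟩
  refine hγc.comp (continuousOn_id.mul ((continuousOn_const.sub continuousOn_id).inv₀ ?_)) ?_
  · intro t ht; exact (sub_pos.2 ht.2).ne'
  · intro t ht
    exact mul_nonneg ht.1 (inv_nonneg.2 (sub_pos.2 ht.2).le)

theorem opUnitaryOrbit_conj {X Y u : H →L[ℂ] H} (hu : u ∈ unitary (H →L[ℂ] H))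
    (hY : Y ∈ opUnitaryOrbit X) : star u * Y * u ∈ opUnitaryOrbit X := by
  obtain ⟨v, hv, rfl⟩ := hY
  exact ⟨v * u, mul_mem hv hu, by rw [star_mul]; noncomm_ring⟩

theorem closure_opUnitaryOrbit_conj {X Y u : H →L[ℂ] H} (hu : u ∈ unitary (H →L[ℂ] H))
    (hY : Y ∈ closure (opUnitaryOrbit X)) : star u * Y * u ∈ closure (opUnitaryOrbit X) := by
  have : Continuous fun Z : H →L[ℂ] H => star u * Z * u := by fun_prop
  exact map_mem_closure (f := fun Z : H →L[ℂ] H => star u * Z * u) this hY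
    fun Z hZ => opUnitaryOrbit_conj hu hZ

theorem StrongInternalPathOp.mem_closure {X Y C : H →L[ℂ] H} (h : StrongInternalPathOp Y C)
    (hY : Y ∈ closure (opUnitaryOrbit X)) : C ∈ closure (opUnitaryOrbit X) := by
  obtain ⟨γ, -, hu, hl⟩ := h
  have : (nhdsWithin (1 : ℝ) (Set.Ico 0 1)).NeBot := by
    rw [← mem_closure_iff_nhdsWithin_neBot, closure_Ico zero_ne_one]; simp
  refine isClosed_closure.mem_of_tendsto hl ?_
  filter_upwards [self_mem_nhdsWithin] with t ht
  exact closure_opUnitaryOrbit_conj (hu t ht) hY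

/-- Unitarily equivalent operators are joined within any closed orbit containing them. -/
theorem joinedIn_conj {X Y u : H →L[ℂ] H} (hu : u ∈ unitary (H →L[ℂ] H))
    (hY : Y ∈ closure (opUnitaryOrbit X)) :
    JoinedIn (closure (opUnitaryOrbit X)) Y (star u * Y * u) := by
  obtain ⟨p⟩ := joined_one_unitary (⟨u, hu⟩ : unitary (H →L[ℂ] H))
  refine ⟨⟨⟨fun t => star (p t : H →L[ℂ] H) * Y * p t, by fun_prop⟩, by simp, by simp⟩, fun t => ?_⟩
  exact closure_opUnitaryOrbit_conj (p t).2 hY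

theorem StrongInternalPathOp.joinedIn {X Y C : H →L[ℂ] H} (h : StrongInternalPathOp Y C)
    (hY : Y ∈ closure (opUnitaryOrbit X)) : JoinedIn (closure (opUnitaryOrbit X)) Y C := by
  have hC := h.mem_closure hY
  obtain ⟨γ, hc, hu, hl⟩ := h
  refine (joinedIn_conj (hu 0 ⟨le_rfl, one_pos⟩) hY).trans ?_
  set f : ℝ → H →L[ℂ] H := fun t => if t = 1 then C else star (γ t) * Y * γ t with hf
  have hfc : ContinuousOn f (Set.Icc 0 1) := by
    have hf1 : ContinuousOn f (Set.Ico 0 1) := by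
      refine ContinuousOn.congr (f := fun t => star (γ t) * Y * γ t) (by fun_prop) fun t ht => ?_
      simp [hf, ht.2.ne]
    intro t ht
    rcases ht.2.eq_or_lt with rfl | ht1
    · rw [← Set.Ico_insert_right zero_le_one, continuousWithinAt_insert_self]
      have : f 1 = C := by simp [hf]
      rw [ContinuousWithinAt, this]
      refine hl.congr' ?_
      filter_upwards [self_mem_nhdsWithin] with t ht
      simp [hf, ht.2.ne]
    · refine (hf1 t ⟨ht.1, ht1⟩).mono_of_mem_nhdsWithin ?_
      filter_upwards [self_mem_nhdsWithin, mem_nhdsWithin_of_mem_nhds (Iio_mem_nhds ht1)]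
        with x hx hx'
      exact ⟨hx.1, hx'⟩
  refine ⟨⟨⟨fun t => f t, ?_⟩, ?_, ?_⟩, ?_⟩
  · exact hfc.comp_continuous continuous_subtype_val fun t => t.2
  · simp [hf]
  · simp [hf]
  · intro t
    change f t ∈ _
    by_cases ht : (t : ℝ) = 1
    · simp only [hf, ht, if_true]
      exact hC
    · simp only [hf, if_neg ht]
      exact closure_opUnitaryOrbit_conj (hu t ⟨t.2.1, lt_of_le_of_ne t.2.2 ht⟩) hY

section OrthogonalSeries

omit [CompleteSpace H] in
theorem norm_sq_sum_of_pairwise_orthogonal {ι : Type*} {v : ι → H}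
    (h : Pairwise fun i j => ⟪v i, v j⟫ = 0) (s : Finset ι) :
    ‖∑ i ∈ s, v i‖ ^ 2 = ∑ i ∈ s, ‖v i‖ ^ 2 := by
  classical
  induction s using Finset.induction_on with
  | empty => simp
  | insert a s ha ih =>
    rw [Finset.sum_insert ha, Finset.sum_insert ha, norm_add_sq (𝕜 := ℂ), ih, inner_sum,
      Finset.sum_eq_zero fun j hj => h (ne_of_mem_of_not_mem hj ha).symm]
    simp

theorem summable_of_pairwise_orthogonal {ι : Type*} {v : ι → H}
    (h : Pairwise fun i j => ⟪v i, v j⟫ = 0) (hs : Summable fun i => ‖v i‖ ^ 2) :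
    Summable v := by
  have hV : OrthogonalFamily ℂ (fun i => (ℂ ∙ v i : Submodule ℂ H))
      fun i => (ℂ ∙ v i : Submodule ℂ H).subtypeₗᵢ := by
    refine OrthogonalFamily.of_pairwise fun i j hij => ?_
    refine Submodule.isOrtho_span.2 ?_
    rintro _ rfl _ rfl
    exact h hij
  exact (hV.summable_iff_norm_sq_summable fun i => ⟨v i, Submodule.mem_span_singleton_self _⟩).2 hs

omit [CompleteSpace H] in
theorem hasSum_norm_sq_of_pairwise_orthogonal {ι : Type*} {v : ι → H} {a : H}
    (h : Pairwise fun i j => ⟪v i, v j⟫ = 0) (ha : HasSum v a) :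
    HasSum (fun i => ‖v i‖ ^ 2) (‖a‖ ^ 2) := by
  have : Tendsto (fun s : Finset ι => ‖∑ i ∈ s, v i‖ ^ 2) atTop (nhds (‖a‖ ^ 2)) :=
    (Filter.Tendsto.norm ha).pow 2
  simp only [norm_sq_sum_of_pairwise_orthogonal h] at this
  exact this

end OrthogonalSeries

theorem exists_strong_limit (g : ℕ → H →L[ℂ] H)
    (h : ∀ x, ∃ y, Tendsto (fun n => g n x) atTop (nhds y)) :
    ∃ B : H →L[ℂ] H, ∀ x, Tendsto (fun n => g n x) atTop (nhds (B x)) := by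
  choose f hf using h
  exact ⟨continuousLinearMapOfTendsto g (tendsto_pi_nhds.2 hf), hf⟩

theorem star_mul_self_eq_of_norm {A p : H →L[ℂ] H} (hp : star p * p = p)
    (h : ∀ x, ‖A x‖ ^ 2 = ‖p x‖ ^ 2) : star A * A = p := by
  apply ContinuousLinearMap.coe_injective
  rw [← ext_inner_map]
  intro x
  have h1 : ⟪(star A * A) x, x⟫ = ((‖A x‖ ^ 2 : ℝ) : ℂ) := by
    rw [mul_apply_eq_comp, inner_star_apply, inner_self_eq_norm_sq_to_K]; norm_cast
  have h2 : ⟪(star p * p) x, x⟫ = ((‖p x‖ ^ 2 : ℝ) : ℂ) := by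
    rw [mul_apply_eq_comp, inner_star_apply, inner_self_eq_norm_sq_to_K]; norm_cast
  rw [hp] at h2
  change ⟪(star A * A) x, x⟫ = ⟪p x, x⟫
  rw [h1, h2, h]

theorem norm_apply_sq_of_star_mul_self {A p : H →L[ℂ] H} (hp : star p * p = p)
    (h : star A * A = p) (x : H) : ‖A x‖ ^ 2 = ‖p x‖ ^ 2 := by
  have h1 : ⟪(star A * A) x, x⟫ = ((‖A x‖ ^ 2 : ℝ) : ℂ) := by
    rw [mul_apply_eq_comp, inner_star_apply, inner_self_eq_norm_sq_to_K]; norm_cast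
  have h2 : ⟪(star p * p) x, x⟫ = ((‖p x‖ ^ 2 : ℝ) : ℂ) := by
    rw [mul_apply_eq_comp, inner_star_apply, inner_self_eq_norm_sq_to_K]; norm_cast
  rw [h, ← hp, h2] at h1
  exact_mod_cast h1.symm

theorem norm_le_one_of_star_mul_self {p : H →L[ℂ] H} (hp : star p * p = p) : ‖p‖ ≤ 1 := by
  have h := CStarRing.norm_star_mul_self (x := p)
  rw [hp] at h
  nlinarith [norm_nonneg p]

/-- A sequence of partial isometries with common initial projection `p` and pairwise orthogonal
ranges. -/
structure IsOrthoIsometrySeq (W : ℕ → H →L[ℂ] H) (p : H →L[ℂ] H) : Prop where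
  star_mul_self (i : ℕ) : star (W i) * W i = p
  star_mul_of_ne {i j : ℕ} (h : i ≠ j) : star (W i) * W j = 0
  mul_proj (i : ℕ) : W i * p = W i
  star_proj : star p = p

namespace IsOrthoIsometrySeq

variable {W : ℕ → H →L[ℂ] H} {p : H →L[ℂ] H}

theorem proj_mul (hW : IsOrthoIsometrySeq W p) : p * p = p := by
  nth_rw 1 [← hW.star_mul_self 0]
  rw [mul_assoc, hW.mul_proj, hW.star_mul_self]

theorem star_proj_mul (hW : IsOrthoIsometrySeq W p) : star p * p = p := by
  rw [hW.star_proj, hW.proj_mul]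

theorem proj_mul_star (hW : IsOrthoIsometrySeq W p) (i : ℕ) : p * star (W i) = star (W i) := by
  have := congrArg star (hW.mul_proj i)
  rwa [star_mul, hW.star_proj] at this

theorem norm_apply_le (hW : IsOrthoIsometrySeq W p) (i : ℕ) (x : H) : ‖W i x‖ ≤ ‖x‖ := by
  have h1 := norm_apply_sq_of_star_mul_self hW.star_proj_mul (hW.star_mul_self i) x
  have h2 := (p.le_opNorm x).trans
    (mul_le_of_le_one_left (norm_nonneg x) (norm_le_one_of_star_mul_self hW.star_proj_mul))
  rw [sq_eq_sq₀ (norm_nonneg _) (norm_nonneg _)] at h1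
  rwa [h1]

theorem norm_apply_star (hW : IsOrthoIsometrySeq W p) (i : ℕ) (x : H) :
    ‖W i (star (W i) x)‖ = ‖star (W i) x‖ := by
  have h1 := norm_apply_sq_of_star_mul_self hW.star_proj_mul (hW.star_mul_self i) (star (W i) x)
  rw [sq_eq_sq₀ (norm_nonneg _) (norm_nonneg _), ← mul_apply_eq_comp p, hW.proj_mul_star] at h1
  exact h1

theorem inner_eq_zero (hW : IsOrthoIsometrySeq W p) {i j : ℕ} (h : i ≠ j) (x y : H) :
    ⟪W i x, W j y⟫ = 0 := by
  rw [← inner_star_apply, ← mul_apply_eq_comp, hW.star_mul_of_ne h.symm]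
  simp

theorem summable_norm_sq_star (hW : IsOrthoIsometrySeq W p) (x : H) :
    Summable fun i => ‖star (W i) x‖ ^ 2 := by
  refine summable_of_sum_le (c := ‖x‖ ^ 2) (fun _ => by positivity) fun s => ?_
  set z := ∑ i ∈ s, W i (star (W i) x) with hz
  have h1 : ‖z‖ ^ 2 = ∑ i ∈ s, ‖star (W i) x‖ ^ 2 := by
    rw [hz, norm_sq_sum_of_pairwise_orthogonal fun i j hij => hW.inner_eq_zero hij _ _]
    simp only [hW.norm_apply_star]
  have h2 : ⟪x, z⟫ = ((∑ i ∈ s, ‖star (W i) x‖ ^ 2 : ℝ) : ℂ) := by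
    rw [hz, inner_sum]
    push_cast
    refine Finset.sum_congr rfl fun i _ => ?_
    rw [← inner_star_apply, inner_self_eq_norm_sq_to_K]
    norm_cast
  have h3 := norm_inner_le_norm (𝕜 := ℂ) x z
  rw [h2, ← h1, Complex.norm_real, Real.norm_of_nonneg (by positivity)] at h3
  rw [← h1]
  have h4 : ‖z‖ ≤ ‖x‖ := by
    rcases (norm_nonneg z).eq_or_lt with h | h
    · rw [← h]; exact norm_nonneg _
    · nlinarith
  gcongr

theorem tendsto_star_apply (hW : IsOrthoIsometrySeq W p) (x : H) :
    Tendsto (fun i => star (W i) x) atTop (nhds 0) := by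
  have h := (hW.summable_norm_sq_star x).tendsto_atTop_zero
  rw [tendsto_zero_iff_norm_tendsto_zero]
  have := (Real.continuous_sqrt.tendsto 0).comp h
  simpa [Function.comp_def] using this

theorem summable_apply (hW : IsOrthoIsometrySeq W p) {f : ℕ → ℕ} (hf : Function.Injective f)
    {x : ℕ → H} (hx : Summable fun i => ‖x i‖ ^ 2) : Summable fun i => W (f i) (x i) := by
  refine summable_of_pairwise_orthogonal
    (fun i j hij => hW.inner_eq_zero (fun h => hij (hf h)) _ _) ?_
  refine hx.of_nonneg_of_le (fun _ => by positivity) fun i => ?_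
  have := hW.norm_apply_le (f i) (x i)
  gcongr

end IsOrthoIsometrySeq

/-- The unitary `1 - (1 - z) Q` attached to a projection `Q` and a phase `z`. -/
theorem one_sub_smul_proj_mem_unitary {Q : H →L[ℂ] H} (h1 : star Q = Q) (h2 : Q * Q = Q) {z : ℂ}
    (hz : star z * z = 1) : 1 - (1 - z) • Q ∈ unitary (H →L[ℂ] H) := by
  have h3 : star (1 - (1 - z) • Q) = 1 - (1 - star z) • Q := by
    rw [star_sub, star_one, star_smul, h1, star_sub, star_one]
  constructor
  · simp only [h3, sub_mul, mul_sub, smul_mul_smul_comm, h2, mul_one, one_mul]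
    rw [sub_sub, ← add_sub_assoc, ← add_smul, ← sub_smul, sub_eq_self]
    convert zero_smul ℂ Q using 2
    linear_combination -hz
  · simp only [h3, sub_mul, mul_sub, smul_mul_smul_comm, h2, mul_one, one_mul]
    rw [sub_sub, ← add_sub_assoc, ← add_smul, ← sub_smul, sub_eq_self]
    convert zero_smul ℂ Q using 2
    linear_combination -hz

theorem norm_conj_one_sub_smul_proj_sub_le {Q : H →L[ℂ] H} (h1 : star Q = Q) (h2 : Q * Q = Q)
    {z : ℂ} (hz : star z * z = 1) (X : H →L[ℂ] H) :
    ‖star (1 - (1 - z) • Q) * X * (1 - (1 - z) • Q) - X‖ ≤ 2 * ‖X * Q - Q * X‖ := by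
  have hu := one_sub_smul_proj_mem_unitary h1 h2 hz
  have : star (1 - (1 - z) • Q) * X * (1 - (1 - z) • Q) - X =
      star (1 - (1 - z) • Q) * (-((1 - z) • (X * Q - Q * X))) := by
    have h3 : star (1 - (1 - z) • Q) * (1 - (1 - z) • Q) * X = X := by rw [hu.1, one_mul]
    conv_lhs => enter [2]; rw [← h3]
    rw [mul_assoc, mul_assoc, ← mul_sub]
    congr 1
    rw [mul_sub, sub_mul, one_mul, mul_one, smul_sub, mul_smul_comm, smul_mul_assoc]
    abel
  rw [this, CStarRing.norm_mem_unitary_mul _ (Unitary.star_mem hu), norm_neg, norm_smul]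
  gcongr
  have hz1 : ‖z‖ = 1 := by
    have : ‖star z * z‖ = 1 := by rw [hz, norm_one]
    rw [norm_mul, norm_star] at this
    nlinarith [norm_nonneg z]
  calc ‖1 - z‖ ≤ ‖(1 : ℂ)‖ + ‖z‖ := norm_sub_le _ _
    _ = 2 := by rw [hz1, norm_one]; norm_num

/-- `1 - D D*`, with `D = W j - W (j + 1)`, swaps the ranges of `W j` and `W (j + 1)`. The product
of the first `n` swaps moves the range of `W 0` to that of `W n` and shifts those in between. -/
noncomputable def swapProduct (W : ℕ → H →L[ℂ] H) : ℕ → H →L[ℂ] H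
  | 0 => 1
  | n + 1 => (1 - (W n - W (n + 1)) * star (W n - W (n + 1))) * swapProduct W n

namespace IsOrthoIsometrySeq

variable {W : ℕ → H →L[ℂ] H} {p : H →L[ℂ] H}

theorem star_diff_mul (hW : IsOrthoIsometrySeq W p) (n : ℕ) :
    star (W n - W (n + 1)) * (W n - W (n + 1)) = p + p := by
  rw [star_sub, sub_mul, mul_sub, mul_sub, hW.star_mul_self, hW.star_mul_self,
    hW.star_mul_of_ne (by omega), hW.star_mul_of_ne (by omega)]
  abel

theorem diff_mul_proj (hW : IsOrthoIsometrySeq W p) (n : ℕ) :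
    (W n - W (n + 1)) * p = W n - W (n + 1) := by
  rw [sub_mul, hW.mul_proj, hW.mul_proj]

theorem star_swap (n : ℕ) : star (1 - (W n - W (n + 1)) * star (W n - W (n + 1))) =
    1 - (W n - W (n + 1)) * star (W n - W (n + 1)) := by
  rw [star_sub, star_mul, star_star, star_one]

theorem swap_mul_of_lt (hW : IsOrthoIsometrySeq W p) {n j : ℕ} (h : n + 1 < j) :
    (1 - (W n - W (n + 1)) * star (W n - W (n + 1))) * W j = W j := by
  have h0 : star (W n - W (n + 1)) * W j = 0 := by
    rw [star_sub, sub_mul, hW.star_mul_of_ne (by omega), hW.star_mul_of_ne (by omega), sub_zero]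
  rw [sub_mul, mul_assoc, h0, one_mul, mul_zero, sub_zero]

theorem swap_mul_succ (hW : IsOrthoIsometrySeq W p) (n : ℕ) :
    (1 - (W n - W (n + 1)) * star (W n - W (n + 1))) * W (n + 1) = W n := by
  have h0 : star (W n - W (n + 1)) * W (n + 1) = -p := by
    rw [star_sub, sub_mul, hW.star_mul_of_ne (by omega), hW.star_mul_self, zero_sub]
  rw [sub_mul, mul_assoc, h0, one_mul, mul_neg, hW.diff_mul_proj]
  abel

theorem star_swapProduct_mul (hW : IsOrthoIsometrySeq W p) (n : ℕ) :
    star (swapProduct W n) * W n = W 0 ∧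
      ∀ j, n < j → star (swapProduct W n) * W j = W j := by
  induction n with
  | zero => simp [swapProduct]
  | succ n ih =>
    simp only [swapProduct, star_mul (_ - _), star_swap]
    refine ⟨?_, fun j hj => ?_⟩
    · rw [mul_assoc, hW.swap_mul_succ, ih.1]
    · rw [mul_assoc, hW.swap_mul_of_lt hj, ih.2 j (by omega)]

theorem star_swapProduct_mul_diff (hW : IsOrthoIsometrySeq W p) (n : ℕ) :
    star (swapProduct W n) * (W n - W (n + 1)) = W 0 - W (n + 1) := by
  rw [mul_sub, (hW.star_swapProduct_mul n).1, (hW.star_swapProduct_mul n).2 _ n.lt_succ_self]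

theorem star_swapProduct_eq (hW : IsOrthoIsometrySeq W p) (n : ℕ) :
    star (swapProduct W n) = 1 - W 0 * (star (W 0) - star (W n)) +
      ∑ j ∈ Finset.range n, W (j + 1) * (star (W j) - star (W (j + 1))) := by
  induction n with
  | zero => simp [swapProduct]
  | succ n ih =>
    have : star (swapProduct W (n + 1)) = star (swapProduct W n) -
        (W 0 - W (n + 1)) * (star (W n) - star (W (n + 1))) := by
      rw [swapProduct, star_mul, star_swap, mul_sub, mul_one, ← mul_assoc,
        hW.star_swapProduct_mul_diff, star_sub]
    rw [this, ih, Finset.sum_range_succ]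
    noncomm_ring

theorem swapProduct_eq (hW : IsOrthoIsometrySeq W p) (n : ℕ) :
    swapProduct W n = 1 - ∑ j ∈ Finset.range n,
      (W j - W (j + 1)) * (star (W 0) - star (W (j + 1))) := by
  induction n with
  | zero => simp [swapProduct]
  | succ n ih =>
    have h := congrArg star (hW.star_swapProduct_mul_diff n)
    rw [star_mul, star_star] at h
    rw [swapProduct, sub_mul, one_mul, mul_assoc, h, star_sub, Finset.sum_range_succ, ih]
    noncomm_ring

theorem swapProduct_mem_unitary (hW : IsOrthoIsometrySeq W p) (n : ℕ) :
    swapProduct W n ∈ unitary (H →L[ℂ] H) := by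
  induction n with
  | zero => exact one_mem _
  | succ n ih =>
    refine mul_mem ?_ ih
    have : (1 - (W n - W (n + 1)) * star (W n - W (n + 1))) *
        (1 - (W n - W (n + 1)) * star (W n - W (n + 1))) = 1 := by
      have h : (W n - W (n + 1)) * star (W n - W (n + 1)) *
          ((W n - W (n + 1)) * star (W n - W (n + 1))) =
          (W n - W (n + 1)) * star (W n - W (n + 1)) +
          (W n - W (n + 1)) * star (W n - W (n + 1)) := by
        rw [mul_assoc, ← mul_assoc (star _), hW.star_diff_mul, ← mul_assoc, mul_add, add_mul,
          hW.diff_mul_proj]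
      generalize (W n - W (n + 1)) * star (W n - W (n + 1)) = P at h
      rw [mul_sub, sub_mul, sub_mul, h, one_mul, mul_one, one_mul]
      abel
    exact ⟨by rw [star_swap, this], by rw [star_swap, this]⟩

theorem exists_tendsto_star_swapProduct (hW : IsOrthoIsometrySeq W p) (x : H) :
    ∃ y, Tendsto (fun n => star (swapProduct W n) x) atTop (nhds y) := by
  have hs : Summable fun j => W (j + 1) (star (W j) x - star (W (j + 1)) x) := by
    simp only [map_sub]
    refine Summable.sub ?_ ?_
    · exact hW.summable_apply (add_left_injective 1) (hW.summable_norm_sq_star x)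
    · exact hW.summable_apply (add_left_injective 1)
        ((summable_nat_add_iff 1).2 (hW.summable_norm_sq_star x))
  have h0 : Tendsto (fun n => x - W 0 (star (W 0) x - star (W n) x)) atTop
      (nhds (x - W 0 (star (W 0) x - 0))) :=
    tendsto_const_nhds.sub (((W 0).continuous.tendsto _).comp
      (tendsto_const_nhds.sub (hW.tendsto_star_apply x)))
  refine ⟨_, (h0.add hs.hasSum.tendsto_sum_nat).congr fun n => ?_⟩
  rw [hW.star_swapProduct_eq]
  simp

theorem exists_tendsto_swapProduct (hW : IsOrthoIsometrySeq W p) {x : H}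
    (hx : star (W 0) x = 0) :
    ∃ y, Tendsto (fun n => swapProduct W n x) atTop (nhds y) := by
  have hs : Summable fun j => (W j - W (j + 1)) (- star (W (j + 1)) x) := by
    simp only [sub_apply]
    have h : Summable fun j => ‖-star (W (j + 1)) x‖ ^ 2 := by
      simpa only [norm_neg] using (summable_nat_add_iff 1).2 (hW.summable_norm_sq_star x)
    exact (hW.summable_apply Function.injective_id h).sub
      (hW.summable_apply (add_left_injective 1) h)
  refine ⟨_, (tendsto_const_nhds (x := x)).sub hs.hasSum.tendsto_sum_nat |>.congr fun n => ?_⟩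
  rw [hW.swapProduct_eq]
  simp [hx]

theorem norm_commutator_le (hW : IsOrthoIsometrySeq W p) {X Y : H →L[ℂ] H} {ε : ℕ → ℝ}
    (h1 : ∀ i, ‖X * W i - W i * Y‖ ≤ ε i) (h2 : ∀ i, ‖star X * W i - W i * star Y‖ ≤ ε i) (n : ℕ) :
    ‖X * ((W n - W (n + 1)) * star (W n - W (n + 1))) -
      (W n - W (n + 1)) * star (W n - W (n + 1)) * X‖ ≤ 4 * (ε n + ε (n + 1)) := by
  set D := W n - W (n + 1) with hD
  have hW1 : ∀ i, ‖W i‖ ≤ 1 := fun i =>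
    ContinuousLinearMap.opNorm_le_bound _ zero_le_one fun x => by
      simpa using hW.norm_apply_le i x
  have hDn : ‖D‖ ≤ 2 := (norm_sub_le _ _).trans (by linarith [hW1 n, hW1 (n + 1)])
  have hd1 : ‖X * D - D * Y‖ ≤ ε n + ε (n + 1) := by
    have : X * D - D * Y = (X * W n - W n * Y) - (X * W (n + 1) - W (n + 1) * Y) := by
      rw [hD]; noncomm_ring
    rw [this]
    exact (norm_sub_le _ _).trans (add_le_add (h1 _) (h1 _))
  have hd2 : ‖star X * D - D * star Y‖ ≤ ε n + ε (n + 1) := by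
    have : star X * D - D * star Y = (star X * W n - W n * star Y) -
        (star X * W (n + 1) - W (n + 1) * star Y) := by
      rw [hD]; noncomm_ring
    rw [this]
    exact (norm_sub_le _ _).trans (add_le_add (h2 _) (h2 _))
  have : X * (D * star D) - D * star D * X =
      (X * D - D * Y) * star D - D * star (star X * D - D * star Y) := by
    simp only [star_sub, star_mul, star_star]
    noncomm_ring
  rw [this]
  have h3 : ‖(X * D - D * Y) * star D‖ ≤ (ε n + ε (n + 1)) * 2 :=
    (norm_mul_le _ _).trans (mul_le_mul hd1 (by rwa [norm_star]) (norm_nonneg _)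
      ((norm_nonneg _).trans hd1))
  have h4 : ‖D * star (star X * D - D * star Y)‖ ≤ 2 * (ε n + ε (n + 1)) :=
    (norm_mul_le _ _).trans (mul_le_mul hDn (by rwa [norm_star]) (norm_nonneg _) zero_le_two)
  linarith [norm_sub_le ((X * D - D * Y) * star D) (D * star (star X * D - D * star Y))]

/-- An operator that is asymptotically intertwined with `Y` by pairwise orthogonal copies of the
projection `p` has a strong internal path to a copy of `X ⊕ Y p`. -/
theorem exists_strongInternalPath (hW : IsOrthoIsometrySeq W p) {X Y : H →L[ℂ] H} {ε : ℕ → ℝ}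
    (hε : Summable ε) (h1 : ∀ i, ‖X * W i - W i * Y‖ ≤ ε i)
    (h2 : ∀ i, ‖star X * W i - W i * star Y‖ ≤ ε i) :
    ∃ C B V : H →L[ℂ] H, StrongInternalPathOp X C ∧ star B * B = 1 ∧ star V * V = p ∧
      B * star B + V * star V = 1 ∧ V * p = V ∧ C * B = B * X ∧ C * V = V * Y := by
  set Q : ℕ → H →L[ℂ] H := fun j => (1 / 2 : ℂ) • ((W j - W (j + 1)) * star (W j - W (j + 1)))
    with hQ
  have hQs : ∀ j, star (Q j) = Q j := by
    intro j
    simp only [hQ, star_smul, star_mul (W j - _), star_star]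
    congr 1
    simp
  have hQQ : ∀ j, Q j * Q j = Q j := by
    intro j
    simp only [hQ, smul_mul_smul_comm]
    rw [mul_assoc, ← mul_assoc (star _), hW.star_diff_mul, ← mul_assoc, mul_add, add_mul,
          hW.diff_mul_proj, ← two_smul ℂ, smul_smul]
    congr 1
    norm_num
  have hz : ∀ s : ℝ, star (Complex.exp (s * Real.pi * Complex.I)) *
      Complex.exp (s * Real.pi * Complex.I) = 1 := by
    intro s
    rw [Complex.star_def, ← Complex.exp_conj, ← Complex.exp_add]
    simp
  obtain ⟨C, hXC, hC⟩ := exists_strongInternalPath_of_summable X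
    (fun j s => 1 - (1 - Complex.exp (s * Real.pi * Complex.I)) • Q j)
    (fun j => by fun_prop) (fun j s => one_sub_smul_proj_mem_unitary (hQs j) (hQQ j) (hz s))
    (fun j => by simp) (fun j => 4 * (ε j + ε (j + 1)))
    ((hε.add ((summable_nat_add_iff 1).2 hε)).mul_left 4)
    (fun j s => by
      refine (norm_conj_one_sub_smul_proj_sub_le (hQs j) (hQQ j) (hz s) X).trans ?_
      have h3 := hW.norm_commutator_le h1 h2 j
      simp only [hQ]
      rw [mul_smul_comm, smul_mul_assoc, ← smul_sub, norm_smul]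
      have h4 : ‖(1 / 2 : ℂ)‖ = 1 / 2 := by norm_num
      rw [h4]
      linarith)
    (swapProduct W) rfl (fun j => by
      rw [swapProduct]
      congr 2
      simp only [hQ, smul_smul]
      norm_num)
  obtain ⟨B, hB⟩ := exists_strong_limit _ hW.exists_tendsto_star_swapProduct
  have hgu := hW.swapProduct_mem_unitary
  have hBn : ∀ x, ‖B x‖ = ‖x‖ := by
    intro x
    refine tendsto_nhds_unique (hB x).norm (tendsto_const_nhds.congr fun n => ?_)
    refine (unitary_norm_apply ?_ x).symm
    rw [star_star, (hgu n).2]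
  have hBB : star B * B = 1 := star_mul_self_eq_of_norm (by simp) (by simp [hBn])
  have hW0B : ∀ x, star (W 0) (B x) = 0 := by
    intro x
    refine tendsto_nhds_unique (((star (W 0)).continuous.tendsto _).comp (hB x))
      ((hW.tendsto_star_apply x).congr fun n => ?_)
    have h := congrArg star (hW.star_swapProduct_mul n).1
    rw [star_mul, star_star] at h
    have h3 : star (W 0) * star (swapProduct W n) = star (W n) := by
      rw [← h, mul_assoc, (hgu n).2, mul_one]
    rw [← h3]; rfl
  have hBW0 : star B * W 0 = 0 := by
    have h : star (W 0) * B = 0 := by ext x; exact hW0B x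
    have := congrArg star h
    rwa [star_mul, star_star, star_zero] at this
  refine ⟨C, B, W 0, hXC, hBB, hW.star_mul_self 0, ?_, hW.mul_proj 0, ?_, ?_⟩
  · ext y
    set y' := y - W 0 (star (W 0) y) with hy'
    have hy0 : star (W 0) y' = 0 := by
      have h : star (W 0) * W 0 * star (W 0) = star (W 0) := by
        rw [hW.star_mul_self, hW.proj_mul_star]
      have h' := congrArg (fun T : H →L[ℂ] H => T y) h
      simp only [mul_apply_eq_comp] at h'
      rw [hy', map_sub, h', sub_self]
    obtain ⟨z, hz⟩ := hW.exists_tendsto_swapProduct hy0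
    have hBz : B z = y' := by
      refine tendsto_nhds_unique (hB z) ?_
      rw [tendsto_iff_norm_sub_tendsto_zero] at hz ⊢
      refine hz.congr fun n => ?_
      have h3 : star (star (swapProduct W n)) * star (swapProduct W n) = 1 := by
        rw [star_star, (hgu n).2]
      rw [← unitary_norm_apply h3, map_sub, ← mul_apply_eq_comp, (hgu n).1, one_apply_eq_self,
        ← norm_neg, neg_sub]
    have hy : y = B z + W 0 (star (W 0) y) := by rw [hBz, hy']; abel
    have hBy : star B y = z := by
      rw [hy, map_add, ← mul_apply_eq_comp, hBB, ← mul_apply_eq_comp, hBW0]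
      simp
    simp only [add_apply, mul_apply_eq_comp, one_apply_eq_self, hBy]
    exact hy.symm
  · ext x
    refine tendsto_nhds_unique ((isBoundedBilinearMap_apply.continuous.tendsto (C, B x)).comp
      (hC.prodMk_nhds (hB x))) ((hB (X x)).congr fun n => ?_)
    have h3 : star (swapProduct W n) * X * swapProduct W n * star (swapProduct W n) =
        star (swapProduct W n) * X := by
      rw [mul_assoc, (hgu n).2, mul_one]
    exact (congrArg (fun T : H →L[ℂ] H => T x) h3).symm
  · have hl : Tendsto (fun n => star (swapProduct W n) * X * swapProduct W n * W 0) atTop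
        (nhds (C * W 0)) := hC.mul_const _
    refine tendsto_nhds_unique hl ?_
    rw [tendsto_iff_norm_sub_tendsto_zero]
    refine squeeze_zero (fun _ => norm_nonneg _) (fun n => ?_) hε.tendsto_atTop_zero
    have h3 : swapProduct W n * W 0 = W n := by
      rw [← (hW.star_swapProduct_mul n).1, ← mul_assoc, (hgu n).2, one_mul]
    have h4 : star (swapProduct W n) * X * swapProduct W n * W 0 - W 0 * Y =
        star (swapProduct W n) * (X * W n - W n * Y) := by
      rw [mul_assoc _ (swapProduct W n), h3, mul_sub, ← mul_assoc, ← mul_assoc,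
        (hW.star_swapProduct_mul n).1]
    rw [h4, CStarRing.norm_mem_unitary_mul _ (Unitary.star_mem (hgu n))]
    exact h1 n

end IsOrthoIsometrySeq

section CosBump

/-- A bump supported on `[-1, 1]` whose integer translates have squares summing to one. -/
noncomputable def cosBump (t : ℝ) : ℝ := Real.cos (Real.pi / 2 * max (-1) (min 1 t))

theorem cosBump_of_one_le_abs {t : ℝ} (h : 1 ≤ |t|) : cosBump t = 0 := by
  unfold cosBump
  rcases le_abs.1 h with h | h
  · rw [min_eq_left h, max_eq_right (by norm_num), mul_one, Real.cos_pi_div_two]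
  · rw [min_eq_right (by linarith), max_eq_left (by linarith), mul_neg_one, Real.cos_neg,
      Real.cos_pi_div_two]

theorem abs_cosBump_sub_le (s t : ℝ) : |cosBump s - cosBump t| ≤ 2 * |s - t| := by
  unfold cosBump
  have hl : LipschitzWith 1 Real.cos := by
    refine lipschitzWith_of_nnnorm_deriv_le Real.differentiable_cos fun x => ?_
    rw [← NNReal.coe_le_coe]
    simpa using Real.abs_sin_le_one x
  have h1 := hl.dist_le_mul (Real.pi / 2 * max (-1) (min 1 s)) (Real.pi / 2 * max (-1) (min 1 t))
  rw [Real.dist_eq, Real.dist_eq, ← mul_sub, abs_mul, abs_of_pos Real.pi_div_two_pos] at h1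
  have h2 : |max (-1) (min 1 s) - max (-1) (min 1 t)| ≤ |s - t| := by
    have h3 := abs_max_sub_max_le_max (-1) (min 1 s) (-1) (min 1 t)
    have h4 := abs_min_sub_min_le_max 1 s 1 t
    simp only [sub_self, abs_zero] at h3 h4
    rw [max_eq_right (abs_nonneg (min 1 s - min 1 t))] at h3
    rw [max_eq_right (abs_nonneg (s - t))] at h4
    exact h3.trans h4
  have h5 := Real.pi_le_four
  have h6 := abs_nonneg (max (-1) (min 1 s) - max (-1) (min 1 t))
  simp only [NNReal.coe_one, one_mul] at h1
  nlinarith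

theorem hasSum_sq_cosBump {t : ℝ} (ht : 0 ≤ t) :
    HasSum (fun k : ℕ => cosBump (t - k) ^ 2) 1 := by
  set n := ⌊t⌋₊ with hn
  have h1 : (n : ℝ) ≤ t := Nat.floor_le ht
  have h2 : t < n + 1 := Nat.lt_floor_add_one t
  have h3 : ∑ k ∈ ({n, n + 1} : Finset ℕ), cosBump (t - k) ^ 2 = 1 := by
    rw [Finset.sum_pair (by omega)]
    unfold cosBump
    push_cast
    rw [min_eq_right (by linarith), max_eq_right (by linarith), min_eq_right (by linarith),
      max_eq_right (by linarith)]
    have h4 : Real.pi / 2 * (t - (n + 1)) = -(Real.pi / 2 - Real.pi / 2 * (t - n)) := by ring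
    rw [h4, Real.cos_neg, Real.cos_pi_div_two_sub, Real.cos_sq_add_sin_sq]
  rw [← h3]
  refine hasSum_sum_of_ne_finset_zero fun k hk => ?_
  simp only [Finset.mem_insert, Finset.mem_singleton, not_or] at hk
  rw [cosBump_of_one_le_abs, zero_pow two_ne_zero]
  rcases lt_or_gt_of_ne hk.1 with h | h
  · have : (k : ℝ) + 1 ≤ n := by exact_mod_cast h
    exact le_abs.2 (Or.inl (by linarith))
  · have : (n : ℝ) + 2 ≤ k := by exact_mod_cast (by omega : n + 2 ≤ k)
    exact le_abs.2 (Or.inr (by linarith))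

/-- A partition of unity on `ℕ` by squares of finitely supported, slowly varying functions. -/
theorem exists_slow_partition {δ : ℝ} (hδ : 0 < δ) (hδ1 : δ ≤ 1) :
    ∃ (f : ℕ → ℕ → ℝ) (J : ℕ → ℕ), (∀ k j, J k ≤ j → f k j = 0) ∧
      (∀ k j, |f k j - f k (j + 1)| ≤ 12 * δ * (1 / 2) ^ k) ∧
      ∀ j, HasSum (fun k => f k j ^ 2) 1 := by
  have hpos : ∀ j : ℕ, 1 ≤ 1 + δ * j := fun j => by
    have : 0 ≤ δ * j := by positivity
    linarith
  choose J hJ using fun k : ℕ => exists_nat_ge (Real.exp (k + 1) / δ)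
  refine ⟨fun k j => cosBump (Real.log (1 + δ * j) - k), J, fun k j hj => ?_, fun k j => ?_,
    fun j => hasSum_sq_cosBump (Real.log_nonneg (hpos j))⟩
  · refine cosBump_of_one_le_abs (le_abs.2 (Or.inl ?_))
    have h1 : Real.exp (k + 1) ≤ 1 + δ * j := by
      have : Real.exp (k + 1) / δ ≤ j := (hJ k).trans (by exact_mod_cast hj)
      rw [div_le_iff₀ hδ] at this
      linarith
    have := (Real.le_log_iff_exp_le (by linarith [hpos j])).2 h1
    linarith
  · have h0 := hpos j
    have hmono : Real.log (1 + δ * j) ≤ Real.log (1 + δ * (j + 1 : ℕ)) :=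
      Real.log_le_log (by linarith) (by push_cast; nlinarith)
    by_cases h : Real.log (1 + δ * (j + 1 : ℕ)) ≤ k - 1
    · simp only
      rw [cosBump_of_one_le_abs (le_abs.2 (Or.inr (by linarith))),
        cosBump_of_one_le_abs (le_abs.2 (Or.inr (by linarith))), sub_zero, abs_zero]
      positivity
    · push Not at h
      have h1 : Real.exp (k - 1) < 1 + δ * (j + 1 : ℕ) :=
        (Real.lt_log_iff_exp_lt (by linarith [hpos (j + 1)])).1 h
      push_cast at h1
      have h2 : Real.exp (k - 1) ≤ 2 * (1 + δ * j) := by nlinarith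
      have h3 : Real.log (1 + δ * (j + 1 : ℕ)) - Real.log (1 + δ * j) ≤ δ / (1 + δ * j) := by
        rw [← Real.log_div (by linarith [hpos (j + 1)]) (by linarith)]
        refine (Real.log_le_sub_one_of_pos (by have := hpos (j + 1); positivity)).trans ?_
        rw [← sub_nonneg]
        push_cast
        field_simp
        ring_nf
        exact le_rfl
      have h4 : δ / (1 + δ * j) ≤ 6 * δ * (1 / 2) ^ k := by
        rw [div_le_iff₀ (by linarith)]
        have h5 : Real.exp 1 ≤ 3 := (Real.exp_one_lt_d9.trans (by norm_num)).le
        have h6 : (2 : ℝ) ^ k ≤ Real.exp k := by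
          rw [← Real.exp_one_pow]
          exact pow_le_pow_left₀ (by norm_num) (by linarith [Real.exp_one_gt_d9]) k
        have h7 : Real.exp k = Real.exp (k - 1) * Real.exp 1 := by
          rw [← Real.exp_add]; ring_nf
        have h8 : (2 : ℝ) ^ k ≤ 6 * (1 + δ * j) := by
          nlinarith [Real.exp_pos (k - 1)]
        have h9 : (1 / 2 : ℝ) ^ k * 2 ^ k = 1 := by rw [← mul_pow]; norm_num
        have h10 : (0 : ℝ) < (1 / 2) ^ k := by positivity
        nlinarith [mul_le_mul_of_nonneg_left h8 h10.le]
      have h11 := abs_cosBump_sub_le (Real.log (1 + δ * j) - k)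
        (Real.log (1 + δ * (j + 1 : ℕ)) - k)
      rw [sub_sub_sub_cancel_right, abs_sub_comm, abs_sub_comm (Real.log _),
        abs_of_nonneg (sub_nonneg.2 hmono)] at h11
      rw [abs_sub_comm]
      linarith

end CosBump

/-- An increasing sequence of projections. -/
structure IsProjFiltration (Q : ℕ → H →L[ℂ] H) : Prop where
  star_eq (j : ℕ) : star (Q j) = Q j
  mul_of_le {i j : ℕ} (h : i ≤ j) : Q j * Q i = Q i

namespace IsProjFiltration

variable {Q : ℕ → H →L[ℂ] H}

theorem mul_of_ge (hQ : IsProjFiltration Q) {i j : ℕ} (h : i ≤ j) : Q i * Q j = Q i := by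
  have := congrArg star (hQ.mul_of_le h)
  rwa [star_mul, hQ.star_eq, hQ.star_eq] at this

theorem inner_apply (hQ : IsProjFiltration Q) (i : ℕ) (x y : H) : ⟪Q i x, y⟫ = ⟪x, Q i y⟫ := by
  rw [← inner_apply_star, hQ.star_eq]

theorem succ (hQ : IsProjFiltration Q) : IsProjFiltration fun j => Q (j + 1) :=
  ⟨fun _ => hQ.star_eq _, fun h => hQ.mul_of_le (by omega)⟩

theorem star_diff (hQ : IsProjFiltration Q) (j : ℕ) :
    star (Q (j + 1) - Q j) = Q (j + 1) - Q j := by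
  rw [star_sub, hQ.star_eq, hQ.star_eq]

theorem diff_mul_diff (hQ : IsProjFiltration Q) {i j : ℕ} (h : i ≠ j) :
    (Q (i + 1) - Q i) * (Q (j + 1) - Q j) = 0 := by
  rw [sub_mul, mul_sub, mul_sub]
  rcases lt_or_gt_of_ne h with h | h
  · rw [hQ.mul_of_ge (by omega : i + 1 ≤ j + 1), hQ.mul_of_ge (by omega : i + 1 ≤ j),
      hQ.mul_of_ge (by omega : i ≤ j + 1), hQ.mul_of_ge (by omega : i ≤ j)]
    abel
  · rw [hQ.mul_of_le (by omega : j + 1 ≤ i + 1), hQ.mul_of_le (by omega : j ≤ i + 1),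
      hQ.mul_of_le (by omega : j + 1 ≤ i), hQ.mul_of_le (by omega : j ≤ i)]
    abel

theorem inner_diff_apply (hQ : IsProjFiltration Q) {i j : ℕ} (h : i ≠ j) (x y : H) :
    ⟪(Q (i + 1) - Q i) x, (Q (j + 1) - Q j) y⟫ = 0 := by
  rw [← inner_star_apply, hQ.star_diff, ← mul_apply_eq_comp, hQ.diff_mul_diff h.symm]
  simp

theorem norm_apply_le (hQ : IsProjFiltration Q) (n : ℕ) (x : H) : ‖Q n x‖ ≤ ‖x‖ := by
  have h : star (Q n) * Q n = Q n := by rw [hQ.star_eq, hQ.mul_of_le le_rfl]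
  exact ((Q n).le_opNorm x).trans
    (mul_le_of_le_one_left (norm_nonneg x) (norm_le_one_of_star_mul_self h))

theorem sum_norm_sq_diff (hQ : IsProjFiltration Q) (n : ℕ) (x : H) :
    ∑ j ∈ Finset.range n, ‖(Q (j + 1) - Q j) x‖ ^ 2 = ‖(Q n - Q 0) x‖ ^ 2 := by
  rw [← norm_sq_sum_of_pairwise_orthogonal fun i j h => hQ.inner_diff_apply h x x]
  congr 2
  rw [← sum_apply, Finset.sum_range_sub]

theorem sum_norm_sq_diff_le (hQ : IsProjFiltration Q) (n : ℕ) (x : H) :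
    ∑ j ∈ Finset.range n, ‖(Q (j + 1) - Q j) x‖ ^ 2 ≤ ‖x‖ ^ 2 := by
  rw [hQ.sum_norm_sq_diff]
  have h : (Q n - Q 0) * (Q n - Q 0) = Q n - Q 0 := by
    rw [sub_mul, mul_sub, mul_sub, hQ.mul_of_le le_rfl, hQ.mul_of_le le_rfl,
      hQ.mul_of_le (Nat.zero_le n), hQ.mul_of_ge (Nat.zero_le n)]
    abel
  have h' : star (Q n - Q 0) * (Q n - Q 0) = Q n - Q 0 := by
    rw [star_sub, hQ.star_eq, hQ.star_eq, h]
  have := ((Q n - Q 0).le_opNorm x).trans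
    (mul_le_of_le_one_left (norm_nonneg x) (norm_le_one_of_star_mul_self h'))
  gcongr

theorem norm_sum_smul_le (hQ : IsProjFiltration Q) {Y : H →L[ℂ] H}
    (hY : ∀ j, star Y * Q j = Q (j + 1) * star Y * Q j) {c : ℕ → ℝ} {M : ℝ}
    (hc : ∀ j, |c j| ≤ M) (n : ℕ) :
    ‖∑ j ∈ Finset.range n, (c j : ℂ) • (Q j * Y * (Q (j + 1) - Q j))‖ ≤ M * ‖Y‖ := by
  have hM : 0 ≤ M := (abs_nonneg _).trans (hc 0)
  have hzero : ∀ i j, i < j → Q i * Y * (Q (j + 1) - Q j) = 0 := by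
    intro i j h
    have h1 : star (Q i * Y * (Q (j + 1) - Q j)) = 0 := by
      rw [star_mul, star_mul, hQ.star_diff, hQ.star_eq, hY, ← mul_assoc, ← mul_assoc, sub_mul,
        hQ.mul_of_le (by omega : i + 1 ≤ j + 1), hQ.mul_of_le (by omega : i + 1 ≤ j), sub_self]
      simp
    rw [← star_star (Q i * _ * _), h1, star_zero]
  have hort : ∀ x, Pairwise fun i j =>
      ⟪((c i : ℂ) • (Q i * Y * (Q (i + 1) - Q i))) x,
        ((c j : ℂ) • (Q j * Y * (Q (j + 1) - Q j))) x⟫ = 0 := by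
    have key : ∀ x i j, i < j →
        ⟪(Q i * Y * (Q (i + 1) - Q i)) x, (Q j * Y * (Q (j + 1) - Q j)) x⟫ = 0 := by
      intro x i j h
      have h1 : Q i * (Q j * Y * (Q (j + 1) - Q j)) = 0 := by
        rw [mul_assoc, ← mul_assoc, hQ.mul_of_ge h.le, ← mul_assoc, hzero i j h]
      rw [mul_assoc, mul_apply_eq_comp, hQ.inner_apply, ← mul_apply_eq_comp, h1]
      simp
    intro x i j h
    simp only [smul_apply, inner_smul_left, inner_smul_right]
    rcases lt_or_gt_of_ne h with h | h
    · rw [key x i j h, mul_zero, mul_zero]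
    · rw [← inner_conj_symm, key x j i h, map_zero, mul_zero, mul_zero]
  refine ContinuousLinearMap.opNorm_le_bound _ (by positivity) fun x => ?_
  refine abs_le_of_sq_le_sq' ?_ (by positivity) |>.2
  rw [sum_apply, norm_sq_sum_of_pairwise_orthogonal (hort x)]
  calc _ ≤ ∑ j ∈ Finset.range n, (M * ‖Y‖) ^ 2 * ‖(Q (j + 1) - Q j) x‖ ^ 2 := by
        refine Finset.sum_le_sum fun j _ => ?_
        rw [← mul_pow]
        refine pow_le_pow_left₀ (norm_nonneg _) ?_ 2
        rw [smul_apply, norm_smul, Complex.norm_real, Real.norm_eq_abs, mul_assoc M]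
        refine mul_le_mul (hc j) ?_ (norm_nonneg _) hM
        exact (hQ.norm_apply_le j _).trans (Y.le_opNorm _)
    _ ≤ (M * ‖Y‖ * ‖x‖) ^ 2 := by
        rw [← Finset.mul_sum, mul_pow _ ‖x‖]
        exact mul_le_mul_of_nonneg_left (hQ.sum_norm_sq_diff_le n x) (by positivity)

/-- The block diagonal operator with weights `f`. -/
noncomputable def blockDiag (Q : ℕ → H →L[ℂ] H) (f : ℕ → ℝ) (n : ℕ) : H →L[ℂ] H :=
  ∑ j ∈ Finset.range n, (f j : ℂ) • (Q (j + 1) - Q j)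

omit [CompleteSpace H] in
theorem blockDiag_eq (h0 : Q 0 = 0) {f : ℕ → ℝ} (n : ℕ) (hf : f n = 0) :
    blockDiag Q f n = ∑ j ∈ Finset.range n, ((f j - f (j + 1) : ℝ) : ℂ) • Q (j + 1) := by
  have : ∀ n, blockDiag Q f n =
      (f n : ℂ) • Q n + ∑ j ∈ Finset.range n, ((f j - f (j + 1) : ℝ) : ℂ) • Q (j + 1) := by
    intro n
    induction n with
    | zero => simp [blockDiag, h0]
    | succ n ih =>
      rw [blockDiag, Finset.sum_range_succ, ← blockDiag, ih, Finset.sum_range_succ]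
      push_cast
      module
  rw [this, hf]
  simp

theorem norm_blockDiag_commutator_le (hQ : IsProjFiltration Q) (h0 : Q 0 = 0) {Y : H →L[ℂ] H}
    (hY : ∀ j, Y * Q j = Q (j + 1) * Y * Q j)
    (hY' : ∀ j, star Y * Q j = Q (j + 1) * star Y * Q j) {f : ℕ → ℝ} {M : ℝ}
    (hM : ∀ j, |f j - f (j + 1)| ≤ M) (n : ℕ) (hf : f n = 0) :
    ‖blockDiag Q f n * Y - Y * blockDiag Q f n‖ ≤ 2 * (M * ‖Y‖) := by
  have hY2 : ∀ j, star (star Y) * Q j = Q (j + 1) * star (star Y) * Q j := by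
    simpa only [star_star] using hY
  have h1 := hQ.succ.norm_sum_smul_le (fun j => hY' (j + 1)) hM n
  have h2 := hQ.succ.norm_sum_smul_le (fun j => hY2 (j + 1)) hM n
  rw [← norm_star, norm_star Y] at h2
  have h3 : ∀ j, Q j * Y = Q j * Y * Q (j + 1) := fun j => by
    have := congrArg star (hY' j)
    simpa only [star_mul, star_star, hQ.star_eq, mul_assoc] using this
  have : blockDiag Q f n * Y - Y * blockDiag Q f n =
      ∑ j ∈ Finset.range n, ((f j - f (j + 1) : ℝ) : ℂ) •
        (Q (j + 1) * Y * (Q (j + 1 + 1) - Q (j + 1))) -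
      star (∑ j ∈ Finset.range n, ((f j - f (j + 1) : ℝ) : ℂ) •
        (Q (j + 1) * star Y * (Q (j + 1 + 1) - Q (j + 1)))) := by
    rw [blockDiag_eq h0 n hf, Finset.sum_mul, Finset.mul_sum, star_sum, ← Finset.sum_sub_distrib,
      ← Finset.sum_sub_distrib]
    refine Finset.sum_congr rfl fun j _ => ?_
    rw [star_smul, star_mul, star_mul, star_star, hQ.star_eq, hQ.star_diff (j + 1),
      Complex.star_def, Complex.conj_ofReal, smul_mul_assoc, mul_smul_comm, ← smul_sub, ← smul_sub]
    congr 1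
    rw [mul_sub, ← h3, sub_mul, ← mul_assoc (Q (j + 1 + 1)), ← hY, ← mul_assoc]
    abel
  rw [this]
  exact (norm_sub_le _ _).trans (by linarith)

theorem star_blockDiag (hQ : IsProjFiltration Q) (f : ℕ → ℝ) (n : ℕ) :
    star (blockDiag Q f n) = blockDiag Q f n := by
  rw [blockDiag, star_sum]
  refine Finset.sum_congr rfl fun j _ => ?_
  rw [star_smul, hQ.star_diff, Complex.star_def, Complex.conj_ofReal]

theorem hasSum_norm_sq_blockDiag (hQ : IsProjFiltration Q) (h0 : Q 0 = 0) {p : H →L[ℂ] H}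
    (hp : ∀ x, Tendsto (fun n => Q n x) atTop (nhds (p x))) {f : ℕ → ℕ → ℝ} {J : ℕ → ℕ}
    (hJ : ∀ k j, J k ≤ j → f k j = 0) (hf : ∀ j, HasSum (fun k => f k j ^ 2) 1) (x : H) :
    HasSum (fun k => ‖blockDiag Q (f k) (J k) x‖ ^ 2) (‖p x‖ ^ 2) := by
  have h1 : HasSum (fun j => ‖(Q (j + 1) - Q j) x‖ ^ 2) (‖p x‖ ^ 2) := by
    rw [hasSum_iff_tendsto_nat_of_nonneg fun _ => by positivity]
    refine ((hp x).norm.pow 2).congr fun n => ?_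
    rw [hQ.sum_norm_sq_diff, h0, sub_zero]
  have h2 : ∀ k, ‖blockDiag Q (f k) (J k) x‖ ^ 2 =
      ∑ j ∈ Finset.range (J k), f k j ^ 2 * ‖(Q (j + 1) - Q j) x‖ ^ 2 := by
    intro k
    rw [blockDiag, sum_apply, norm_sq_sum_of_pairwise_orthogonal]
    · refine Finset.sum_congr rfl fun j _ => ?_
      rw [smul_apply, norm_smul, Complex.norm_real, mul_pow, Real.norm_eq_abs, sq_abs]
    · intro i j h
      simp only [smul_apply, inner_smul_left, inner_smul_right, hQ.inner_diff_apply h, mul_zero]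
  have h3 : ∀ k, HasSum (fun j => f k j ^ 2 * ‖(Q (j + 1) - Q j) x‖ ^ 2)
      (‖blockDiag Q (f k) (J k) x‖ ^ 2) := by
    intro k
    rw [h2]
    refine hasSum_sum_of_ne_finset_zero fun j hj => ?_
    rw [hJ k j (by simpa using hj)]
    simp
  have h4 : ∀ j, HasSum (fun k => f k j ^ 2 * ‖(Q (j + 1) - Q j) x‖ ^ 2)
      (‖(Q (j + 1) - Q j) x‖ ^ 2) := fun j => by
    simpa using (hf j).mul_right (‖(Q (j + 1) - Q j) x‖ ^ 2)
  have h5 : Summable fun a : ℕ × ℕ => f a.2 a.1 ^ 2 * ‖(Q (a.1 + 1) - Q a.1) x‖ ^ 2 := by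
    rw [summable_prod_of_nonneg fun _ => by positivity]
    refine ⟨fun j => (h4 j).summable, ?_⟩
    simpa only [(h4 _).tsum_eq] using h1.summable
  have h6 := h5.hasSum.prod_fiberwise h4
  have h7 := ((Equiv.prodComm ℕ ℕ).hasSum_iff.2 h5.hasSum).prod_fiberwise h3
  rwa [h1.unique h6]

end IsProjFiltration

/-- An increasing sequence of finite-dimensional subspaces exhausting `M`, each mapped into the
next one by `Y` and `star Y`. -/
noncomputable def krylov (Y : H →L[ℂ] H) (M : Submodule ℂ H) [M.HasOrthogonalProjection]
    (e : ℕ → H) : ℕ → Submodule ℂ H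
  | 0 => ⊥
  | n + 1 => krylov Y M e n ⊔ (krylov Y M e n).map (Y : H →ₗ[ℂ] H) ⊔
      (krylov Y M e n).map (star Y : H →L[ℂ] H).toLinearMap ⊔ (ℂ ∙ M.starProjection (e n))

section Krylov

variable (Y : H →L[ℂ] H) (M : Submodule ℂ H) [M.HasOrthogonalProjection] (e : ℕ → H)

instance finiteDimensional_krylov (n : ℕ) : FiniteDimensional ℂ (krylov Y M e n) := by
  induction n with
  | zero => rw [krylov]; infer_instance
  | succ n ih => rw [krylov]; infer_instance

theorem krylov_monotone : Monotone (krylov Y M e) :=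
  monotone_nat_of_le_succ fun n => by
    rw [krylov]
    exact le_sup_left.trans (le_sup_left.trans le_sup_left)

theorem apply_mem_krylov {n : ℕ} {x : H} (hx : x ∈ krylov Y M e n) :
    Y x ∈ krylov Y M e (n + 1) := by
  rw [krylov]
  exact Submodule.mem_sup_left (Submodule.mem_sup_left (Submodule.mem_sup_right ⟨x, hx, rfl⟩))

theorem star_apply_mem_krylov {n : ℕ} {x : H} (hx : x ∈ krylov Y M e n) :
    star Y x ∈ krylov Y M e (n + 1) := by
  rw [krylov]
  exact Submodule.mem_sup_left (Submodule.mem_sup_right ⟨x, hx, rfl⟩)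

theorem starProjection_mem_krylov (n : ℕ) : M.starProjection (e n) ∈ krylov Y M e (n + 1) := by
  rw [krylov]
  exact Submodule.mem_sup_right (Submodule.mem_span_singleton_self _)

variable {Y M}

theorem krylov_le (h : ∀ x ∈ M, Y x ∈ M) (h' : ∀ x ∈ M, star Y x ∈ M) (n : ℕ) :
    krylov Y M e n ≤ M := by
  induction n with
  | zero => rw [krylov]; exact bot_le
  | succ n ih =>
    rw [krylov]
    refine sup_le (sup_le (sup_le ih ?_) ?_) ?_
    · exact Submodule.map_le_iff_le_comap.2 fun x hx => h x (ih hx)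
    · exact Submodule.map_le_iff_le_comap.2 fun x hx => h' x (ih hx)
    · rw [Submodule.span_singleton_le_iff_mem]
      exact M.starProjection_apply_mem _

theorem closure_iSup_krylov (hMc : IsClosed (M : Set H)) (h : ∀ x ∈ M, Y x ∈ M)
    (h' : ∀ x ∈ M, star Y x ∈ M)
    (he : DenseRange e) : (⨆ n, krylov Y M e n).topologicalClosure = M := by
  refine le_antisymm
    (Submodule.topologicalClosure_minimal _ (iSup_le (krylov_le e h h')) hMc) fun x hx => ?_
  have h1 : x ∈ closure (M.starProjection '' Set.range e) :=
    image_closure_subset_closure_image M.starProjection.continuous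
      ⟨x, he x, Submodule.starProjection_eq_self_iff.2 hx⟩
  refine closure_mono ?_ h1
  rintro _ ⟨_, ⟨n, rfl⟩, rfl⟩
  exact Submodule.mem_iSup_of_mem (n + 1) (starProjection_mem_krylov Y M e n)

theorem isProjFiltration_krylov : IsProjFiltration fun n => (krylov Y M e n).starProjection where
  star_eq _ := star_starProjection _
  mul_of_le {i j} h := by
    ext x
    exact Submodule.starProjection_eq_self_iff.2
      (krylov_monotone Y M e h (Submodule.starProjection_apply_mem _ x))

end Krylov

/-- A square partition of unity of a reducing subspace by finite-rank operators that almost commute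
with `Y`. -/
theorem exists_quasicentral_partition [TopologicalSpace.SeparableSpace H] (Y : H →L[ℂ] H)
    (M : Submodule ℂ H) [M.HasOrthogonalProjection] (hMc : IsClosed (M : Set H))
    (h : ∀ x ∈ M, Y x ∈ M) (h' : ∀ x ∈ M, star Y x ∈ M) {δ : ℝ} (hδ : 0 < δ) :
    ∃ E : ℕ → H →L[ℂ] H, (∀ k, star (E k) = E k) ∧
      (∀ k, ∃ G : Submodule ℂ H, FiniteDimensional ℂ G ∧ ∀ x, E k x ∈ G) ∧
      (∀ k, E k * M.starProjection = E k) ∧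
      (∀ k, ‖E k * Y - Y * E k‖ ≤ δ * (1 / 2) ^ k) ∧
      ∀ x, HasSum (fun k => ‖E k x‖ ^ 2) (‖M.starProjection x‖ ^ 2) := by
  set e := TopologicalSpace.denseSeq H
  set Q : ℕ → H →L[ℂ] H := fun n => (krylov Y M e n).starProjection with hQdef
  have hQ : IsProjFiltration Q := isProjFiltration_krylov e
  have h0 : Q 0 = 0 := by
    ext x
    simp [hQdef, krylov]
  have hQM : ∀ n, Q n * M.starProjection = Q n := by
    intro n
    have h1 : M.starProjection * Q n = Q n := by
      ext x
      exact Submodule.starProjection_eq_self_iff.2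
        (krylov_le e h h' n (Submodule.starProjection_apply_mem _ x))
    have := congrArg star h1
    rwa [star_mul, hQ.star_eq, star_starProjection] at this
  have hY : ∀ j, Y * Q j = Q (j + 1) * Y * Q j := by
    intro j
    ext x
    exact (Submodule.starProjection_eq_self_iff.2
      (apply_mem_krylov Y M e (Submodule.starProjection_apply_mem _ x))).symm
  have hY' : ∀ j, star Y * Q j = Q (j + 1) * star Y * Q j := by
    intro j
    ext x
    exact (Submodule.starProjection_eq_self_iff.2
      (star_apply_mem_krylov Y M e (Submodule.starProjection_apply_mem _ x))).symm
  have hp : ∀ x, Tendsto (fun n => Q n x) atTop (nhds (M.starProjection x)) := by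
    intro x
    have := Submodule.starProjection_tendsto_closure_iSup _ (krylov_monotone Y M e) x
    simpa only [closure_iSup_krylov e hMc h h' (TopologicalSpace.denseRange_denseSeq H)] using this
  set δ' := min 1 (δ / (24 * ‖Y‖ + 1)) with hδ'
  have hden : 0 < 24 * ‖Y‖ + 1 := by positivity
  obtain ⟨f, J, hJ, hf, hs⟩ := exists_slow_partition (δ := δ') (by positivity) (min_le_left _ _)
  refine ⟨fun k => IsProjFiltration.blockDiag Q (f k) (J k), fun k => hQ.star_blockDiag _ _,
    fun k => ⟨krylov Y M e (J k), inferInstance, fun x => ?_⟩, fun k => ?_, fun k => ?_,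
    hQ.hasSum_norm_sq_blockDiag h0 hp hJ hs⟩
  · simp only [IsProjFiltration.blockDiag]
    rw [sum_apply]
    refine Submodule.sum_mem _ fun j hj => Submodule.smul_mem _ _ (Submodule.sub_mem _ ?_ ?_)
    · exact krylov_monotone Y M e (by simpa using hj) (Submodule.starProjection_apply_mem _ x)
    · exact krylov_monotone Y M e (by have := Finset.mem_range.1 hj; omega)
        (Submodule.starProjection_apply_mem _ x)
  · simp only [IsProjFiltration.blockDiag]
    rw [Finset.sum_mul]
    refine Finset.sum_congr rfl fun j _ => ?_
    rw [smul_mul_assoc, sub_mul, hQM, hQM]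
  · refine (hQ.norm_blockDiag_commutator_le h0 hY hY' (hf k) (J k) (hJ k _ le_rfl)).trans ?_
    have h1 : δ' * (24 * ‖Y‖ + 1) ≤ δ := (le_div_iff₀ hden).1 (min_le_right _ _)
    have h2 : 0 < δ' := by positivity
    have h3 : 24 * δ' * ‖Y‖ ≤ δ := by linarith
    have h4 : (0 : ℝ) < (1 / 2) ^ k := by positivity
    nlinarith

section FiniteDimensional

omit [CompleteSpace H] in
theorem starProjection_apply_eq_sum (K : Submodule ℂ H) [FiniteDimensional ℂ K] (x : H) :
    K.starProjection x =
      ∑ i, ⟪(stdOrthonormalBasis ℂ K i : H), x⟫ • (stdOrthonormalBasis ℂ K i : H) := by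
  rw [(stdOrthonormalBasis ℂ K).starProjection_eq_sum_rankOne]
  simp

omit [CompleteSpace H] in
/-- An isometry moving the finite-dimensional subspace `F` into the orthogonal complement of
another one. -/
theorem exists_isometry_into_orthogonal (hinf : ¬ FiniteDimensional ℂ H) (F N : Submodule ℂ H)
    [FiniteDimensional ℂ F] [FiniteDimensional ℂ N] :
    ∃ w : H →L[ℂ] H, (∀ x, w x ∈ Nᗮ) ∧ (∀ x, ‖w x‖ = ‖F.starProjection x‖) ∧
      ∃ G : Submodule ℂ H, FiniteDimensional ℂ G ∧ ∀ x, w x ∈ G := by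
  have hN : ¬ FiniteDimensional ℂ Nᗮ := by
    intro h
    have h1 : FiniteDimensional ℂ (N ⊔ Nᗮ : Submodule ℂ H) := inferInstance
    rw [Submodule.sup_orthogonal_of_hasOrthogonalProjection] at h1
    exact hinf (Module.finite_def.2 (Module.Finite.iff_fg.1 h1))
  have hr : ((Module.finrank ℂ F : ℕ) : Cardinal) ≤ Module.rank ℂ Nᗮ := by
    refine Cardinal.natCast_le_aleph0.trans ?_
    by_contra hlt
    exact hN (Module.rank_lt_aleph0_iff.1 (not_le.1 hlt))
  obtain ⟨f, hf⟩ := Module.le_rank_iff_exists_linearMap.1 hr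
  set L := LinearMap.range (Submodule.subtype Nᗮ ∘ₗ f) with hL
  have hinj : Function.Injective (Submodule.subtype Nᗮ ∘ₗ f) := fun a b hab =>
    hf (Subtype.ext hab)
  have hdim : Module.finrank ℂ F = Module.finrank ℂ L := by
    rw [hL, LinearMap.finrank_range_of_inj hinj]
    simp
  have hLN : ∀ y : L, (y : H) ∈ Nᗮ := by
    rintro ⟨_, z, rfl⟩
    exact (f z).2
  let e : F ≃ₗᵢ[ℂ] L := (stdOrthonormalBasis ℂ F).equiv (stdOrthonormalBasis ℂ L) (finCongr hdim)
  refine ⟨L.subtypeL ∘L (e.toContinuousLinearEquiv : F →L[ℂ] L) ∘L F.orthogonalProjectionOnto,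
    fun x => hLN _, fun x => ?_, L, inferInstance, fun x => Submodule.coe_mem _⟩
  exact (e.norm_map _)

theorem tendsto_norm_starProjection_mul {ι : Type*} {l : Filter ι} {u : ι → H →L[ℂ] H}
    {p E : H →L[ℂ] H} (hp : star p = p)
    (hu : ∀ x y, Tendsto (fun n => ⟪y, u n (p x)⟫) l (nhds 0)) (hE : star E = E)
    {G : Submodule ℂ H} [FiniteDimensional ℂ G] (hG : ∀ x, E x ∈ G) (hEp : E * p = E)
    (F : Submodule ℂ H) [FiniteDimensional ℂ F] :
    Tendsto (fun n => ‖F.starProjection * u n * E‖) l (nhds 0) := by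
  have hpE : p * E = E := by
    have := congrArg star hEp
    rwa [star_mul, hE, hp] at this
  have h1 : ∀ x, Tendsto (fun n => (F.starProjection * u n * E) x) l (nhds 0) := by
    intro x
    have h2 : ∀ n, (F.starProjection * u n * E) x =
        ∑ i, ⟪(stdOrthonormalBasis ℂ F i : H), u n (p (E x))⟫ •
          (stdOrthonormalBasis ℂ F i : H) := by
      intro n
      rw [← mul_apply_eq_comp p, hpE, ← starProjection_apply_eq_sum]
      rfl
    simp only [h2]
    have h3 := tendsto_finsetSum Finset.univ fun i _ =>
      (hu (E x) (stdOrthonormalBasis ℂ F i)).smul_const (stdOrthonormalBasis ℂ F i : H)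
    simpa using h3
  have hEG : E * G.starProjection = E := by
    have h3 : G.starProjection * E = E := by
      ext x
      exact Submodule.starProjection_eq_self_iff.2 (hG x)
    have := congrArg star h3
    rwa [star_mul, hE, star_starProjection] at this
  have h4 : Tendsto (fun n => ∑ i, ‖(F.starProjection * u n * E) (stdOrthonormalBasis ℂ G i)‖) l
      (nhds 0) := by
    have h3 := tendsto_finsetSum Finset.univ fun i _ => (h1 (stdOrthonormalBasis ℂ G i)).norm
    simpa using h3
  refine squeeze_zero (fun _ => norm_nonneg _) (fun n => ?_) h4
  refine ContinuousLinearMap.opNorm_le_bound _ (by positivity) fun x => ?_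
  have h5 : (F.starProjection * u n * E) x = (F.starProjection * u n * E) (G.starProjection x) := by
    rw [← mul_apply_eq_comp _ G.starProjection, mul_assoc _ E, hEG]
  rw [h5, starProjection_apply_eq_sum, map_sum, Finset.sum_mul]
  refine (norm_sum_le _ _).trans (Finset.sum_le_sum fun i _ => ?_)
  rw [map_smul, norm_smul, mul_comm]
  refine mul_le_mul_of_nonneg_left ?_ (norm_nonneg _)
  refine (norm_inner_le_norm _ _).trans ?_
  rw [← Submodule.coe_norm, (stdOrthonormalBasis ℂ G).norm_eq_one, one_mul]

end FiniteDimensional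

theorem norm_sub_le_of_near {X Y u E S : H →L[ℂ] H} (hu : u ∈ unitary (H →L[ℂ] H)) {t : ℝ}
    (hS : ‖S - u * E‖ ≤ t) :
    ‖X * S - S * Y‖ ≤ t * (‖X‖ + ‖Y‖) + ‖X * u - u * Y‖ * ‖E‖ + ‖E * Y - Y * E‖ := by
  have : X * S - S * Y = X * (S - u * E) - (S - u * E) * Y + (X * u - u * Y) * E -
      u * (E * Y - Y * E) := by noncomm_ring
  rw [this]
  have h1 : ‖X * (S - u * E)‖ ≤ ‖X‖ * t :=
    (norm_mul_le _ _).trans (mul_le_mul_of_nonneg_left hS (norm_nonneg _))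
  have h2 : ‖(S - u * E) * Y‖ ≤ t * ‖Y‖ :=
    (norm_mul_le _ _).trans (mul_le_mul_of_nonneg_right hS (norm_nonneg _))
  have h3 := norm_mul_le (X * u - u * Y) E
  have h4 : ‖u * (E * Y - Y * E)‖ = ‖E * Y - Y * E‖ := CStarRing.norm_mem_unitary_mul _ hu
  have h5 := norm_sub_le (X * (S - u * E) - (S - u * E) * Y + (X * u - u * Y) * E)
    (u * (E * Y - Y * E))
  have h6 := norm_add_le (X * (S - u * E) - (S - u * E) * Y) ((X * u - u * Y) * E)
  have h7 := norm_sub_le (X * (S - u * E)) ((S - u * E) * Y)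
  linarith

/-- Asymptotically intertwining unitaries `u n` that vanish weakly on the range of `p`. -/
structure IsWeaklyNullIntertwiner {ι : Type*} (l : Filter ι) (u : ι → H →L[ℂ] H)
    (X Y p : H →L[ℂ] H) : Prop where
  mem_unitary (n : ι) : u n ∈ unitary (H →L[ℂ] H)
  star_proj : star p = p
  weak (x y : H) : Tendsto (fun n => ⟪y, u n (p x)⟫) l (nhds 0)
  intertwine : Tendsto (fun n => ‖X * u n - u n * Y‖) l (nhds 0)
  star_intertwine : Tendsto (fun n => ‖star X * u n - u n * star Y‖) l (nhds 0)

namespace IsWeaklyNullIntertwiner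

variable {ι : Type*} {l : Filter ι} {u : ι → H →L[ℂ] H} {X Y p : H →L[ℂ] H}

theorem exists_block [l.NeBot] (h : IsWeaklyNullIntertwiner l u X Y p)
    (hinf : ¬ FiniteDimensional ℂ H) {E : H →L[ℂ] H} (hE : star E = E) {G : Submodule ℂ H}
    [FiniteDimensional ℂ G] (hG : ∀ x, E x ∈ G) (hEp : E * p = E) (F : Submodule ℂ H)
    [FiniteDimensional ℂ F] {η : ℝ} (hη : 0 < η) :
    ∃ S : H →L[ℂ] H, (∀ x, ‖S x‖ = ‖E x‖) ∧ (∀ x, S x ∈ Fᗮ) ∧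
      (∃ G' : Submodule ℂ H, FiniteDimensional ℂ G' ∧ ∀ x, S x ∈ G') ∧
      ‖X * S - S * Y‖ ≤ η + ‖E * Y - Y * E‖ ∧
      ‖star X * S - S * star Y‖ ≤ η + ‖E * Y - Y * E‖ := by
  have ht := tendsto_norm_starProjection_mul h.star_proj h.weak hE hG hEp F
  have h1 : Tendsto (fun n => 2 * ‖F.starProjection * u n * E‖ * (‖X‖ + ‖Y‖) +
      ‖X * u n - u n * Y‖ * ‖E‖) l (nhds 0) := by
    simpa using ((ht.const_mul 2).mul_const (‖X‖ + ‖Y‖)).add (h.intertwine.mul_const ‖E‖)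
  have h2 : Tendsto (fun n => 2 * ‖F.starProjection * u n * E‖ * (‖X‖ + ‖Y‖) +
      ‖star X * u n - u n * star Y‖ * ‖E‖) l (nhds 0) := by
    simpa using ((ht.const_mul 2).mul_const (‖X‖ + ‖Y‖)).add (h.star_intertwine.mul_const ‖E‖)
  obtain ⟨n, hn1, hn2⟩ := ((h1.eventually_lt_const hη).and (h2.eventually_lt_const hη)).exists
  obtain ⟨w, hwN, hw, G₂, hG₂, hwG⟩ := exists_isometry_into_orthogonal hinf F
    (F ⊔ G.map (u n : H →ₗ[ℂ] H))
  set P := F.starProjection with hP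
  set S : H →L[ℂ] H := (1 - P + w) * (u n * E) with hS
  have hSx : ∀ x, S x = (u n (E x) - P (u n (E x))) + w (u n (E x)) := fun x => by
    simp [hS]
  have hmem : ∀ x, u n (E x) - P (u n (E x)) ∈ F ⊔ G.map (u n : H →ₗ[ℂ] H) := fun x =>
    Submodule.sub_mem _ (Submodule.mem_sup_right ⟨E x, hG x, rfl⟩)
      (Submodule.mem_sup_left (Submodule.starProjection_apply_mem _ _))
  have hnear : ‖S - u n * E‖ ≤ 2 * ‖P * u n * E‖ := by
    refine ContinuousLinearMap.opNorm_le_bound _ (by positivity) fun x => ?_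
    have h3 : (S - u n * E) x = w (u n (E x)) - P (u n (E x)) := by
      rw [sub_apply, hSx, mul_apply_eq_comp]
      abel
    have h4 : ‖P (u n (E x))‖ ≤ ‖P * u n * E‖ * ‖x‖ := (P * u n * E).le_opNorm x
    rw [h3]
    have h5 := norm_sub_le (w (u n (E x))) (P (u n (E x)))
    rw [hw] at h5
    linarith
  refine ⟨S, fun x => ?_, fun x => ?_, ⟨F ⊔ G.map (u n : H →ₗ[ℂ] H) ⊔ G₂, inferInstance, fun x => ?_⟩,
    ?_, ?_⟩
  · have h3 : ⟪u n (E x) - P (u n (E x)), w (u n (E x))⟫ = 0 := hwN _ _ (hmem x)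
    have h4 := norm_add_sq (𝕜 := ℂ) (u n (E x) - P (u n (E x))) (w (u n (E x)))
    rw [h3, ← hSx, hw] at h4
    have h5 := Submodule.norm_sq_eq_add_norm_sq_starProjection (u n (E x)) F
    rw [Submodule.starProjection_orthogonal_val] at h5
    rw [← unitary_norm_apply (h.mem_unitary n).1 (E x), ← sq_eq_sq₀ (norm_nonneg _) (norm_nonneg _),
      h4, h5]
    simp only [map_zero, mul_zero, add_zero]
    ring
  · rw [hSx]
    refine Submodule.add_mem _ (Submodule.sub_starProjection_mem_orthogonal _) ?_
    exact Submodule.orthogonal_le le_sup_left (hwN _)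
  · rw [hSx]
    exact Submodule.add_mem _ (Submodule.mem_sup_left (hmem x)) (Submodule.mem_sup_right (hwG _))
  · have := norm_sub_le_of_near (X := X) (Y := Y) (h.mem_unitary n) hnear
    linarith
  · have := norm_sub_le_of_near (X := star X) (Y := star Y) (h.mem_unitary n) hnear
    have h3 : ‖E * star Y - star Y * E‖ = ‖E * Y - Y * E‖ := by
      rw [← norm_star, star_sub, star_mul, star_mul, star_star, hE, norm_sub_rev]
    rw [h3, norm_star, norm_star] at this
    linarith

theorem exists_block_seq [l.NeBot] (h : IsWeaklyNullIntertwiner l u X Y p)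
    (hinf : ¬ FiniteDimensional ℂ H) {E : ℕ → H →L[ℂ] H} (hE : ∀ i, star (E i) = E i)
    (hG : ∀ i, ∃ G : Submodule ℂ H, FiniteDimensional ℂ G ∧ ∀ x, E i x ∈ G)
    (hEp : ∀ i, E i * p = E i) {η : ℕ → ℝ} (hη : ∀ i, 0 < η i) :
    ∃ S : ℕ → H →L[ℂ] H, (∀ i x, ‖S i x‖ = ‖E i x‖) ∧
      (∀ i j, i ≠ j → ∀ x y, ⟪S i x, S j y⟫ = 0) ∧
      (∀ i, ‖X * S i - S i * Y‖ ≤ η i + ‖E i * Y - Y * E i‖) ∧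
      ∀ i, ‖star X * S i - S i * star Y‖ ≤ η i + ‖E i * Y - Y * E i‖ := by
  have key : ∀ (i : ℕ) (F : {F : Submodule ℂ H // FiniteDimensional ℂ F}),
      ∃ (S : H →L[ℂ] H) (F' : {F : Submodule ℂ H // FiniteDimensional ℂ F}),
        (∀ x, ‖S x‖ = ‖E i x‖) ∧ (∀ x, S x ∈ F.1ᗮ) ∧ F.1 ≤ F'.1 ∧ (∀ x, S x ∈ F'.1) ∧
        ‖X * S - S * Y‖ ≤ η i + ‖E i * Y - Y * E i‖ ∧
        ‖star X * S - S * star Y‖ ≤ η i + ‖E i * Y - Y * E i‖ := by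
    rintro i ⟨F, hF⟩
    obtain ⟨G, hGf, hG⟩ := hG i
    obtain ⟨S, h1, h2, ⟨G', hG', h3⟩, h4, h5⟩ := h.exists_block hinf (hE i) hG (hEp i) F (hη i)
    exact ⟨S, ⟨F ⊔ G', inferInstance⟩, h1, h2, le_sup_left,
      fun x => Submodule.mem_sup_right (h3 x), h4, h5⟩
  choose S F' h1 h2 h3 h4 h5 h6 using key
  let F : ℕ → {F : Submodule ℂ H // FiniteDimensional ℂ F} :=
    fun n => Nat.rec ⟨⊥, inferInstance⟩ F' n
  have hmono : Monotone fun n => (F n).1 := monotone_nat_of_le_succ fun n => h3 n (F n)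
  have hort : ∀ i j, i < j → ∀ x y, ⟪S i (F i) x, S j (F j) y⟫ = 0 := fun i j hij x y =>
    h2 j (F j) y _ (hmono (Nat.succ_le_of_lt hij) (h4 i (F i) x))
  refine ⟨fun i => S i (F i), fun i => h1 i _, fun i j hij x y => ?_, fun i => h5 i _,
    fun i => h6 i _⟩
  rcases lt_or_gt_of_ne hij with hij | hij
  · exact hort i j hij x y
  · rw [← inner_conj_symm, hort j i hij y x, map_zero]

end IsWeaklyNullIntertwiner

theorem exists_strong_sum {S : ℕ → H →L[ℂ] H} (hS : ∀ i j, i ≠ j → ∀ x y, ⟪S i x, S j y⟫ = 0)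
    {p : H →L[ℂ] H} (hp : ∀ x, HasSum (fun k => ‖S k x‖ ^ 2) (‖p x‖ ^ 2)) :
    ∃ W : H →L[ℂ] H, (∀ x, HasSum (fun k => S k x) (W x)) ∧ ∀ x, ‖W x‖ ^ 2 = ‖p x‖ ^ 2 := by
  have hort : ∀ x, Pairwise fun i j => ⟪S i x, S j x⟫ = 0 := fun x i j hij => hS i j hij x x
  have hs : ∀ x, Summable fun k => S k x := fun x =>
    summable_of_pairwise_orthogonal (hort x) (hp x).summable
  obtain ⟨W, hW⟩ := exists_strong_limit (fun n => ∑ k ∈ Finset.range n, S k) fun x =>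
    ⟨_, (hs x).hasSum.tendsto_sum_nat.congr fun n => (sum_apply ..).symm⟩
  have hsum : ∀ x, HasSum (fun k => S k x) (W x) := by
    intro x
    have : W x = ∑' k, S k x := tendsto_nhds_unique (hW x)
      ((hs x).hasSum.tendsto_sum_nat.congr fun n => (sum_apply ..).symm)
    rw [this]
    exact (hs x).hasSum
  exact ⟨W, hsum, fun x =>
    (hasSum_norm_sq_of_pairwise_orthogonal (hort x) (hsum x)).unique (hp x)⟩

omit [CompleteSpace H] in
theorem norm_intertwine_strong_sum_le {S : ℕ → H →L[ℂ] H} {W X Y : H →L[ℂ] H}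
    (hW : ∀ x, HasSum (fun k => S k x) (W x)) {c : ℕ → ℝ} {s : ℝ} (hc : HasSum c s)
    (h : ∀ k, ‖X * S k - S k * Y‖ ≤ c k) : ‖X * W - W * Y‖ ≤ s := by
  refine ContinuousLinearMap.opNorm_le_bound _
    (hc.nonneg fun k => (norm_nonneg _).trans (h k)) fun x => ?_
  have h1 : HasSum (fun k => (X * S k - S k * Y) x) ((X * W - W * Y) x) :=
    ((hW x).mapL X).sub (hW (Y x))
  refine h1.norm_le_of_bounded (hc.mul_right ‖x‖) fun k => ?_
  exact ((X * S k - S k * Y).le_opNorm x).trans (by gcongr; exact h k)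

omit [CompleteSpace H] in
theorem inner_eq_zero_of_hasSum {v w : ℕ → H} {a b : H} (ha : HasSum v a) (hb : HasSum w b)
    (h : ∀ i j, ⟪v i, w j⟫ = 0) : ⟪a, b⟫ = 0 := by
  have h1 : ∀ i, ⟪v i, b⟫ = 0 := fun i => by
    have h2 := hb.mapL (innerSL ℂ (v i))
    simp only [innerSL_apply_apply, h] at h2
    exact h2.unique hasSum_zero
  have h2 := ha.mapL (innerSL ℂ b)
  simp only [innerSL_apply_apply] at h2
  have h3 : ∀ i, ⟪b, v i⟫ = 0 := fun i => by rw [← inner_conj_symm, h1, map_zero]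
  simp only [h3] at h2
  rw [← inner_conj_symm, h2.unique hasSum_zero, map_zero]

namespace IsWeaklyNullIntertwiner

variable {ι : Type*} {l : Filter ι} {u : ι → H →L[ℂ] H} {X Y : H →L[ℂ] H}

theorem exists_isOrthoIsometrySeq [l.NeBot] [TopologicalSpace.SeparableSpace H]
    (hinf : ¬ FiniteDimensional ℂ H) {M : Submodule ℂ H} [M.HasOrthogonalProjection]
    (h : IsWeaklyNullIntertwiner l u X Y M.starProjection) (hMc : IsClosed (M : Set H))
    (hM : ∀ x ∈ M, Y x ∈ M) (hM' : ∀ x ∈ M, star Y x ∈ M) :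
    ∃ (W : ℕ → H →L[ℂ] H) (ε : ℕ → ℝ), IsOrthoIsometrySeq W M.starProjection ∧ Summable ε ∧
      (∀ i, ‖X * W i - W i * Y‖ ≤ ε i) ∧ ∀ i, ‖star X * W i - W i * star Y‖ ≤ ε i := by
  choose E hE hG hEp hc hs using fun n : ℕ => exists_quasicentral_partition Y M hMc hM hM'
    (δ := (1 / 2) ^ n) (by positivity)
  obtain ⟨S, hS, hort, h1, h2⟩ := h.exists_block_seq hinf
    (E := fun i => E i.unpair.1 i.unpair.2) (fun i => hE _ _) (fun i => hG _ _)
    (fun i => hEp _ _) (η := fun i => (1 / 2) ^ i.unpair.1 * (1 / 2) ^ i.unpair.2)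
    (fun i => by positivity)
  have hpp : star M.starProjection * M.starProjection = M.starProjection := by
    rw [star_starProjection, starProjection_mul_self]
  have hne : ∀ n k k', k ≠ k' → Nat.pair n k ≠ Nat.pair n k' := fun n k k' hk he =>
    hk (Nat.pair_eq_pair.1 he).2
  choose W hW hWn using fun n : ℕ => exists_strong_sum (S := fun k => S (Nat.pair n k))
    (fun k k' hk => hort _ _ (hne n k k' hk)) (p := M.starProjection) (fun x => by
      simpa only [hS, Nat.unpair_pair] using hs n x)
  have hsum : ∀ n : ℕ, HasSum (fun k : ℕ => (2 * (1 / 2) ^ n) * (1 / 2 : ℝ) ^ k)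
      ((2 * (1 / 2) ^ n) * 2) := fun n => hasSum_geometric_two.mul_left _
  refine ⟨W, fun n => (2 * (1 / 2) ^ n) * 2, ⟨fun n => ?_, fun {n m} hnm => ?_, fun n => ?_,
    star_starProjection M⟩, ?_, fun n => ?_, fun n => ?_⟩
  · exact star_mul_self_eq_of_norm hpp (hWn n)
  · ext x
    refine ext_inner_left ℂ fun y => ?_
    rw [mul_apply_eq_comp, inner_apply_star]
    simp only [zero_apply, inner_zero_right]
    exact inner_eq_zero_of_hasSum (hW n y) (hW m x) fun k k' =>
      hort _ _ (fun he => hnm (Nat.pair_eq_pair.1 he).1) _ _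
  · ext x
    rw [← sub_eq_zero, mul_apply_eq_comp, ← map_sub, ← norm_eq_zero, ← sq_eq_zero_iff, hWn,
      map_sub, ← mul_apply_eq_comp, starProjection_mul_self, sub_self]
    simp
  · exact (summable_geometric_two.mul_left 2).mul_right 2
  · refine norm_intertwine_strong_sum_le (hW n) (hsum n) fun k => (h1 _).trans ?_
    have := hc n k
    simp only [Nat.unpair_pair]
    linarith
  · refine norm_intertwine_strong_sum_le (hW n) (hsum n) fun k => (h2 _).trans ?_
    have := hc n k
    simp only [Nat.unpair_pair]
    linarith

end IsWeaklyNullIntertwiner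

section WeakLimit

variable {ι : Type*}

/-- Contractions have weak limits along ultrafilters. -/
theorem exists_weak_limit (l : Ultrafilter ι) {u : ι → H →L[ℂ] H} (hu : ∀ n x, ‖u n x‖ ≤ ‖x‖) :
    ∃ T : H →L[ℂ] H, ∀ x y, Tendsto (fun n => ⟪u n x, y⟫) l (nhds ⟪T x, y⟫) := by
  have hb : ∀ x y n, ‖⟪u n x, y⟫‖ ≤ 1 * ‖x‖ * ‖y‖ := fun x y n => by
    rw [one_mul]
    exact (norm_inner_le_norm _ _).trans (mul_le_mul_of_nonneg_right (hu n x) (norm_nonneg y))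
  have hlim : ∀ x y, ∃ z : ℂ, Tendsto (fun n => ⟪u n x, y⟫) l (nhds z) := by
    intro x y
    obtain ⟨z, -, hz⟩ := (isCompact_closedBall (0 : ℂ) (1 * ‖x‖ * ‖y‖)).ultrafilter_le_nhds
      (l.map fun n => ⟪u n x, y⟫) (by
        rw [le_principal_iff]
        exact Eventually.of_forall (f := (l : Filter ι)) fun n => by simpa using hb x y n)
    exact ⟨z, hz⟩
  choose b hbl using hlim
  let B : H →L⋆[ℂ] H →L[ℂ] ℂ := LinearMap.mkContinuous₂ (LinearMap.mk₂'ₛₗ (starRingEnd ℂ)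
    (RingHom.id ℂ) b
    (fun x x' y => tendsto_nhds_unique (hbl _ _) (((hbl x y).add (hbl x' y)).congr fun n => by
      rw [map_add, inner_add_left]))
    (fun c x y => tendsto_nhds_unique (hbl _ _) (((hbl x y).const_mul _).congr fun n => by
      rw [map_smul, inner_smul_left]))
    (fun x y y' => tendsto_nhds_unique (hbl _ _) (((hbl x y).add (hbl x y')).congr fun n => by
      rw [inner_add_right]))
    (fun c x y => tendsto_nhds_unique (hbl _ _) (((hbl x y).const_mul _).congr fun n => by
      rw [inner_smul_right]; rfl))) 1
    (fun x y => le_of_tendsto (hbl x y).norm (Eventually.of_forall (hb x y)))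
  refine ⟨InnerProductSpace.continuousLinearMapOfBilin B, fun x y => ?_⟩
  rw [InnerProductSpace.continuousLinearMapOfBilin_apply]
  exact hbl x y

variable {l : Filter ι} {u : ι → H →L[ℂ] H} {T X Y : H →L[ℂ] H}

theorem tendsto_inner_star (hT : ∀ x y, Tendsto (fun n => ⟪u n x, y⟫) l (nhds ⟪T x, y⟫)) (x y : H) :
    Tendsto (fun n => ⟪star (u n) x, y⟫) l (nhds ⟪star T x, y⟫) := by
  have h := (Complex.continuous_conj.tendsto _).comp (hT y x)
  rw [inner_conj_symm, ← inner_star_apply] at h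
  refine h.congr fun n => ?_
  rw [Function.comp_apply, inner_conj_symm, inner_star_apply]

theorem weak_limit_intertwines [l.NeBot]
    (hT : ∀ x y, Tendsto (fun n => ⟪u n x, y⟫) l (nhds ⟪T x, y⟫))
    (h : Tendsto (fun n => ‖X * u n - u n * Y‖) l (nhds 0)) : X * T = T * Y := by
  ext x
  refine ext_inner_right ℂ fun y => ?_
  rw [mul_apply_eq_comp, mul_apply_eq_comp, ← inner_apply_star]
  refine tendsto_nhds_unique (hT x (star X y)) ?_
  have h1 : Tendsto (fun n => ⟪(X * u n - u n * Y) x, y⟫) l (nhds 0) := by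
    refine squeeze_zero_norm (fun n => ?_) (by simpa using (h.mul_const ‖x‖).mul_const ‖y‖)
    exact (norm_inner_le_norm _ _).trans
      (mul_le_mul_of_nonneg_right ((X * u n - u n * Y).le_opNorm x) (norm_nonneg y))
  have h2 := h1.add (hT (Y x) y)
  rw [zero_add] at h2
  refine h2.congr fun n => ?_
  rw [inner_apply_star, ← inner_add_left]
  simp

theorem isWeaklyNullIntertwiner_ker (hu : ∀ n, u n ∈ unitary (H →L[ℂ] H))
    (hT : ∀ x y, Tendsto (fun n => ⟪u n x, y⟫) l (nhds ⟪T x, y⟫))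
    (h : Tendsto (fun n => ‖X * u n - u n * Y‖) l (nhds 0))
    (h' : Tendsto (fun n => ‖star X * u n - u n * star Y‖) l (nhds 0)) {p : H →L[ℂ] H}
    (hp : star p = p) (hTp : T * p = 0) : IsWeaklyNullIntertwiner l u X Y p where
  mem_unitary := hu
  star_proj := hp
  weak x y := by
    have h1 := (Complex.continuous_conj.tendsto _).comp (hT (p x) y)
    rw [← mul_apply_eq_comp T, hTp] at h1
    simp only [zero_apply, inner_zero_left, map_zero] at h1
    refine h1.congr fun n => ?_
    rw [Function.comp_apply, inner_conj_symm]
  intertwine := h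
  star_intertwine := h'

theorem norm_star_intertwine {v : H →L[ℂ] H} (hv : v ∈ unitary (H →L[ℂ] H)) :
    ‖Y * star v - star v * X‖ = ‖X * v - v * Y‖ := by
  have : Y * star v - star v * X = -(star v * (X * v - v * Y) * star v) := by
    have h1 : star v * (X * v - v * Y) * star v =
        star v * X * (v * star v) - (star v * v) * Y * star v := by noncomm_ring
    rw [h1, hv.1, hv.2]
    noncomm_ring
  rw [this, norm_neg, CStarRing.norm_mul_mem_unitary _ (Unitary.star_mem hv),
    CStarRing.norm_mem_unitary_mul _ (Unitary.star_mem hv)]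

end WeakLimit

section Polar

theorem eq_zero_of_mul_eq_zero {A T q : H →L[ℂ] H} (hq : ∀ x, star T x = 0 → q x = x)
    (hqs : star q = q) (hT : A * T = 0) (h : A * q = 0) : A = 0 := by
  have h1 : star T * star A = 0 := by rw [← star_mul, hT, star_zero]
  have h2 : q * star A = 0 := by rw [← star_zero, ← h, star_mul, hqs]
  have h3 : star A = 0 := by
    ext x
    rw [← hq (star A x) (congrArg (fun B : H →L[ℂ] H => B x) h1)]
    exact congrArg (fun B : H →L[ℂ] H => B x) h2
  rw [← star_star A, h3, star_zero]

theorem exists_factor {R T p : H →L[ℂ] H} (hR : star R = R) (hRp : R * p = 0)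
    (h : ∀ x, ‖T x‖ = ‖R x‖) : ∃ U : H →L[ℂ] H, U * R = T ∧ U * p = 0 := by
  set K := (LinearMap.range (R : H →ₗ[ℂ] H)).topologicalClosure with hK
  have : CompleteSpace K := (Submodule.isClosed_topologicalClosure _).completeSpace_coe
  have hmem : ∀ x, R x ∈ K := fun x => Submodule.le_topologicalClosure _ ⟨x, rfl⟩
  let e : H →ₗ[ℂ] K := (R : H →ₗ[ℂ] H).codRestrict K hmem
  have he : DenseRange e := by
    intro z
    rw [closure_subtype]
    refine closure_mono ?_ z.2
    rintro _ ⟨x, rfl⟩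
    exact ⟨e x, ⟨x, rfl⟩, rfl⟩
  have hn : ∃ C, ∀ x, ‖(T : H →ₗ[ℂ] H) x‖ ≤ C * ‖e x‖ := ⟨1, fun x => by
    rw [one_mul]; exact (h x).le⟩
  refine ⟨(LinearMap.extendOfNorm (T : H →ₗ[ℂ] H) e) ∘L K.orthogonalProjectionOnto, ?_, ?_⟩
  · ext x
    have h1 : K.orthogonalProjectionOnto (R x) = e x :=
      Submodule.orthogonalProjectionOnto_mem_subspace_eq_self (e x)
    change LinearMap.extendOfNorm (T : H →ₗ[ℂ] H) e (K.orthogonalProjectionOnto (R x)) = T x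
    rw [h1, LinearMap.extendOfNorm_eq he hn]
    rfl
  · ext x
    have h1 : p x ∈ Kᗮ := by
      rw [hK, Submodule.orthogonal_closure]
      rintro _ ⟨y, rfl⟩
      change ⟪R y, p x⟫ = 0
      rw [← inner_apply_star, hR, ← mul_apply_eq_comp, hRp]
      simp
    change LinearMap.extendOfNorm (T : H →ₗ[ℂ] H) e (K.orthogonalProjectionOnto (p x)) = 0
    rw [Submodule.orthogonalProjectionOnto_eq_zero_iff.2 h1, map_zero]

/-- The polar part of an intertwiner is an intertwiner. -/
theorem exists_polar_s6 {T X Y p q : H →L[ℂ] H} (hXT : X * T = T * Y)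
    (hXT' : star X * T = T * star Y) (hp : star p = p) (hpk : ∀ x, T x = 0 → p x = x)
    (hTp : T * p = 0) (hqX : Commute q X) (hq : star q = q) (hqk : ∀ x, star T x = 0 → q x = x)
    (hTq : star T * q = 0) :
    ∃ U : H →L[ℂ] H, star U * U = 1 - p ∧ U * star U = 1 - q ∧ U * p = 0 ∧ q * U = 0 ∧
      star U * X = Y * star U := by
  set R := CFC.sqrt (star T * T) with hRdef
  have hRR : R * R = star T * T := CFC.sqrt_mul_sqrt_self _ (star_mul_self_nonneg T)
  have hR : star R = R := (IsSelfAdjoint.of_nonneg (CFC.sqrt_nonneg _)).star_eq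
  have hnorm : ∀ x, ‖T x‖ = ‖R x‖ := by
    intro x
    have h1 : ⟪T x, T x⟫ = ⟪R x, R x⟫ := by
      rw [← inner_star_apply, ← inner_star_apply, hR, ← mul_apply_eq_comp, ← mul_apply_eq_comp, hRR]
    rw [norm_eq_sqrt_re_inner (𝕜 := ℂ), h1, ← norm_eq_sqrt_re_inner]
  have hcomm : Commute R Y := by
    have h1 : Commute (star T * T) Y := by
      have h2 := congrArg star hXT'
      rw [star_mul, star_mul, star_star, star_star] at h2
      rw [commute_iff_eq, mul_assoc, ← hXT, ← mul_assoc, h2, mul_assoc]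
    exact h1.cfcₙ_nnreal _
  have hRp : R * p = 0 := by
    ext x
    change (R * p) x = 0
    rw [← norm_eq_zero, mul_apply_eq_comp, ← hnorm, ← mul_apply_eq_comp, hTp]
    simp
  have hpR : ∀ x, star R x = 0 → p x = x := fun x hx => hpk x (by
    rw [← norm_eq_zero, hnorm, ← hR, hx, norm_zero])
  have hpp : p * p = p := by
    ext x
    exact hpk (p x) (congrArg (fun B : H →L[ℂ] H => B x) hTp)
  have hqq : q * q = q := by
    ext x
    exact hqk (q x) (congrArg (fun B : H →L[ℂ] H => B x) hTq)
  obtain ⟨U, hUR, hUp⟩ := exists_factor hR hRp hnorm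
  have hpR0 : p * R = 0 := by rw [← hR, ← hp, ← star_mul, hRp, star_zero]
  have hpU : p * star U = 0 := by rw [← hp, ← star_mul, hUp, star_zero]
  have hRU : R * star U = star T := by rw [← hUR, star_mul, hR]
  have hqT : q * T = 0 := by rw [← star_star (q * T), star_mul, hq, hTq, star_zero]
  have hUT : star U * T = R := by
    rw [← sub_eq_zero, ← star_eq_zero]
    refine eq_zero_of_mul_eq_zero hpR hp ?_ ?_
    · rw [← star_eq_zero, star_mul, star_star, hR, mul_sub, ← mul_assoc, hRU, hRR, sub_self]
    · rw [← star_eq_zero, star_mul, star_star, hp, mul_sub, ← mul_assoc, hpU, hpR0, zero_mul,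
        sub_self]
  have hqU : q * U = 0 := by
    refine eq_zero_of_mul_eq_zero hpR hp ?_ ?_
    · rw [mul_assoc, hUR, hqT]
    · rw [mul_assoc, hUp, mul_zero]
  have hUq : star U * q = 0 := by rw [← hq, ← star_mul, hqU, star_zero]
  refine ⟨U, ?_, ?_, hUp, hqU, ?_⟩
  · rw [← sub_eq_zero]
    refine eq_zero_of_mul_eq_zero hpR hp ?_ ?_
    · rw [sub_mul, mul_assoc, hUR, hUT, sub_mul, hpR0, one_mul, sub_zero, sub_self]
    · rw [sub_mul, mul_assoc, hUp, sub_mul, hpp, one_mul, sub_self, mul_zero, sub_self]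
  · rw [← sub_eq_zero]
    refine eq_zero_of_mul_eq_zero hqk hq ?_ ?_
    · rw [sub_mul, mul_assoc, hUT, hUR, sub_mul, hqT, one_mul, sub_zero, sub_self]
    · rw [sub_mul, mul_assoc, hUq, sub_mul, hqq, one_mul, sub_self, mul_zero, sub_self]
  · rw [← sub_eq_zero]
    refine eq_zero_of_mul_eq_zero hqk hq ?_ ?_
    · rw [sub_mul, mul_assoc, hXT, mul_assoc, hUT, ← mul_assoc, hUT, hcomm.eq, sub_self]
    · rw [sub_mul, mul_assoc, ← hqX.eq, mul_assoc, hUq, ← mul_assoc, hUq, zero_mul, mul_zero,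
        sub_self]

end Polar

theorem star_mul_eq_zero_of_add_eq_one {B V p : H →L[ℂ] H} (hB : star B * B = 1)
    (hV : star V * V = p) (hBV : B * star B + V * star V = 1) (hVp : V * p = V) :
    star B * V = 0 := by
  have h := congrArg (fun A => star B * A * V) hBV
  have e : star B * (B * star B + V * star V) * V =
      star B * B * (star B * V) + star B * (V * (star V * V)) := by noncomm_ring
  simp only [e, hB, hV, hVp, mul_one, one_mul] at h
  exact left_eq_add.mp h.symm

/-- `X ⊕ Y|ker T` and `Y ⊕ X|ker T*` are unitarily equivalent. -/
theorem exists_unitary_conj {X Y C C' B V B' W U p q : H →L[ℂ] H}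
    (hB : star B * B = 1) (hV : star V * V = p) (hBV : B * star B + V * star V = 1)
    (hVp : V * p = V) (hCB : C * B = B * X) (hCV : C * V = V * Y)
    (hB' : star B' * B' = 1) (hW : star W * W = q) (hBW : B' * star B' + W * star W = 1)
    (hWq : W * q = W) (hCB' : C' * B' = B' * Y) (hCW : C' * W = W * X)
    (hp : star p = p) (hpY : Commute p Y)
    (hUU : star U * U = 1 - p) (hUU' : U * star U = 1 - q) (hUp : U * p = 0) (hqU : q * U = 0)
    (hUX : star U * X = Y * star U) :
    ∃ v ∈ unitary (H →L[ℂ] H), v * C = C' * v := by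
  have hBV0 : star B * V = 0 := star_mul_eq_zero_of_add_eq_one hB hV hBV hVp
  have hBW0 : star B' * W = 0 := star_mul_eq_zero_of_add_eq_one hB' hW hBW hWq
  have hVB0 : star V * B = 0 := by rw [← star_star (star V * B), star_mul, star_star, hBV0, star_zero]
  have hWB0 : star W * B' = 0 := by
    rw [← star_star (star W * B'), star_mul, star_star, hBW0, star_zero]
  have hUV : U * star V = 0 := by
    rw [← hVp, star_mul, hp, ← mul_assoc, hUp, zero_mul]
  have hVU : V * star U = 0 := by rw [← star_star (V * star U), star_mul, star_star, hUV, star_zero]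
  have hWU : W * U = 0 := by rw [← hWq, mul_assoc, hqU, mul_zero]
  have hUW : star U * star W = 0 := by rw [← star_mul, hWU, star_zero]
  have hpV : p * star V = star V := by
    conv_rhs => rw [← hVp, star_mul, hp]
  set v := W * star B + B' * star U * star B + B' * star V with hv
  have hvs : star v = B * star W + B * U * star B' + V * star B' := by
    simp only [hv, star_add, star_mul, star_star, mul_assoc]
  have hvB : v * B = W + B' * star U := by
    have : v * B = W * (star B * B) + B' * star U * (star B * B) + B' * (star V * B) := by
      rw [hv]; noncomm_ring
    rw [this, hB, hVB0]; simp
  have hvV : v * V = B' * p := by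
    have : v * V = W * (star B * V) + B' * star U * (star B * V) + B' * (star V * V) := by
      rw [hv]; noncomm_ring
    rw [this, hV, hBV0]; simp
  refine ⟨v, ⟨?_, ?_⟩, ?_⟩
  · have : star v * v = B * (star W * W) * star B + B * (star W * B') * (star U * star B + star V) +
        (B * U + V) * (star B' * W) * star B + B * (U * (star B' * B') * star U) * star B +
        B * (U * (star B' * B') * star V) + V * (star B' * B') * star U * star B +
        V * (star B' * B') * star V := by
      rw [hvs, hv]; noncomm_ring
    rw [this, hW, hWB0, hBW0, hB', mul_one, mul_one, hUU', hUV, hVU]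
    refine Eq.trans ?_ hBV
    noncomm_ring
  · rw [hvs, mul_add, mul_add, ← mul_assoc, ← mul_assoc, ← mul_assoc, ← mul_assoc, hvB, hvV]
    have : (W + B' * star U) * star W + (W + B' * star U) * U * star B' + B' * p * star B' =
        W * star W + B' * (star U * star W) + W * U * star B' + B' * (star U * U + p) * star B' := by
      noncomm_ring
    rw [this, hUW, hWU, hUU, sub_add_cancel]
    refine Eq.trans ?_ hBW
    noncomm_ring
  · have hC : C = B * X * star B + V * Y * star V := by
      rw [← hCB, ← hCV, mul_assoc, mul_assoc, ← mul_add, hBV, mul_one]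
    have h1 : v * C = v * B * X * star B + v * V * Y * star V := by
      rw [hC]; noncomm_ring
    have h2 : C' * v = C' * W * star B + C' * B' * star U * star B + C' * B' * star V := by
      rw [hv]; noncomm_ring
    have h3 : B' * p * Y * star V = B' * Y * star V := by
      rw [mul_assoc B', hpY.eq, mul_assoc, mul_assoc, hpV, mul_assoc]
    have h4 : (W + B' * star U) * X * star B = W * X * star B + B' * (star U * X) * star B := by
      noncomm_ring
    rw [h1, h2, hvB, hvV, hCW, hCB', h3, h4, hUX, ← mul_assoc B' Y]

theorem StrongInternalPathOp.conj {Y C C' v : H →L[ℂ] H} (h : StrongInternalPathOp Y C')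
    (hv : v ∈ unitary (H →L[ℂ] H)) (hC : v * C = C' * v) : StrongInternalPathOp Y C := by
  obtain ⟨γ, hγ, hu, hlim⟩ := h
  refine ⟨fun t => γ t * v, hγ.mul continuousOn_const, fun t ht => mul_mem (hu t ht) hv, ?_⟩
  have h1 : C = star v * C' * v := by
    rw [mul_assoc, ← hC, ← mul_assoc, hv.1, one_mul]
  rw [h1]
  refine ((hlim.const_mul (star v)).mul_const v).congr fun t => ?_
  rw [star_mul]
  noncomm_ring

omit [CompleteSpace H] in
theorem mem_ker_of_intertwines {T X Y : H →L[ℂ] H} (h : X * T = T * Y) {x : H}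
    (hx : x ∈ LinearMap.ker (T : H →ₗ[ℂ] H)) : Y x ∈ LinearMap.ker (T : H →ₗ[ℂ] H) := by
  have hx' : T x = 0 := hx
  change T (Y x) = 0
  rw [← mul_apply_eq_comp, ← h, mul_apply_eq_comp, hx', map_zero]

omit [CompleteSpace H] in
theorem isClosed_ker_coe (T : H →L[ℂ] H) :
    IsClosed (LinearMap.ker (T : H →ₗ[ℂ] H) : Set H) :=
  isClosed_singleton.preimage T.continuous

theorem exists_intertwining_seq {X Y : H →L[ℂ] H} (hY : Y ∈ closure (opUnitaryOrbit X)) :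
    ∃ u : ℕ → H →L[ℂ] H, (∀ n, u n ∈ unitary (H →L[ℂ] H)) ∧
      Tendsto (fun n => ‖X * u n - u n * Y‖) atTop (nhds 0) ∧
      Tendsto (fun n => ‖star X * u n - u n * star Y‖) atTop (nhds 0) := by
  obtain ⟨Z, hZ, hlim⟩ := mem_closure_iff_seq_limit.1 hY
  choose u hu hZu using hZ
  have h0 := tendsto_iff_norm_sub_tendsto_zero.1 hlim
  have e : ∀ n (A D : H →L[ℂ] H), ‖A * u n - u n * D‖ = ‖star (u n) * A * u n - D‖ := by
    intro n A D
    rw [← CStarRing.norm_mem_unitary_mul (A * u n - u n * D) (Unitary.star_mem (hu n)), mul_sub,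
      ← mul_assoc, ← mul_assoc, (hu n).1, one_mul]
  refine ⟨u, hu, h0.congr fun n => ?_, h0.congr fun n => ?_⟩
  · rw [e, hZu]
  · rw [e, hZu, ← norm_star]
    simp [mul_assoc]

theorem exists_common_strongInternalPath [TopologicalSpace.SeparableSpace H]
    (hinf : ¬ FiniteDimensional ℂ H) {X Y : H →L[ℂ] H} (hY : Y ∈ closure (opUnitaryOrbit X)) :
    ∃ C, StrongInternalPathOp X C ∧ StrongInternalPathOp Y C := by
  obtain ⟨u, hu, h1, h2⟩ := exists_intertwining_seq hY
  set l : Ultrafilter ℕ := hyperfilter ℕ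
  have hl : (l : Filter ℕ) ≤ atTop := by
    rw [← Nat.cofinite_eq_atTop]; exact hyperfilter_le_cofinite
  replace h1 := h1.mono_left hl
  replace h2 := h2.mono_left hl
  obtain ⟨T, hT⟩ := exists_weak_limit l fun n x => (unitary_norm_apply (hu n).1 x).le
  have hXT : X * T = T * Y := weak_limit_intertwines hT h1
  have hXT' : star X * T = T * star Y := weak_limit_intertwines hT h2
  have hYT : Y * star T = star T * X := by simpa using (congrArg star hXT').symm
  have hYT' : star Y * star T = star T * star X := by simpa using (congrArg star hXT).symm
  have hT' := tendsto_inner_star hT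
  have h1' : Tendsto (fun n => ‖Y * star (u n) - star (u n) * X‖) l (nhds 0) :=
    h1.congr fun n => (norm_star_intertwine (hu n)).symm
  have h2' : Tendsto (fun n => ‖star Y * star (u n) - star (u n) * star X‖) l (nhds 0) :=
    h2.congr fun n => (norm_star_intertwine (hu n)).symm
  set M : Submodule ℂ H := LinearMap.ker (T : H →ₗ[ℂ] H)
  set N : Submodule ℂ H := LinearMap.ker ((star T : H →L[ℂ] H) : H →ₗ[ℂ] H)
  have hMc : IsClosed (M : Set H) := isClosed_ker_coe T
  have hNc : IsClosed (N : Set H) := isClosed_ker_coe (star T)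
  have : CompleteSpace M := hMc.completeSpace_coe
  have : CompleteSpace N := hNc.completeSpace_coe
  have hMY : ∀ x ∈ M, Y x ∈ M := fun x => mem_ker_of_intertwines hXT
  have hMY' : ∀ x ∈ M, star Y x ∈ M := fun x => mem_ker_of_intertwines hXT'
  have hNX : ∀ x ∈ N, X x ∈ N := fun x => mem_ker_of_intertwines hYT
  have hNX' : ∀ x ∈ N, star X x ∈ N := fun x => mem_ker_of_intertwines hYT'
  have hTp : T * M.starProjection = 0 := by
    ext x; exact Submodule.starProjection_apply_mem M x
  have hTq : star T * N.starProjection = 0 := by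
    ext x; exact Submodule.starProjection_apply_mem N x
  have hp := star_starProjection M
  have hpY : Commute M.starProjection Y := commute_starProjection_of_reducing hMY hMY'
  obtain ⟨W, ε, hW, hε, hW1, hW2⟩ := (isWeaklyNullIntertwiner_ker hu hT h1 h2
    hp hTp).exists_isOrthoIsometrySeq hinf hMc hMY hMY'
  obtain ⟨C, B, V, hXC, hB, hV, hBV, hVp, hCB, hCV⟩ := hW.exists_strongInternalPath hε hW1 hW2
  obtain ⟨W', ε', hW', hε', hW1', hW2'⟩ := (isWeaklyNullIntertwiner_ker
    (fun n => Unitary.star_mem (hu n)) hT' h1' h2' (star_starProjection N)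
    hTq).exists_isOrthoIsometrySeq hinf hNc hNX hNX'
  obtain ⟨C', B', V', hYC', hB', hV', hBV', hVp', hCB', hCV'⟩ :=
    hW'.exists_strongInternalPath hε' hW1' hW2'
  obtain ⟨U, hUU, hUU', hUp, hqU, hUX⟩ := exists_polar_s6 hXT hXT' hp
    (fun x hx => Submodule.starProjection_eq_self_iff.2 hx) hTp
    (commute_starProjection_of_reducing hNX hNX') (star_starProjection N)
    (fun x hx => Submodule.starProjection_eq_self_iff.2 hx) hTq
  obtain ⟨v, hv, hvC⟩ := exists_unitary_conj hB hV hBV hVp hCB hCV hB' hV' hBV' hVp' hCB' hCV' hp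
    hpY hUU hUU' hUp hqU hUX
  exact ⟨C, hXC, hYC'.conj hv hvC⟩

theorem stmt6 [TopologicalSpace.SeparableSpace H] (hinf : ¬ FiniteDimensional ℂ H)
    (X Y : H →L[ℂ] H) (hY : Y ∈ closure (opUnitaryOrbit X)) :
    (∃ C ∈ closure (opUnitaryOrbit X), StrongInternalPathOp X C ∧ StrongInternalPathOp Y C) ∧
    IsPathConnected (closure (opUnitaryOrbit X)) := by
  have hX : X ∈ closure (opUnitaryOrbit X) :=
    subset_closure ⟨1, one_mem _, by rw [star_one, one_mul, mul_one]⟩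
  refine ⟨?_, X, hX, fun {Z} hZ => ?_⟩
  · obtain ⟨C, hXC, hYC⟩ := exists_common_strongInternalPath hinf hY
    exact ⟨C, hXC.mem_closure hX, hXC, hYC⟩
  · obtain ⟨C, hXC, hZC⟩ := exists_common_strongInternalPath hinf hZ
    exact (hXC.joinedIn hX).trans (hZC.joinedIn hZ).symm
end
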